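/- Let n ≥ 4, let Γ be a finite-index subgroup of SL(n,ℤ), and let ρ : Γ → Bir(ℙ²_ℂ) = Aut_ℂ(ℂ(x,y)) be a group homomorphism. Then the image of ρ is finite. (Equivalently: if a morphism from a finite-index subgroup of SL(n,ℤ) into Bir(ℙ²_ℂ) has infinite image, then n ≤ 3.) -/

import Mathlib

set_option autoImplicit false

noncomputable section

/-- The field `ℂ(x,y)` of rational functions in two variables over `ℂ`. -/
abbrev K2 : Type := FractionRing (MvPolynomial (Fin 2) ℂ)

/-- The plane Cremona group `Bir(ℙ²_ℂ)`, identified with the group `Aut_ℂ(ℂ(x,y))`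
of `ℂ`-algebra automorphisms of `ℂ(x,y)`. -/
abbrev Cremona2 : Type := K2 ≃ₐ[ℂ] K2

/-- The coordinate function `x`. -/
def X0 : K2 := algebraMap (MvPolynomial (Fin 2) ℂ) K2 (MvPolynomial.X 0)

/-- The coordinate function `y`. -/
def X1 : K2 := algebraMap (MvPolynomial (Fin 2) ℂ) K2 (MvPolynomial.X 1)

namespace SLn
open Matrix
open scoped commutatorElement

variable {ι : Type*} [Fintype ι] [DecidableEq ι]

/-- The elementary matrix `1 + t E_{ij}` as an element of `SL`. -/
abbrev elem {i j : ι} (h : i ≠ j) (t : ℤ) : SpecialLinearGroup ι ℤ :=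
  SpecialLinearGroup.transvection h t

theorem elem_smul {i j : ι} (h : i ≠ j) (t : ℤ) (v : ι → ℤ) :
    elem h t • v = Function.update v i (v i + t * v j) := by
  have h1 : elem h t • v = (1 + Matrix.single i j t) *ᵥ v := rfl
  rw [h1, Matrix.add_mulVec, Matrix.one_mulVec]
  ext k
  by_cases hk : k = i
  · subst hk; simp [Matrix.single_mulVec]
  · simp [hk, Matrix.single_mulVec]

theorem commutator_elem {i j k : ι} (hij : i ≠ j) (hjk : j ≠ k) (hik : i ≠ k) (s t : ℤ) :
    ⁅elem hij s, elem hjk t⁆ = elem hik (s * t) := by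
  rw [commutatorElement_def, mul_inv_eq_iff_eq_mul, mul_inv_eq_iff_eq_mul]
  apply Subtype.ext
  simp [SpecialLinearGroup.transvection_coe, mul_add, add_mul, hjk.symm, hik.symm,
    Matrix.single_mul_single_of_ne, Matrix.single_mul_single_same]
  abel

theorem commute_elem {i j k l : ι} (hij : i ≠ j) (hkl : k ≠ l) (hjk : j ≠ k) (hil : i ≠ l)
    (s t : ℤ) : Commute (elem hij s) (elem hkl t) := by
  apply Subtype.ext
  simp [SpecialLinearGroup.transvection_coe, mul_add, add_mul, hjk, hil.symm,
    Matrix.single_mul_single_of_ne]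
  abel

theorem smul_single_apply (g : SpecialLinearGroup ι ℤ) (i k : ι) :
    (g • (Pi.single i 1 : ι → ℤ)) k = (g : Matrix ι ι ℤ) k i := by
  have h1 : g • (Pi.single i 1 : ι → ℤ) = (g : Matrix ι ι ℤ) *ᵥ Pi.single i 1 := rfl
  rw [h1, Matrix.mulVec_single_one]
  rfl

theorem smul_apply (g : SpecialLinearGroup ι ℤ) (v : ι → ℤ) (k : ι) :
    (g • v) k = ∑ l, (g : Matrix ι ι ℤ) k l * v l := by
  rw [Matrix.SpecialLinearGroup.smul_def]
  rfl

theorem eq_one_of_forall_smul_single {g : SpecialLinearGroup ι ℤ}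
    (h : ∀ i, g • (Pi.single i 1 : ι → ℤ) = Pi.single i 1) : g = 1 := by
  apply Subtype.ext
  ext k i
  rw [← smul_single_apply, h i]
  simp [Matrix.one_apply, Pi.single_apply]

/-- Adding to the coordinate `j` combinations of the coordinates in `S`, with coefficients divisible
by `N`, is achieved by a subgroup containing the elementary matrices of level `N`. -/
theorem exists_smul_eq_add_sum {P : Subgroup (SpecialLinearGroup ι ℤ)} (N : ℤ) (j : ι)
    (S : Finset ι) (hj : j ∉ S)
    (hP : ∀ l ∈ S, ∀ h : j ≠ l, ∀ t : ℤ, elem h (N * t) ∈ P) (v c : ι → ℤ) :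
    ∃ h ∈ P, h • v = Function.update v j (v j + N * ∑ l ∈ S, c l * v l) := by
  induction S using Finset.induction_on with
  | empty => exact ⟨1, P.one_mem, by simp⟩
  | insert a S ha ih =>
    have hja : j ≠ a := by rintro rfl; simp at hj
    obtain ⟨h, hh, e⟩ := ih (by simp at hj; tauto)
      (fun l hl => hP l (Finset.mem_insert_of_mem hl))
    refine ⟨elem hja (N * c a) * h, P.mul_mem (hP a (Finset.mem_insert_self _ _) hja _) hh, ?_⟩
    rw [mul_smul, e, elem_smul, Finset.sum_insert ha]
    simp [hja.symm]
    congr 1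
    ring

/-- Subtracting multiples of a coordinate equal to `1` from the other ones. -/
theorem exists_smul_eq_single_of_apply_eq_one {P : Subgroup (SpecialLinearGroup ι ℤ)} (N : ℤ)
    (i : ι) (hP : ∀ l, ∀ h : l ≠ i, ∀ t : ℤ, elem h (N * t) ∈ P) (v : ι → ℤ) (hi : v i = 1)
    (hv : ∀ l, l ≠ i → N ∣ v l) :
    ∃ h ∈ P, h • v = Pi.single i 1 := by
  suffices H : ∀ S : Finset ι, i ∉ S → ∃ h ∈ P, h • v = fun l => if l ∈ S then 0 else v l by
    obtain ⟨h, hh, e⟩ := H (Finset.univ.erase i) (by simp)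
    refine ⟨h, hh, ?_⟩
    rw [e]
    ext l
    by_cases hl : l = i
    · subst hl; simp [hi]
    · simp [hl]
  intro S
  induction S using Finset.induction_on with
  | empty => exact fun _ => ⟨1, P.one_mem, by simp⟩
  | insert a S ha ih =>
    intro hS
    have hai : a ≠ i := by rintro rfl; simp at hS
    have hiS : i ∉ S := by simp at hS; tauto
    obtain ⟨h, hh, e⟩ := ih hiS
    obtain ⟨q, hq⟩ := hv a hai
    refine ⟨elem hai (N * -q) * h, P.mul_mem (hP a hai _) hh, ?_⟩
    rw [mul_smul, e, elem_smul]
    ext l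
    by_cases hl : l = a
    · subst hl
      simp [ha, hiS, hi, hq]
    · simp [hl]

theorem exists_isCoprime_add_mul {a b c : ℤ} (ha : a ≠ 0) (x y z : ℤ)
    (h : x * a + y * b + z * c = 1) : ∃ s, IsCoprime a (b + s * c) := by
  classical
  set F : Finset ℕ := a.natAbs.primeFactors.filter (fun q : ℕ => ¬ (q : ℤ) ∣ b) with hF
  refine ⟨∏ q ∈ F, ((q : ℕ) : ℤ), ?_⟩
  set s := ∏ q ∈ F, ((q : ℕ) : ℤ) with hs
  rw [Int.isCoprime_iff_gcd_eq_one]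
  by_contra hg
  obtain ⟨q, hq, hqg⟩ := Nat.exists_prime_and_dvd hg
  have hqa : (q : ℤ) ∣ a := (Int.natCast_dvd_natCast.2 hqg).trans (Int.gcd_dvd_left ..)
  have hqb : (q : ℤ) ∣ b + s * c := (Int.natCast_dvd_natCast.2 hqg).trans (Int.gcd_dvd_right ..)
  have hqp : Prime (q : ℤ) := Nat.prime_iff_prime_int.1 hq
  by_cases hb : (q : ℤ) ∣ b
  · have h1 : (q : ℤ) ∣ s * c := (dvd_add_right hb).1 hqb
    rcases hqp.dvd_or_dvd h1 with h2 | h2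
    · rw [hs, hqp.dvd_finsetProd_iff] at h2
      obtain ⟨r, hr, hqr⟩ := h2
      simp only [hF, Finset.mem_filter, Nat.mem_primeFactors] at hr
      have : q = r := (Nat.prime_dvd_prime_iff_eq hq hr.1.1).1 (Int.natCast_dvd_natCast.1 hqr)
      subst this
      exact hr.2 hb
    · apply hqp.not_dvd_one
      rw [← h]
      exact dvd_add (dvd_add (hqa.mul_left _) (hb.mul_left _)) (h2.mul_left _)
  · apply hb
    have : (q : ℤ) ∣ s := Finset.dvd_prod_of_mem (fun q : ℕ => (q : ℤ))
      (Finset.mem_filter.2 ⟨Nat.mem_primeFactors.2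
        ⟨hq, Int.natCast_dvd.1 hqa, by simpa using ha⟩, hb⟩)
    exact (dvd_add_left (this.mul_right c)).1 hqb

/-- The congruence subgroup of level `N`. -/
def congr (N : ℕ) : Subgroup (SpecialLinearGroup ι ℤ) :=
  (SpecialLinearGroup.map (n := ι) (Int.castRingHom (ZMod N))).ker

instance (N : ℕ) : (congr N : Subgroup (SpecialLinearGroup ι ℤ)).Normal :=
  MonoidHom.normal_ker _

theorem mem_congr {N : ℕ} {g : SpecialLinearGroup ι ℤ} :
    g ∈ congr N ↔ ∀ i j, (N : ℤ) ∣ (g : Matrix ι ι ℤ) i j - (1 : Matrix ι ι ℤ) i j := by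
  have h1 : g ∈ congr N ↔ ∀ i j,
      (((g : Matrix ι ι ℤ) i j : ℤ) : ZMod N) = (1 : Matrix ι ι (ZMod N)) i j := by
    rw [congr, MonoidHom.mem_ker, Matrix.SpecialLinearGroup.ext_iff]
    rfl
  rw [h1]
  refine forall_congr' fun i => forall_congr' fun j => ?_
  rw [← ZMod.intCast_zmod_eq_zero_iff_dvd, Int.cast_sub, sub_eq_zero]
  by_cases h : i = j <;> simp [Matrix.one_apply, h]

theorem elem_mem_congr {N : ℕ} {i j : ι} (h : i ≠ j) (t : ℤ) : elem h (N * t) ∈ congr N := by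
  rw [mem_congr]
  intro a b
  simp only [SpecialLinearGroup.transvection_coe, Matrix.add_apply, add_sub_cancel_left,
    Matrix.single_apply]
  split_ifs <;> simp

instance (N : ℕ) [NeZero N] : (congr N : Subgroup (SpecialLinearGroup ι ℤ)).FiniteIndex :=
  Subgroup.finiteIndex_ker _

theorem dvd_smul_sub_smul {N : ℕ} {g : SpecialLinearGroup ι ℤ} (hg : g ∈ congr N) (v : ι → ℤ)
    (l : ι) : (N : ℤ) ∣ (g • v) l - v l := by
  have : (g • v) l - v l
      = ∑ m, ((g : Matrix ι ι ℤ) l m - (1 : Matrix ι ι ℤ) l m) * v m := by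
    have h1 := smul_apply (1 : SpecialLinearGroup ι ℤ) v l
    rw [one_smul] at h1
    simp_rw [sub_mul]
    rw [Finset.sum_sub_distrib, ← smul_apply]
    exact congrArg ((g • v) l - ·) h1
  rw [this]
  exact Finset.dvd_sum fun m _ => (mem_congr.1 hg l m).mul_right _

/-- A primitive vector congruent to `e_i` modulo `N` can be moved to `e_i` by any normal subgroup
containing the elementary matrices of level `N`, in dimension at least three. -/
theorem exists_smul_eq_single {P : Subgroup (SpecialLinearGroup ι ℤ)} [P.Normal] {N : ℕ}
    (hN : 2 ≤ N) (hcard : 3 ≤ Fintype.card ι)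
    (hP : ∀ (i j : ι) (h : i ≠ j) (t : ℤ), elem h (N * t) ∈ P) (i : ι) (v w : ι → ℤ)
    (hw : ∑ l, w l * v l = 1) (hv : ∀ l, (N : ℤ) ∣ v l - Pi.single (M := fun _ => ℤ) i 1 l) :
    ∃ h ∈ P, h • v = Pi.single i 1 := by
  obtain ⟨j, hji⟩ : ∃ j, j ≠ i := by
    have : Nontrivial ι := Fintype.one_lt_card_iff_nontrivial.1 (by omega)
    exact exists_ne i
  obtain ⟨k, hki, hkj⟩ : ∃ k, k ≠ i ∧ k ≠ j := by
    by_contra! hc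
    have : (Finset.univ : Finset ι) ⊆ {i, j} := by
      intro k _
      by_cases h : k = i
      · simp [h]
      · simp [hc k h]
    have := (Finset.card_le_card this).trans Finset.card_le_two
    rw [Finset.card_univ] at this
    omega
  have hvi : (N : ℤ) ∣ v i - 1 := by simpa using hv i
  have hvl : ∀ l, l ≠ i → (N : ℤ) ∣ v l := fun l hl => by simpa [hl] using hv l
  have hvi0 : v i ≠ 0 := by
    intro h0
    rw [h0, zero_sub, dvd_neg] at hvi
    have := Int.le_of_dvd one_pos hvi
    omega
  -- make the coordinates `i` and `j` coprime
  obtain ⟨h₁, hh₁, hv₁, x, y, hxy⟩ : ∃ h ∈ P,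
      (∀ l, (h • v) l = v l ∨ l = j ∧ (N : ℤ) ∣ (h • v) j) ∧
        IsCoprime ((h • v) i) ((h • v) j) := by
    set S : Finset ι := Finset.univ \ {i, j} with hS
    have hsum : w i * v i + w j * v j + ∑ l ∈ S, w l * v l = 1 := by
      rw [← hw, ← Finset.sum_sdiff (Finset.subset_univ {i, j}), Finset.sum_pair hji.symm]
      ring
    obtain ⟨m, hm⟩ := hvi
    set c := ∑ l ∈ S, w l * v l with hc
    obtain ⟨s, hs⟩ := exists_isCoprime_add_mul (b := v j) (c := N * c) hvi0
      (w i + c) (w j) (-m) (by linear_combination hsum + c * hm)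
    obtain ⟨h, hh, e⟩ := exists_smul_eq_add_sum (P := P) N j S (by simp [hS])
      (fun l _ h t => hP j l h t) v (fun l => s * w l)
    have hsum' : v j + N * ∑ l ∈ S, s * w l * v l = v j + s * (N * c) := by
      rw [hc, Finset.mul_sum, Finset.mul_sum, Finset.mul_sum]
      congr 1
      exact Finset.sum_congr rfl fun l _ => by ring
    rw [hsum'] at e
    refine ⟨h, hh, fun l => ?_, ?_⟩
    · by_cases hl : l = j
      · right
        refine ⟨hl, ?_⟩
        rw [e, Function.update_self]
        exact dvd_add (hvl j hji) ((dvd_mul_right _ _).mul_left _)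
      · left
        rw [e, Function.update_of_ne hl]
    · rw [e, Function.update_self, Function.update_of_ne hji.symm]
      exact hs
  have hi₁ : (h₁ • v) i = v i := (hv₁ i).resolve_right (fun h => hji h.1.symm)
  have hl₁ : ∀ l, l ≠ i → (N : ℤ) ∣ (h₁ • v) l := by
    intro l hl
    rcases hv₁ l with h | ⟨h, h'⟩
    · rw [h]; exact hvl l hl
    · rw [h]; exact h'
  obtain ⟨q, hq⟩ : (N : ℤ) ∣ 1 - v i - (h₁ • v) k :=
    dvd_sub (by rw [← dvd_neg, neg_sub]; exact hvi) (hl₁ k hki)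
  obtain ⟨h₂, hh₂, e₂⟩ := exists_smul_eq_add_sum (P := P) N k {i, j} (by simp [hki, hkj])
    (fun l _ h t => hP k l h t) (h₁ • v) (fun l => if l = i then q * x else q * y)
  rw [Finset.sum_pair hji.symm, if_pos rfl, if_neg hji] at e₂
  have hk₂ : (h₂ • h₁ • v) k = 1 - v i := by
    rw [e₂, Function.update_self]
    linear_combination (N : ℤ) * q * hxy - hq
  have hi₂ : (h₂ • h₁ • v) i = v i := by
    rw [e₂, Function.update_of_ne hki.symm, hi₁]
  have hl₂ : ∀ l, l ≠ i → (N : ℤ) ∣ (h₂ • h₁ • v) l := by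
    intro l hl
    by_cases hlk : l = k
    · rw [hlk, hk₂, ← dvd_neg, neg_sub]; exact hvi
    · rw [e₂, Function.update_of_ne hlk]; exact hl₁ l hl
  obtain ⟨h₃, hh₃, e₃⟩ := exists_smul_eq_single_of_apply_eq_one (P := P) N i
    (fun l h t => hP l i h t) (elem hki.symm 1 • h₂ • h₁ • v)
    (by rw [elem_smul, Function.update_self, hi₂, hk₂]; ring)
    (fun l hl => by rw [elem_smul, Function.update_of_ne hl]; exact hl₂ l hl)
  refine ⟨(elem hki.symm 1)⁻¹ * h₃ * elem hki.symm 1 * (h₂ * h₁),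
    P.mul_mem ?_ (P.mul_mem hh₂ hh₁), ?_⟩
  · simpa using ‹P.Normal›.conj_mem h₃ hh₃ (elem hki.symm 1)⁻¹
  · rw [mul_smul, mul_smul, mul_smul, mul_smul, e₃, SpecialLinearGroup.transvection_inv, elem_smul]
    simp [hki]

end SLn

namespace SLn
open Matrix
open scoped commutatorElement

variable {ι : Type*} [Fintype ι] [DecidableEq ι]

/-- The Euclidean algorithm on the coordinates of a vector lying in `T`. -/
theorem exists_smul_apply_eq_one {P : Subgroup (SpecialLinearGroup ι ℤ)} (T : Finset ι)
    (hP : ∀ a, ∀ b ∈ T, ∀ (h : a ≠ b) (t : ℤ), elem h t ∈ P) (k : ι) (hk : k ∈ T)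
    (hT : ∃ b ∈ T, b ≠ k) (v : ι → ℤ) (hv : ∀ d : ℤ, (∀ l ∈ T, d ∣ v l) → IsUnit d) :
    ∃ h ∈ P, (h • v) k = 1 := by
  induction hs : ∑ l ∈ T, (v l).natAbs using Nat.strong_induction_on generalizing v with
  | _ s ih =>
  subst hs
  by_cases hab : ∃ a ∈ T, ∃ b ∈ T, a ≠ b ∧ v b ≠ 0 ∧ (v b).natAbs ≤ (v a).natAbs
  · obtain ⟨a, ha, b, hb, hne, hb0, hle⟩ := hab
    obtain ⟨t, ht⟩ : ∃ t : ℤ, (v a + t * v b).natAbs < (v a).natAbs := by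
      rcases le_or_gt 0 (v a * v b) with h | h
      · refine ⟨-1, ?_⟩
        rcases lt_or_gt_of_ne hb0 with h0 | h0
        · have : v a ≤ 0 := by nlinarith
          omega
        · have : 0 ≤ v a := by nlinarith
          omega
      · refine ⟨1, ?_⟩
        rcases lt_or_gt_of_ne hb0 with h0 | h0
        · have : 0 ≤ v a := by nlinarith
          omega
        · have : v a ≤ 0 := by nlinarith
          omega
    obtain ⟨h, hh, e⟩ := ih (∑ l ∈ T, ((elem hne t • v) l).natAbs) (by
      apply Finset.sum_lt_sum
      · intro l _
        rw [elem_smul]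
        by_cases hl : l = a
        · subst hl; rw [Function.update_self]; exact ht.le
        · rw [Function.update_of_ne hl]
      · exact ⟨a, ha, by rw [elem_smul, Function.update_self]; exact ht⟩) (elem hne t • v) (by
      intro d hd
      apply hv
      have hdb : d ∣ v b := by
        have := hd b hb
        rwa [elem_smul, Function.update_of_ne hne.symm] at this
      intro l hl
      have := hd l hl
      rw [elem_smul] at this
      by_cases hla : l = a
      · subst hla
        rw [Function.update_self] at this
        exact (dvd_add_left (hdb.mul_left t)).1 this
      · rwa [Function.update_of_ne hla] at this) rfl
    exact ⟨h * elem hne t, P.mul_mem hh (hP a b hb hne t), by rwa [mul_smul]⟩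
  · push Not at hab
    obtain ⟨a, ha, ha0⟩ : ∃ a ∈ T, v a ≠ 0 := by
      by_contra! hc
      have := hv 0 (fun l hl => by rw [hc l hl])
      simp at this
    have h0 : ∀ l ∈ T, l ≠ a → v l = 0 := by
      intro l hl hla
      by_contra hl0
      have h1 := hab a ha l hl hla.symm hl0
      have h2 := hab l hl a ha hla ha0
      omega
    have hau : IsUnit (v a) := hv (v a) (fun l hl => by
      by_cases hla : l = a
      · rw [hla]
      · rw [h0 l hl hla]; exact dvd_zero _)
    have hmul : v a * v a = 1 := by
      rcases Int.isUnit_iff.1 hau with h | h <;> rw [h] <;> rfl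
    by_cases hak : k = a
    · subst hak
      obtain ⟨b, hb, hbk⟩ := hT
      refine ⟨elem hbk.symm (1 - v k) * elem hbk (v k),
        P.mul_mem (hP _ _ hb _ _) (hP _ _ hk _ _), ?_⟩
      rw [mul_smul, elem_smul, elem_smul, Function.update_self, Function.update_self,
        Function.update_of_ne hbk.symm, h0 b hb hbk, zero_add, hmul]
      ring
    · refine ⟨elem hak (v a), hP _ _ ha _ _, ?_⟩
      rw [elem_smul, Function.update_self, h0 k hk hak, hmul, zero_add]

/-- `SL(n, ℤ)` is generated by elementary matrices. -/
theorem mem_of_forall_elem_mem {E : Subgroup (SpecialLinearGroup ι ℤ)}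
    (hE : ∀ (a b : ι) (h : a ≠ b) (t : ℤ), elem h t ∈ E) (g : SpecialLinearGroup ι ℤ) : g ∈ E := by
  suffices H : ∀ S : Finset ι, ∃ h ∈ E, ∀ i ∈ S,
      (h * g) • (Pi.single i 1 : ι → ℤ) = Pi.single i 1 by
    obtain ⟨h, hh, e⟩ := H Finset.univ
    have := eq_one_of_forall_smul_single fun i => e i (Finset.mem_univ i)
    rw [eq_inv_of_mul_eq_one_right this]
    exact E.inv_mem hh
  intro S
  induction S using Finset.induction_on with
  | empty => exact ⟨1, E.one_mem, by simp⟩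
  | insert k S hk ih =>
    obtain ⟨h₀, hh₀, e₀⟩ := ih
    set g' := h₀ * g with hg'
    set P : Subgroup (SpecialLinearGroup ι ℤ) :=
      E ⊓ ⨅ i ∈ S, MulAction.stabilizer _ (Pi.single i 1 : ι → ℤ) with hPdef
    have hP : ∀ a, ∀ b ∈ Sᶜ, ∀ (h : a ≠ b) (t : ℤ), elem h t ∈ P := by
      intro a b hb h t
      refine Subgroup.mem_inf.2 ⟨hE a b h t, ?_⟩
      simp only [Subgroup.mem_iInf, MulAction.mem_stabilizer_iff]
      intro i hi
      have hbi : b ≠ i := by rintro rfl; simp [hi] at hb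
      rw [elem_smul]
      simp [hbi]
    have hkT : k ∈ Sᶜ := by simpa using hk
    set v : ι → ℤ := g' • (Pi.single k 1 : ι → ℤ) with hv
    obtain ⟨h₁, hh₁, e₁⟩ : ∃ h ∈ P, (h • v) k = 1 := by
      by_cases hT : ∃ b ∈ Sᶜ, b ≠ k
      · refine exists_smul_apply_eq_one Sᶜ hP k hkT hT v fun d hd => ?_
        have h1 : (g'⁻¹ • v) k = 1 := by rw [hv, inv_smul_smul]; simp
        rw [smul_apply] at h1
        apply isUnit_of_dvd_one
        rw [← h1]
        refine Finset.dvd_sum fun l _ => ?_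
        by_cases hl : l ∈ S
        · have h2 : (g'⁻¹ • (Pi.single l 1 : ι → ℤ)) k = 0 := by
            rw [inv_smul_eq_iff.2 (e₀ l hl).symm]
            have : k ≠ l := by rintro rfl; exact hk hl
            simp [this]
          rw [smul_single_apply] at h2
          rw [h2, zero_mul]
          exact dvd_zero d
        · exact (hd l (by simpa using hl)).mul_left _
      · push Not at hT
        refine ⟨1, P.one_mem, ?_⟩
        rw [one_smul]
        have h1 : (g' : Matrix ι ι ℤ) = (1 : Matrix ι ι ℤ).updateCol k v := by
          ext a b
          by_cases hb : b = k
          · subst hb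
            rw [updateCol_self, hv, smul_single_apply]
          · rw [updateCol_ne hb, ← smul_single_apply, e₀ b (by
              by_contra hbS
              exact hb (hT b (by simpa using hbS)))]
            simp [Matrix.one_apply, Pi.single_apply]
        have h2 := g'.det_coe
        rw [h1, ← Matrix.cramer_apply] at h2
        simpa using h2
    obtain ⟨h₂, hh₂, e₂⟩ := exists_smul_eq_single_of_apply_eq_one (P := P) 1 k
      (fun l h t => hP l k hkT h _) (h₁ • v) e₁ (fun l _ => one_dvd _)
    have hh := P.mul_mem hh₂ hh₁
    refine ⟨h₂ * h₁ * h₀, E.mul_mem hh.1 hh₀, ?_⟩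
    rw [mul_assoc, ← hg']
    intro i hi
    rcases Finset.mem_insert.1 hi with rfl | hiS
    · rw [mul_smul, mul_smul, ← hv, e₂]
    · rw [mul_smul, e₀ i hiS]
      have h1 := (Subgroup.mem_inf.1 hh).2
      simp only [Subgroup.mem_iInf, MulAction.mem_stabilizer_iff] at h1
      exact h1 i hiS

theorem exists_ne_ne (hcard : 3 ≤ Fintype.card ι) (i j : ι) : ∃ k, k ≠ i ∧ k ≠ j := by
  by_contra! hc
  have : (Finset.univ : Finset ι) ⊆ {i, j} := by
    intro k _
    by_cases h : k = i
    · simp [h]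
    · simp [hc k h]
  have := (Finset.card_le_card this).trans Finset.card_le_two
  rw [Finset.card_univ] at this
  omega

/-- A matrix fixing `e_i` conjugates `e_{il}(1)` to `1 + e_i ⊗ (row l of g⁻¹)`. -/
theorem smul_conj_elem {g : SpecialLinearGroup ι ℤ} {i l : ι} (hil : i ≠ l)
    (hg : g • (Pi.single i 1 : ι → ℤ) = Pi.single i 1) (v : ι → ℤ) :
    (g * elem hil 1 * g⁻¹) • v = v + (g⁻¹ • v) l • Pi.single i 1 := by
  rw [mul_smul, mul_smul, elem_smul]
  have : Function.update (g⁻¹ • v) i ((g⁻¹ • v) i + 1 * (g⁻¹ • v) l)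
      = g⁻¹ • v + (g⁻¹ • v) l • (Pi.single i 1 : ι → ℤ) := by
    ext k
    by_cases hk : k = i
    · subst hk; simp
    · simp [hk]
  rw [this, smul_add, smul_inv_smul, smul_comm, hg]

theorem conj_elem_mul_inv_mem {P : Subgroup (SpecialLinearGroup ι ℤ)} [P.Normal] {N : ℕ}
    (hN : 2 ≤ N) (hcard : 3 ≤ Fintype.card ι) (hPN : P ≤ congr N)
    (hP : ∀ (i j : ι) (h : i ≠ j) (t : ℤ), elem h (N * t) ∈ P) {g : SpecialLinearGroup ι ℤ}
    (hg : g ∈ congr N) {i l : ι} (hil : i ≠ l) :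
    g * elem hil 1 * g⁻¹ * (elem hil 1)⁻¹ ∈ P := by
  -- reduce to the case where `g` fixes `e_i`
  obtain ⟨h, hh, e⟩ := exists_smul_eq_single hN hcard hP i (g • (Pi.single i 1 : ι → ℤ))
    ((g⁻¹ : Matrix.SpecialLinearGroup ι ℤ).1 i) (by
      have := smul_apply g⁻¹ (g • (Pi.single i 1 : ι → ℤ)) i
      rw [inv_smul_smul, Pi.single_eq_same] at this
      exact this.symm) (fun l => dvd_smul_sub_smul hg _ l)
  rw [← mul_smul] at e
  set g' := h * g with hg'
  have hg'N : g' ∈ congr N := mul_mem (hPN hh) hg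
  -- the conjugate of `e_il` by `g'` differs from `e_il` by elementary matrices of level `N`
  have key : g' * elem hil 1 * g'⁻¹ * (elem hil 1)⁻¹ ∈ P := by
    have hc : ∀ m, (N : ℤ) ∣ ((g'⁻¹ : Matrix.SpecialLinearGroup ι ℤ) : Matrix ι ι ℤ) l m
        - (1 : Matrix ι ι ℤ) l m := fun m => mem_congr.1 (inv_mem hg'N) l m
    choose c hc using hc
    have hci : ((g'⁻¹ : Matrix.SpecialLinearGroup ι ℤ) : Matrix ι ι ℤ) l i = 0 := by
      rw [← smul_single_apply, inv_smul_eq_iff.2 e.symm]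
      simp [hil.symm]
    obtain ⟨h', hh', e'⟩ : ∃ h ∈ P, ∀ v : ι → ℤ,
        h • v = v + (N * ∑ m ∈ Finset.univ.erase i, c m * v m) • (Pi.single i 1 : ι → ℤ) := by
      suffices H : ∀ S : Finset ι, i ∉ S → ∃ h ∈ P, ∀ v : ι → ℤ,
          h • v = v + (N * ∑ m ∈ S, c m * v m) • (Pi.single i 1 : ι → ℤ) from
        H _ (Finset.notMem_erase i _)
      intro S
      induction S using Finset.induction_on with
      | empty => exact fun _ => ⟨1, P.one_mem, by simp⟩
      | insert a S ha ih =>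
        intro hS
        have hia : i ≠ a := by rintro rfl; simp at hS
        obtain ⟨h, hh, e⟩ := ih (by simp at hS; tauto)
        refine ⟨elem hia (N * c a) * h, P.mul_mem (hP _ _ _ _) hh, fun v => ?_⟩
        rw [mul_smul, elem_smul, e, Finset.sum_insert ha]
        ext k
        by_cases hk : k = i
        · subst hk
          simp [hia.symm]
          ring
        · simp [hk]
    have : g' * elem hil 1 * g'⁻¹ * (elem hil 1)⁻¹ = h' := by
      rw [mul_inv_eq_iff_eq_mul, ← inv_mul_eq_one]
      apply eq_one_of_forall_smul_single
      intro k
      generalize (Pi.single k 1 : ι → ℤ) = v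
      rw [mul_smul, inv_smul_eq_iff, mul_smul h', smul_conj_elem hil e, e', elem_smul]
      have h1 : (g'⁻¹ • v) l = v l + N * ∑ m ∈ Finset.univ.erase i, c m * v m := by
        have h2 : (1 : SpecialLinearGroup ι ℤ) • v = v := one_smul _ v
        have h3 := smul_apply (1 : SpecialLinearGroup ι ℤ) v l
        rw [h2] at h3
        rw [h3, smul_apply, Finset.mul_sum, ← sub_eq_iff_eq_add', ← Finset.sum_sub_distrib,
          ← Finset.add_sum_erase _ _ (Finset.mem_univ i)]
        have h4 : ((1 : SpecialLinearGroup ι ℤ) : Matrix ι ι ℤ) l i = 0 :=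
          Matrix.one_apply_ne hil.symm
        rw [hci, h4, zero_mul, sub_zero, zero_add]
        refine Finset.sum_congr rfl fun m _ => ?_
        rw [← sub_mul, ← mul_assoc, ← hc m]
        rfl
      have h5 : ∑ m ∈ Finset.univ.erase i,
            c m * (Function.update v i (v i + 1 * v l)) m
          = ∑ m ∈ Finset.univ.erase i, c m * v m :=
        Finset.sum_congr rfl fun m hm => by
          rw [Function.update_of_ne (Finset.ne_of_mem_erase hm)]
      rw [h1, h5]
      ext k
      by_cases hk : k = i
      · subst hk; simp; ring
      · simp [hk]
    rw [this]
    exact hh'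
  have h6 : g * elem hil 1 * g⁻¹ * (elem hil 1)⁻¹
      = h⁻¹ * (g' * elem hil 1 * g'⁻¹ * (elem hil 1)⁻¹) * (elem hil 1 * h * (elem hil 1)⁻¹) := by
    rw [hg']; group
  rw [h6]
  exact P.mul_mem (P.mul_mem (P.inv_mem hh) key) (‹P.Normal›.conj_mem h hh _)

/-- The one-parameter subgroup of elementary matrices at the position `(i, j)`. -/
def elemHom {i j : ι} (h : i ≠ j) : Multiplicative ℤ →* SpecialLinearGroup ι ℤ where
  toFun t := elem h t.toAdd
  map_one' := SpecialLinearGroup.transvection_coeff_zero h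
  map_mul' s t := SpecialLinearGroup.transvection_add h s.toAdd t.toAdd

theorem elem_zpow {i j : ι} (h : i ≠ j) (s t : ℤ) : elem h s ^ t = elem h (t * s) := by
  have := map_zpow (elemHom h) (Multiplicative.ofAdd s) t
  rw [← ofAdd_zsmul] at this
  exact this.symm

theorem finite_commutatorSet_of_finiteIndex_center {Q : Type*} [Group Q]
    [(Subgroup.center Q).FiniteIndex] : Finite (commutatorSet Q) := by
  have : commutatorSet Q ⊆ Set.range fun q : (Q ⧸ Subgroup.center Q) × (Q ⧸ Subgroup.center Q) =>
      ⁅q.1.out, q.2.out⁆ := by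
    rintro _ ⟨a, b, rfl⟩
    obtain ⟨z, hz⟩ := QuotientGroup.mk_out_eq_mul (Subgroup.center Q) a
    obtain ⟨w, hw⟩ := QuotientGroup.mk_out_eq_mul (Subgroup.center Q) b
    refine ⟨(a, b), ?_⟩
    simp only [hz, hw, commutatorElement_def]
    have hz' := Subgroup.mem_center_iff.1 z.2
    have hw' := Subgroup.mem_center_iff.1 w.2
    have h1 : a * z * (b * w) = a * b * (z * w) := by
      rw [mul_assoc, ← mul_assoc (z : Q), ← hz' b, mul_assoc, mul_assoc]
    have h2 : b * w * (a * z) = b * a * (z * w) := by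
      rw [mul_assoc, ← mul_assoc (w : Q), ← hw' a, mul_assoc, ← hw' z, mul_assoc]
    rw [mul_inv_eq_iff_eq_mul, mul_inv_eq_iff_eq_mul, mul_assoc _ (b * (w : Q)), h1, h2]
    group
  exact (Set.finite_range _).subset this

theorem finiteIndex_of_elem_mem_of_le {P : Subgroup (SpecialLinearGroup ι ℤ)} [P.Normal] {N : ℕ}
    (hN : 2 ≤ N) (hcard : 3 ≤ Fintype.card ι) (hPN : P ≤ congr N)
    (hP : ∀ (i j : ι) (h : i ≠ j) (t : ℤ), elem h (N * t) ∈ P) : P.FiniteIndex := by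
  have : NeZero N := ⟨by omega⟩
  set π := QuotientGroup.mk' P with hπ
  have hsurj : Function.Surjective π := QuotientGroup.mk'_surjective P
  have hcenter : (congr N).map π ≤ Subgroup.center _ := by
    rintro _ ⟨g, hg, rfl⟩
    rw [Subgroup.mem_center_iff]
    intro q
    obtain ⟨x, rfl⟩ := hsurj q
    have : x ∈ (Subgroup.centralizer {π g}).comap π := by
      refine mem_of_forall_elem_mem (fun a b hab t => ?_) x
      have h1 : elem hab t = elem hab 1 ^ t := by rw [elem_zpow, mul_one]
      rw [h1]
      refine Subgroup.zpow_mem _ ?_ t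
      rw [Subgroup.mem_comap, Subgroup.mem_centralizer_singleton_iff]
      have h2 := conj_elem_mul_inv_mem hN hcard hPN hP hg hab
      have h3 : π (g * elem hab 1 * g⁻¹ * (elem hab 1)⁻¹) = 1 :=
        (QuotientGroup.eq_one_iff _).2 h2
      rw [map_mul, map_mul, map_mul, map_inv, map_inv, mul_inv_eq_one, mul_inv_eq_iff_eq_mul] at h3
      exact h3.symm
    exact Subgroup.mem_centralizer_singleton_iff.1 this
  have : ((congr N).map π).FiniteIndex :=
    ⟨ne_zero_of_dvd_ne_zero (Subgroup.FiniteIndex.index_ne_zero (H := (congr N)))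
      (Subgroup.index_map_dvd _ hsurj)⟩
  have : (Subgroup.center (SpecialLinearGroup ι ℤ ⧸ P)).FiniteIndex :=
    Subgroup.finiteIndex_of_le hcenter
  have := finite_commutatorSet_of_finiteIndex_center (Q := SpecialLinearGroup ι ℤ ⧸ P)
  have htop : commutator (SpecialLinearGroup ι ℤ ⧸ P) = ⊤ := by
    rw [eq_top_iff]
    intro q _
    obtain ⟨x, rfl⟩ := hsurj q
    have : x ∈ (commutator (SpecialLinearGroup ι ℤ ⧸ P)).comap π := by
      refine mem_of_forall_elem_mem (fun a b hab t => ?_) x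
      obtain ⟨c, hca, hcb⟩ := exists_ne_ne hcard a b
      have h1 := commutator_elem hca.symm hcb hab t 1
      rw [mul_one] at h1
      rw [Subgroup.mem_comap, ← h1, map_commutatorElement]
      exact Subgroup.commutator_mem_commutator (Subgroup.mem_top _) (Subgroup.mem_top _)
    exact this
  have hfin : Finite (SpecialLinearGroup ι ℤ ⧸ P) := by
    have h1 : Finite (commutator (SpecialLinearGroup ι ℤ ⧸ P)) := inferInstance
    rw [htop] at h1
    exact Finite.of_equiv _ Subgroup.topEquiv.toEquiv
  exact Subgroup.finiteIndex_of_finite_quotient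

/-- Normal subgroups of `SL(n, ℤ)`, `n ≥ 3`, containing powers of the elementary matrices have
finite index. -/
theorem finiteIndex_of_elem_mem {P : Subgroup (SpecialLinearGroup ι ℤ)} [P.Normal] {N : ℕ}
    (hN : 0 < N) (hcard : 3 ≤ Fintype.card ι)
    (hP : ∀ (i j : ι) (h : i ≠ j) (t : ℤ), elem h (N * t) ∈ P) : P.FiniteIndex := by
  have : (P ⊓ congr (2 * N)).FiniteIndex := by
    refine finiteIndex_of_elem_mem_of_le (N := 2 * N) (by omega) hcard inf_le_right ?_
    intro i j h t
    refine Subgroup.mem_inf.2 ⟨?_, elem_mem_congr h t⟩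
    have := hP i j h (2 * t)
    push_cast
    rwa [show 2 * (N : ℤ) * t = N * (2 * t) by ring]
  exact Subgroup.finiteIndex_of_le (inf_le_left : P ⊓ congr (2 * N) ≤ P)

/-- If every homomorphism from a finite-index subgroup to `H` kills powers of elementary matrices,
then every such homomorphism has finite image. -/
theorem finite_range_of_elem_mem_ker {H : Type*} [Group H] (hcard : 3 ≤ Fintype.card ι)
    (hcore : ∀ (Γ : Subgroup (SpecialLinearGroup ι ℤ)) (_ : Γ.FiniteIndex) (ρ : Γ →* H) (i j : ι)
      (h : i ≠ j), ∃ N : ℕ, 0 < N ∧ ∃ hm : elem h N ∈ Γ, ρ ⟨elem h N, hm⟩ = 1)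
    (Γ : Subgroup (SpecialLinearGroup ι ℤ)) (hΓ : Γ.FiniteIndex) (ρ : Γ →* H) :
    (Set.range ρ).Finite := by
  classical
  set Γ₀ := Γ.normalCore with hΓ₀
  have hle : Γ₀ ≤ Γ := Γ.normalCore_le
  have hfin : Γ₀.FiniteIndex := inferInstance
  set ρ₀ : Γ₀ →* H := ρ.comp (Subgroup.inclusion hle) with hρ₀
  set K : Subgroup (SpecialLinearGroup ι ℤ) := ρ₀.ker.map Γ₀.subtype with hK
  have hmemK : ∀ x (hx : x ∈ Γ₀), ρ₀ ⟨x, hx⟩ = 1 → x ∈ K := fun x hx h => ⟨⟨x, hx⟩, h, rfl⟩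
  have key : ∀ (q : SpecialLinearGroup ι ℤ ⧸ Γ₀) (p : {p : ι × ι // p.1 ≠ p.2}),
      ∃ N : ℕ, 0 < N ∧ q.out * elem p.2 N * q.out⁻¹ ∈ K := by
    intro q p
    obtain ⟨N, hN, hm, h1⟩ := hcore Γ₀ hfin
      (ρ₀.comp (MulAut.conjNormal q.out : MulAut Γ₀).toMonoidHom) p.1.1 p.1.2 p.2
    refine ⟨N, hN, hmemK _ (Subgroup.Normal.conj_mem inferInstance _ hm _) ?_⟩
    rw [← h1]
    rfl
  choose N hN hNK using key
  have : Fintype (SpecialLinearGroup ι ℤ ⧸ Γ₀) := Subgroup.fintypeQuotientOfFiniteIndex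
  set M : ℕ := ∏ q, ∏ p, N q p with hM
  have hdvd : ∀ q p, N q p ∣ M := fun q p =>
    (Finset.dvd_prod_of_mem _ (Finset.mem_univ p)).trans
      (Finset.dvd_prod_of_mem (fun q => ∏ p, N q p) (Finset.mem_univ q))
  have hM0 : 0 < M := Finset.prod_pos fun q _ => Finset.prod_pos fun p _ => hN q p
  clear_value M
  set S : Set (SpecialLinearGroup ι ℤ) :=
    {g | ∃ (i j : ι) (h : i ≠ j) (t : ℤ), g = elem h (M * t)} with hS
  have hSK : Subgroup.normalClosure S ≤ K := by
    rw [Subgroup.normalClosure, Subgroup.closure_le]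
    intro x hx
    obtain ⟨_, ⟨i, j, h, t, rfl⟩, hconj⟩ := Group.mem_conjugatesOfSet_iff.1 hx
    obtain ⟨g, rfl⟩ := isConj_iff.1 hconj
    obtain ⟨γ, hγ⟩ := QuotientGroup.mk_out_eq_mul Γ₀ g
    set q : SpecialLinearGroup ι ℤ ⧸ Γ₀ := QuotientGroup.mk g
    have h1 : q.out * elem h (M * t) * q.out⁻¹ ∈ K := by
      obtain ⟨c, hc⟩ := hdvd q ⟨(i, j), h⟩
      have := K.zpow_mem (hNK q ⟨(i, j), h⟩) (c * t)
      rw [conj_zpow, elem_zpow] at this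
      convert this using 4
      rw [hc]
      push_cast
      ring
    obtain ⟨δ, hδ⟩ : ∃ δ : Γ₀, (δ : SpecialLinearGroup ι ℤ) * q.out = g :=
      ⟨⟨g * (γ : SpecialLinearGroup ι ℤ)⁻¹ * g⁻¹,
        Subgroup.Normal.conj_mem inferInstance _ (Γ₀.inv_mem γ.2) _⟩, by rw [hγ]; simp⟩
    obtain ⟨y, hy, hyq⟩ := h1
    refine ⟨δ * y * δ⁻¹, (MonoidHom.normal_ker ρ₀).conj_mem y hy δ, ?_⟩
    rw [map_mul, map_mul, hyq, ← hδ, map_inv, Subgroup.coe_subtype]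
    group
  have hSn : ∀ (i j : ι) (h : i ≠ j) (t : ℤ), elem h (M * t) ∈ Subgroup.normalClosure S :=
    fun i j h t => Subgroup.subset_normalClosure ⟨i, j, h, t, rfl⟩
  have h2 : (Subgroup.normalClosure S).FiniteIndex :=
    finiteIndex_of_elem_mem hM0 hcard hSn
  have h3 : (Subgroup.normalClosure S).subgroupOf Γ ≤ ρ.ker := by
    intro x hx
    obtain ⟨y, hy, hyx⟩ := hSK (Subgroup.mem_subgroupOf.1 hx)
    have : Subgroup.inclusion hle y = x := Subtype.ext hyx
    rw [← this]
    exact hy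
  have h4 : ρ.ker.FiniteIndex := Subgroup.finiteIndex_of_le h3
  have h5 : Finite ρ.range := Finite.of_equiv _ (QuotientGroup.quotientKerEquivRange ρ).toEquiv
  exact Set.toFinite (ρ.range : Set H)

end SLn

namespace PadicFlow
open Filter Topology

section Lie

variable {F : Type*} [Field F]

theorem lie_smul_right (D E : Derivation ℤ F F) (f : F) : ⁅D, f • E⁆ = D f • E + f • ⁅D, E⁆ := by
  ext g
  simp [Derivation.commutator_apply]
  ring

theorem lie_smul_left (D E : Derivation ℤ F F) (f : F) : ⁅f • D, E⁆ = f • ⁅D, E⁆ - E f • D := by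
  ext g
  simp [Derivation.commutator_apply]
  ring

variable {W : Submodule F (Derivation ℤ F F)} {x y : F}

/-- In a space of derivations of dimension at most two, two derivations are either proportional or
span everything. -/
theorem proportional_or_span (hW : ∀ D ∈ W, D x = 0 → D y = 0 → D = 0) {D Z : Derivation ℤ F F}
    (hD : D ∈ W) (hZ : Z ∈ W) (hZ0 : Z ≠ 0) :
    (∃ a : F, D = a • Z) ∨ ((∀ a b : F, a • D + b • Z = 0 → a = 0 ∧ b = 0) ∧
      ∀ E ∈ W, ∃ a b : F, E = a • D + b • Z) := by
  by_cases hΔ : D x * Z y - D y * Z x = 0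
  · left
    by_cases hx : Z x = 0
    · have hy : Z y ≠ 0 := fun hy => hZ0 (hW Z hZ hx hy)
      refine ⟨D y / Z y, sub_eq_zero.1 (hW _ (W.sub_mem hD (W.smul_mem _ hZ)) ?_ ?_)⟩
      · rw [hx, mul_zero, sub_zero] at hΔ
        simp [hx, (mul_eq_zero.1 hΔ).resolve_right hy]
      · simp [hy]
    · refine ⟨D x / Z x, sub_eq_zero.1 (hW _ (W.sub_mem hD (W.smul_mem _ hZ)) ?_ ?_)⟩
      · simp [hx]
      · simp only [Derivation.sub_apply, Derivation.smul_apply, smul_eq_mul]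
        field_simp
        linear_combination -hΔ
  · right
    constructor
    · intro a b h
      have hx : a * D x + b * Z x = 0 := by simpa using DFunLike.congr_fun h x
      have hy : a * D y + b * Z y = 0 := by simpa using DFunLike.congr_fun h y
      constructor
      · exact (mul_eq_zero.1 (by linear_combination Z y * hx - Z x * hy :
          a * (D x * Z y - D y * Z x) = 0)).resolve_right hΔ
      · exact (mul_eq_zero.1 (by linear_combination D x * hy - D y * hx :
          b * (D x * Z y - D y * Z x) = 0)).resolve_right hΔ
    · intro E hE
      refine ⟨(E x * Z y - E y * Z x) / (D x * Z y - D y * Z x),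
        (D x * E y - D y * E x) / (D x * Z y - D y * Z x), sub_eq_zero.1
          (hW _ (W.sub_mem hE (W.add_mem (W.smul_mem _ hD) (W.smul_mem _ hZ))) ?_ ?_)⟩
      · have hΔ' : D x * Z y - D y * Z x ≠ 0 := hΔ
        simp only [Derivation.sub_apply, Derivation.add_apply, Derivation.smul_apply, smul_eq_mul]
        rw [div_mul_eq_mul_div, div_mul_eq_mul_div, ← add_div, sub_eq_zero, eq_div_iff hΔ']
        ring
      · have hΔ' : D x * Z y - D y * Z x ≠ 0 := hΔ
        simp only [Derivation.sub_apply, Derivation.add_apply, Derivation.smul_apply, smul_eq_mul]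
        rw [div_mul_eq_mul_div, div_mul_eq_mul_div, ← add_div, sub_eq_zero, eq_div_iff hΔ']
        ring

/-- The Heisenberg-type Lie algebra with two commuting pairs sharing their commutator does not embed
in a space of derivations of dimension at most two. -/
theorem eq_zero_of_lie_eq (hW : ∀ D ∈ W, D x = 0 → D y = 0 → D = 0)
    {A₁ B₁ A₂ B₂ Z : Derivation ℤ F F} (hA₁ : A₁ ∈ W) (hB₁ : B₁ ∈ W) (hA₂ : A₂ ∈ W) (hB₂ : B₂ ∈ W)
    (hZ : Z ∈ W) (h₁ : ⁅A₁, B₁⁆ = Z) (h₂ : ⁅A₂, B₂⁆ = Z) (hA : ⁅A₁, A₂⁆ = 0)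
    (hBA : ⁅B₁, A₂⁆ = 0) (hZA₁ : ⁅Z, A₁⁆ = 0)
    (hZB₁ : ⁅Z, B₁⁆ = 0) (hZA₂ : ⁅Z, A₂⁆ = 0) (hZB₂ : ⁅Z, B₂⁆ = 0) : Z = 0 := by
  by_contra hZ0
  have hsmul : ∀ {f : F} {D : Derivation ℤ F F}, D ≠ 0 → f • D = 0 → f = 0 :=
    fun hD h => (smul_eq_zero.1 h).resolve_right hD
  have hskew : ∀ {D E : Derivation ℤ F F}, ⁅D, E⁆ = 0 → ⁅E, D⁆ = 0 := fun {D E} h => by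
    rw [← lie_skew, h, neg_zero]
  rcases proportional_or_span hW hA₂ hZ hZ0 with ⟨a, rfl⟩ | ⟨hind, hspan⟩
  · have hZa : Z a = 0 := by
      rw [lie_smul_right, lie_self, smul_zero, add_zero] at hZA₂
      exact hsmul hZ0 hZA₂
    have hA₁a : A₁ a = 0 := by
      rw [lie_smul_right, hskew hZA₁, smul_zero, add_zero] at hA
      exact hsmul hZ0 hA
    have hB₁a : B₁ a = 0 := by
      rw [lie_smul_right, hskew hZB₁, smul_zero, add_zero] at hBA
      exact hsmul hZ0 hBA
    have hB₂a : B₂ a = 0 → False := by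
      intro h
      rw [lie_smul_left, hZB₂, h, smul_zero, zero_smul, sub_zero] at h₂
      exact hZ0 h₂.symm
    rcases proportional_or_span hW hA₁ hZ hZ0 with ⟨b, rfl⟩ | ⟨-, hspan⟩
    · rcases proportional_or_span hW hB₁ hZ hZ0 with ⟨c, rfl⟩ | ⟨-, hspan⟩
      · apply hZ0
        rw [lie_smul_right, lie_self, smul_zero, add_zero] at hZA₁ hZB₁
        have hb := hsmul hZ0 hZA₁
        have hc := hsmul hZ0 hZB₁
        rw [← h₁, lie_smul_left, lie_smul_right, lie_self]
        simp [hb, hc]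
      · obtain ⟨α, β, rfl⟩ := hspan B₂ hB₂
        exact hB₂a (by simp [hB₁a, hZa])
    · obtain ⟨α, β, rfl⟩ := hspan B₂ hB₂
      exact hB₂a (by simp [hA₁a, hZa])
  · obtain ⟨α, β, rfl⟩ := hspan B₁ hB₁
    have e₁ := hskew hBA
    rw [lie_add, lie_smul_right, lie_smul_right, lie_self, hskew hZA₂, smul_zero, smul_zero,
      add_zero, add_zero] at e₁
    have e₂ := hZB₁
    rw [lie_add, lie_smul_right, lie_smul_right, lie_self, hZA₂, smul_zero, smul_zero,
      add_zero, add_zero] at e₂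
    obtain ⟨a, b, rfl⟩ := hspan A₁ hA₁
    obtain ⟨h1, h2⟩ := hind _ _ e₁
    obtain ⟨h3, h4⟩ := hind _ _ e₂
    apply hZ0
    rw [← h₁, lie_add, lie_smul_right _ A₂, lie_smul_right _ Z, hA, hskew hZA₁]
    simp [h1, h2, h3, h4]

end Lie

section Flow

variable {F : Type*} [NormedField F] [IsUltrametricDist F] {p : ℕ}

/-- The difference quotient `(g^{p^n} - 1) / p^n`. -/
def quot (p : ℕ) (g : F →+* F) (n : ℕ) (b : F) : F := ((g ^ p ^ n) b - b) / (p : F) ^ n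

/-- `D` is the logarithm of `g`. -/
def HasLog (p : ℕ) (g : F →+* F) (D : F → F) : Prop :=
  ∀ b, Tendsto (fun n => quot p g n b) atTop (𝓝 (D b))

/-- The ring endomorphism `g` is close to the identity. -/
def Close (c : ℝ) (g : F →+* F) : Prop := ∀ b, ‖g b - b‖ ≤ c * ‖b‖

theorem norm_add_le' {a b : F} {c : ℝ} (ha : ‖a‖ ≤ c) (hb : ‖b‖ ≤ c) : ‖a + b‖ ≤ c :=
  (IsUltrametricDist.norm_add_le_max a b).trans (max_le ha hb)

theorem Close.norm_le {c : ℝ} {g : F →+* F} (h : Close c g) (hc : c ≤ 1) (b : F) :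
    ‖g b‖ ≤ ‖b‖ := by
  have := norm_add_le' ((h b).trans (mul_le_of_le_one_left (norm_nonneg b) hc)) le_rfl (b := b)
  simpa using this

theorem Close.pow_sub {c : ℝ} {g : F →+* F} (h : Close c g) (hc0 : 0 ≤ c) (hc : c ≤ 1) (m : ℕ)
    (b : F) : ‖(g ^ m) b - b - m * (g b - b)‖ ≤ c ^ 2 * ‖b‖ := by
  induction m with
  | zero => simp; positivity
  | succ m ih =>
    have h1 : (g ^ (m + 1)) b - b - ((m + 1 : ℕ) : F) * (g b - b)
        = g ((g ^ m) b - b - m * (g b - b)) + m * (g (g b - b) - (g b - b)) := by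
      rw [pow_succ', RingHom.mul_def, RingHom.comp_apply]
      simp only [map_sub, map_mul, map_natCast]
      push_cast
      ring
    rw [h1]
    refine norm_add_le' ((h.norm_le hc _).trans ih) ?_
    rw [norm_mul]
    refine (mul_le_of_le_one_left (norm_nonneg _) (IsUltrametricDist.norm_natCast_le_one F m)).trans
      ((h _).trans ?_)
    rw [sq, mul_assoc]
    exact mul_le_mul_of_nonneg_left (h b) hc0

variable {r : ℝ}

theorem Close.pow_prime {g : F →+* F} (hr : ‖(p : F)‖ = r) (hr0 : 0 < r) (hr1 : r < 1) {j : ℕ}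
    (hj : 1 ≤ j) (h : Close (r ^ j) g) : Close (r ^ (j + 1)) (g ^ p) := by
  intro b
  have hc : r ^ j ≤ 1 := pow_le_one₀ hr0.le hr1.le
  have h1 := h.pow_sub (by positivity) hc p b
  have h2 : (g ^ p) b - b = ((g ^ p) b - b - p * (g b - b)) + p * (g b - b) := by ring
  rw [h2]
  refine norm_add_le' (h1.trans ?_) ?_
  · rw [← pow_mul]
    exact mul_le_mul_of_nonneg_right (pow_le_pow_of_le_one hr0.le hr1.le (by omega)) (norm_nonneg b)
  · rw [norm_mul, hr, pow_succ', mul_assoc]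
    exact mul_le_mul_of_nonneg_left (h b) hr0.le

theorem Close.pow_pow {g : F →+* F} (hr : ‖(p : F)‖ = r) (hr0 : 0 < r) (hr1 : r < 1) {j : ℕ}
    (hj : 1 ≤ j) (h : Close (r ^ j) g) (n : ℕ) : Close (r ^ (j + n)) (g ^ p ^ n) := by
  induction n with
  | zero => simpa using h
  | succ n ih =>
    rw [pow_succ, pow_mul, ← add_assoc]
    exact ih.pow_prime hr hr0 hr1 (by omega)

theorem Close.norm_quot_le {g : F →+* F} (hr : ‖(p : F)‖ = r) (hr0 : 0 < r) (hr1 : r < 1) {j : ℕ}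
    (hj : 1 ≤ j) (h : Close (r ^ j) g) (n : ℕ) (b : F) : ‖quot p g n b‖ ≤ r ^ j * ‖b‖ := by
  rw [quot, norm_div, norm_pow, hr, div_le_iff₀ (by positivity)]
  refine (h.pow_pow hr hr0 hr1 hj n b).trans (le_of_eq ?_)
  ring

theorem Close.norm_quot_succ_sub_le {g : F →+* F} (hr : ‖(p : F)‖ = r) (hr0 : 0 < r) (hr1 : r < 1)
    {j : ℕ} (hj : 1 ≤ j) (h : Close (r ^ j) g) (n : ℕ) (b : F) :
    ‖quot p g (n + 1) b - quot p g n b‖ ≤ r ^ (n + (2 * j - 1)) * ‖b‖ := by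
  have hp : (p : F) ≠ 0 := by rw [← norm_pos_iff, hr]; exact hr0
  have h1 : quot p g (n + 1) b - quot p g n b
      = (((g ^ p ^ n) ^ p) b - b - p * ((g ^ p ^ n) b - b)) / (p : F) ^ (n + 1) := by
    rw [quot, quot, ← pow_mul, ← pow_succ]
    field_simp
    ring
  rw [h1, norm_div, norm_pow, hr, div_le_iff₀ (by positivity)]
  refine ((h.pow_pow hr hr0 hr1 hj n).pow_sub (by positivity)
    (pow_le_one₀ hr0.le hr1.le) p b).trans (le_of_eq ?_)
  rw [← pow_mul, mul_right_comm, ← pow_add]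
  congr 2
  omega

theorem Close.norm_quot_add_sub_le {g : F →+* F} (hr : ‖(p : F)‖ = r) (hr0 : 0 < r) (hr1 : r < 1)
    {j : ℕ} (hj : 1 ≤ j) (h : Close (r ^ j) g) (n m : ℕ) (b : F) :
    ‖quot p g (n + m) b - quot p g n b‖ ≤ r ^ (n + (2 * j - 1)) * ‖b‖ := by
  induction m with
  | zero => simp; positivity
  | succ m ih =>
    have := norm_add_le' ((h.norm_quot_succ_sub_le hr hr0 hr1 hj (n + m) b).trans
      (mul_le_mul_of_nonneg_right (pow_le_pow_of_le_one hr0.le hr1.le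
        (by omega : n + (2 * j - 1) ≤ _)) (norm_nonneg b))) ih
    simpa [add_assoc] using this

theorem HasLog.norm_sub_le {g : F →+* F} (hr : ‖(p : F)‖ = r) (hr0 : 0 < r) (hr1 : r < 1)
    {j : ℕ} (hj : 1 ≤ j) (h : Close (r ^ j) g) {D : F → F} (hD : HasLog p g D) (n : ℕ) (b : F) :
    ‖D b - quot p g n b‖ ≤ r ^ (n + (2 * j - 1)) * ‖b‖ := by
  have h1 : Tendsto (fun m => ‖quot p g (n + m) b - quot p g n b‖) atTop
      (𝓝 ‖D b - quot p g n b‖) := by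
    refine (Tendsto.sub_const ?_ _).norm
    simpa [add_comm] using (tendsto_add_atTop_iff_nat n).2 (hD b)
  exact le_of_tendsto' h1 fun m => h.norm_quot_add_sub_le hr hr0 hr1 hj n m b

theorem HasLog.norm_le {g : F →+* F} (hr : ‖(p : F)‖ = r) (hr0 : 0 < r) (hr1 : r < 1)
    {j : ℕ} (hj : 1 ≤ j) (h : Close (r ^ j) g) {D : F → F} (hD : HasLog p g D) (b : F) :
    ‖D b‖ ≤ r ^ j * ‖b‖ :=
  le_of_tendsto' (hD b).norm fun n => h.norm_quot_le hr hr0 hr1 hj n b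

theorem Close.exists_hasLog [CompleteSpace F] {g : F →+* F} (hr : ‖(p : F)‖ = r) (hr0 : 0 < r) (hr1 : r < 1)
    {j : ℕ} (hj : 1 ≤ j) (h : Close (r ^ j) g) : ∃ D : Derivation ℤ F F, HasLog p g D := by
  have hp : (p : F) ≠ 0 := by rw [← norm_pos_iff, hr]; exact hr0
  have hlim : ∀ b, ∃ c, Tendsto (fun n => quot p g n b) atTop (𝓝 c) := by
    intro b
    apply cauchySeq_tendsto_of_complete
    refine cauchySeq_of_le_geometric r ‖b‖ hr1 fun n => ?_
    rw [dist_comm, dist_eq_norm, mul_comm]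
    exact (h.norm_quot_succ_sub_le hr hr0 hr1 hj n b).trans
      (mul_le_mul_of_nonneg_right (pow_le_pow_of_le_one hr0.le hr1.le (by omega)) (norm_nonneg b))
  choose D hD using hlim
  have hadd : ∀ a b, D (a + b) = D a + D b := fun a b => by
    refine tendsto_nhds_unique (hD (a + b)) (((hD a).add (hD b)).congr fun n => ?_)
    simp only [quot, map_add]
    ring
  have hmul : ∀ a b, D (a * b) = a * D b + b * D a := fun a b => by
    have hz : Tendsto (fun n => (p : F) ^ n) atTop (𝓝 0) :=
      tendsto_pow_atTop_nhds_zero_of_norm_lt_one (by rw [hr]; exact hr1)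
    have := (((hD b).const_mul a).add ((hD a).const_mul b)).add (hz.mul ((hD a).mul (hD b)))
    rw [zero_mul, add_zero] at this
    refine tendsto_nhds_unique (hD (a * b)) (this.congr fun n => ?_)
    simp only [quot, map_mul]
    field_simp
    ring
  exact ⟨Derivation.mk' (AddMonoidHom.mk' D hadd).toIntLinearMap (fun a b => by
    simpa using hmul a b), hD⟩

theorem HasLog.tendsto_quot {g : F →+* F} (hr : ‖(p : F)‖ = r) (hr0 : 0 < r) (hr1 : r < 1)
    {j : ℕ} (hj : 1 ≤ j) (hg : Close (r ^ j) g) {D : Derivation ℤ F F}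
    (hD : HasLog p g D) {u : ℕ → F} {l : F} (hE : Tendsto u atTop (𝓝 l)) {φ : ℕ → ℕ}
    (hφ : Tendsto φ atTop atTop) :
    Tendsto (fun n => quot p g (φ n) (u n)) atTop (𝓝 (D l)) := by
  have h1 : Tendsto (fun n => quot p g (φ n) (u n - l)) atTop (𝓝 0) := by
    refine squeeze_zero_norm (fun n => (hg.norm_quot_le hr hr0 hr1 hj _ _).trans
      (mul_le_of_le_one_left (norm_nonneg _) (pow_le_one₀ hr0.le hr1.le))) ?_
    simpa using (hE.sub_const l).norm
  have := h1.add ((hD l).comp hφ)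
  rw [zero_add] at this
  refine this.congr fun n => ?_
  simp only [quot, map_sub, Function.comp]
  ring

theorem pow_mul_pow_eq {M : Type*} [Monoid M] {g h z : M} (hz : g * h = z * (h * g))
    (hzg : Commute z g) (hzh : Commute z h) (m n : ℕ) :
    g ^ m * h ^ n = z ^ (m * n) * (h ^ n * g ^ m) := by
  have h1 : ∀ n, g * h ^ n = z ^ n * (h ^ n * g) := by
    intro n
    induction n with
    | zero => simp
    | succ n ih =>
      rw [pow_succ h, ← mul_assoc, ih, mul_assoc, mul_assoc, hz, ← mul_assoc (h ^ n) z,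
        ← (hzh.pow_right n).eq, pow_succ z]
      simp only [mul_assoc]
  induction m with
  | zero => simp
  | succ m ih =>
    rw [pow_succ' g, mul_assoc, ih, ← mul_assoc, ← (hzg.pow_left _).eq, mul_assoc, ← mul_assoc g,
      h1, Nat.succ_mul, pow_add]
    simp only [mul_assoc]

variable {g h z : F →+* F} {D E Z : Derivation ℤ F F}

/-- The commutator of the logarithms is the logarithm of the commutator. -/
theorem HasLog.lie_eq (hr : ‖(p : F)‖ = r) (hr0 : 0 < r) (hr1 : r < 1) {j : ℕ} (hj : 1 ≤ j)
    (hg : Close (r ^ j) g) (hh : Close (r ^ j) h) (hz : Close (r ^ j) z) (hD : HasLog p g D)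
    (hE : HasLog p h E) (hZ : HasLog p z Z) (hc : g * h = z * (h * g)) (hzg : Commute z g)
    (hzh : Commute z h) : ⁅D, E⁆ = Z := by
  have hp : (p : F) ≠ 0 := by rw [← norm_pos_iff, hr]; exact hr0
  ext b
  rw [Derivation.commutator_apply]
  have h1 := hD.tendsto_quot hr hr0 hr1 hj hg (hE b) tendsto_id
  have h2 := hE.tendsto_quot hr hr0 hr1 hj hh (hD b) tendsto_id
  have h3 : ∀ {g : F →+* F} {D : Derivation ℤ F F}, Close (r ^ j) g → HasLog p g D →
      ∀ {u : ℕ → F}, Tendsto u atTop (𝓝 b) →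
      Tendsto (fun n => (g ^ p ^ n) (u n)) atTop (𝓝 b) := by
    intro g D hg hD u hu
    have hz : Tendsto (fun n => (p : F) ^ n) atTop (𝓝 0) :=
      tendsto_pow_atTop_nhds_zero_of_norm_lt_one (by rw [hr]; exact hr1)
    have := hu.add (hz.mul (hD.tendsto_quot hr hr0 hr1 hj hg hu tendsto_id))
    rw [zero_mul, add_zero] at this
    refine this.congr fun n => ?_
    simp only [quot, id]
    field_simp
    ring
  have h4 := hZ.tendsto_quot hr hr0 hr1 hj hz (h3 hh hE (h3 hg hD tendsto_const_nhds))
    (φ := fun n => n + n) (tendsto_atTop_mono (fun n => Nat.le_add_left n n) tendsto_id)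
  refine tendsto_nhds_unique (h1.sub h2) (h4.congr fun n => ?_)
  have h5 : ∀ a, (g ^ p ^ n) ((h ^ p ^ n) a) = (z ^ p ^ (n + n)) ((h ^ p ^ n) ((g ^ p ^ n) a)) := by
    intro a
    have := DFunLike.congr_fun (pow_mul_pow_eq hc hzg hzh (p ^ n) (p ^ n)) a
    rw [← pow_add] at this
    exact this
  simp only [quot, id, map_sub, map_div₀, map_pow, map_natCast, h5]
  field_simp
  ring

theorem HasLog.lie_eq_zero (hr : ‖(p : F)‖ = r) (hr0 : 0 < r) (hr1 : r < 1) {j : ℕ} (hj : 1 ≤ j)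
    (hg : Close (r ^ j) g) (hh : Close (r ^ j) h) (hD : HasLog p g D)
    (hE : HasLog p h E) (hc : Commute g h) : ⁅D, E⁆ = 0 := by
  refine HasLog.lie_eq (z := 1) hr hr0 hr1 hj hg hh (fun b => ?_) hD hE (fun b => ?_) ?_
    (Commute.one_left _) (Commute.one_left _)
  · simp; positivity
  · simp [quot]
  · rw [one_mul, hc.eq]

theorem HasLog.eq_one (hr : ‖(p : F)‖ = r) (hr0 : 0 < r) (hr1 : r < 1) (hg : Close (r ^ 2) g)
    (hD : HasLog p g 0) : g = 1 := by
  have key : ∀ j, Close (r ^ (j + 2)) g := by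
    intro j
    induction j with
    | zero => exact hg
    | succ j ih =>
      intro b
      have h1 := hD.norm_sub_le hr hr0 hr1 (by omega) ih 0 b
      rw [Pi.zero_apply, zero_sub, norm_neg] at h1
      simp only [quot, pow_zero, pow_one, div_one] at h1
      exact h1.trans (mul_le_mul_of_nonneg_right
        (pow_le_pow_of_le_one hr0.le hr1.le (by omega)) (norm_nonneg b))
  ext b
  rw [RingHom.one_def, RingHom.id_apply, ← sub_eq_zero, ← norm_le_zero_iff]
  have h1 : Tendsto (fun j => r ^ (j + 2) * ‖b‖) atTop (𝓝 0) := by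
    have := ((tendsto_add_atTop_iff_nat 2).2
      (tendsto_pow_atTop_nhds_zero_of_lt_one hr0.le hr1)).mul_const ‖b‖
    rwa [zero_mul] at this
  exact ge_of_tendsto' h1 fun j => key j b

/-- Two commuting Heisenberg pairs of automorphisms close to the identity, with the same central
element `z`, cannot act on a field with at most two independent derivations unless `z = 1`. -/
theorem eq_one_of_heisenberg [CompleteSpace F] (hr : ‖(p : F)‖ = r) (hr0 : 0 < r) (hr1 : r < 1)
    (S : Set F) (x y : F)
    (hS : ∀ D : Derivation ℤ F F, (∃ C, ∀ b, ‖D b‖ ≤ C * ‖b‖) → (∀ s ∈ S, D s = 0) →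
      D x = 0 → D y = 0 → D = 0)
    {a₁ b₁ a₂ b₂ z : F →+* F}
    (hclose : ∀ g ∈ ({a₁, b₁, a₂, b₂, z} : Set (F →+* F)), Close (r ^ 2) g ∧ ∀ s ∈ S, g s = s)
    (h₁ : a₁ * b₁ = z * (b₁ * a₁)) (h₂ : a₂ * b₂ = z * (b₂ * a₂)) (ha : Commute a₁ a₂)
    (hba : Commute b₁ a₂) (hza₁ : Commute z a₁) (hzb₁ : Commute z b₁) (hza₂ : Commute z a₂)
    (hzb₂ : Commute z b₂) : z = 1 := by
  let W : Submodule F (Derivation ℤ F F) :=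
    { carrier := {D | (∃ C, ∀ b, ‖D b‖ ≤ C * ‖b‖) ∧ ∀ s ∈ S, D s = 0}
      zero_mem' := ⟨⟨0, by simp⟩, by simp⟩
      add_mem' := by
        rintro D E ⟨⟨C, hC⟩, hD⟩ ⟨⟨C', hC'⟩, hE⟩
        refine ⟨⟨C + C', fun b => ?_⟩, fun s hs => by simp [hD s hs, hE s hs]⟩
        rw [add_mul]
        exact (norm_add_le _ _).trans (add_le_add (hC b) (hC' b))
      smul_mem' := by
        rintro a D ⟨⟨C, hC⟩, hD⟩
        refine ⟨⟨‖a‖ * C, fun b => ?_⟩, fun s hs => by simp [hD s hs]⟩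
        rw [Derivation.smul_apply, smul_eq_mul, norm_mul, mul_assoc]
        exact mul_le_mul_of_nonneg_left (hC b) (norm_nonneg a) }
  have hW : ∀ D ∈ W, D x = 0 → D y = 0 → D = 0 := fun D hD => hS D hD.1 hD.2
  have hlog : ∀ g ∈ ({a₁, b₁, a₂, b₂, z} : Set (F →+* F)), ∃ D ∈ W, HasLog p g D := by
    intro g hg
    obtain ⟨hc, hs⟩ := hclose g hg
    obtain ⟨D, hD⟩ := hc.exists_hasLog hr hr0 hr1 (by norm_num)
    refine ⟨D, ⟨⟨_, hD.norm_le hr hr0 hr1 (by norm_num) hc⟩, fun s hs' => ?_⟩, hD⟩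
    have h0 : ∀ n, (g ^ n) s = s := by
      intro n
      induction n with
      | zero => rfl
      | succ n ih => rw [pow_succ', RingHom.mul_def, RingHom.comp_apply, ih, hs s hs']
    refine tendsto_nhds_unique (hD s) ?_
    simp [quot, h0]
  have hc := fun g hg => (hclose g hg).1
  simp only [Set.mem_insert_iff, Set.mem_singleton_iff, forall_eq_or_imp, forall_eq] at hlog hc
  obtain ⟨⟨A₁, hA₁, lA₁⟩, ⟨B₁, hB₁, lB₁⟩, ⟨A₂, hA₂, lA₂⟩, ⟨B₂, hB₂, lB₂⟩, ⟨Z, hZ, lZ⟩⟩ := hlog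
  obtain ⟨cA₁, cB₁, cA₂, cB₂, cZ⟩ := hc
  have h2 : 1 ≤ 2 := by norm_num
  have hZ0 := eq_zero_of_lie_eq hW hA₁ hB₁ hA₂ hB₂ hZ
    (lA₁.lie_eq hr hr0 hr1 h2 cA₁ cB₁ cZ lB₁ lZ h₁ hza₁ hzb₁)
    (lA₂.lie_eq hr hr0 hr1 h2 cA₂ cB₂ cZ lB₂ lZ h₂ hza₂ hzb₂)
    (lA₁.lie_eq_zero hr hr0 hr1 h2 cA₁ cA₂ lA₂ ha)
    (lB₁.lie_eq_zero hr hr0 hr1 h2 cB₁ cA₂ lA₂ hba)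
    (lZ.lie_eq_zero hr hr0 hr1 h2 cZ cA₁ lA₁ hza₁)
    (lZ.lie_eq_zero hr hr0 hr1 h2 cZ cB₁ lB₁ hzb₁)
    (lZ.lie_eq_zero hr hr0 hr1 h2 cZ cA₂ lA₂ hza₂)
    (lZ.lie_eq_zero hr hr0 hr1 h2 cZ cB₂ lB₂ hzb₂)
  subst hZ0
  exact HasLog.eq_one hr hr0 hr1 cZ lZ

end Flow

end PadicFlow

namespace PointCount
open scoped commutatorElement

variable {G X : Type*} [Group G] [MulAction G X]

open Classical in
/-- The number of points of `A` which are moved out of `A` by `g`. -/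
noncomputable def exitCount (A : Finset X) (g : G) : ℕ := (A.filter fun x => g • x ∉ A).card

theorem exitCount_eq (A : Finset X) (g : G) [DecidablePred fun x => g • x ∉ A] :
    exitCount A g = (A.filter fun x => g • x ∉ A).card := by
  unfold exitCount
  congr

theorem exitCount_mul (A : Finset X) (g h : G) :
    exitCount A (g * h) ≤ exitCount A g + exitCount A h := by
  classical
  have h1 : (A.filter fun x => (g * h) • x ∉ A) ⊆
      (A.filter fun x => h • x ∉ A) ∪ ((A.filter fun x => g • x ∉ A).image fun x => h⁻¹ • x) := by
    intro x hx
    rw [Finset.mem_filter, mul_smul] at hx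
    rw [Finset.mem_union, Finset.mem_filter, Finset.mem_image]
    by_cases hhx : h • x ∈ A
    · exact Or.inr ⟨h • x, Finset.mem_filter.2 ⟨hhx, hx.2⟩, inv_smul_smul h x⟩
    · exact Or.inl ⟨hx.1, hhx⟩
  have h2 := (Finset.card_le_card h1).trans (Finset.card_union_le _ _)
  have h3 := Finset.card_image_le (s := A.filter fun x => g • x ∉ A) (f := fun x => h⁻¹ • x)
  rw [exitCount_eq, exitCount_eq, exitCount_eq]
  omega

theorem exitCount_one (A : Finset X) : exitCount A (1 : G) = 0 := by
  simp [exitCount]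

theorem exitCount_inv_le (A : Finset X) (g : G) : exitCount A g⁻¹ ≤ exitCount A g := by
  classical
  have key : (A.filter fun x => g • x ∈ A).card ≤ (A.filter fun x => g⁻¹ • x ∈ A).card := by
    refine Finset.card_le_card_of_injOn (fun x => g • x) (fun x hx => ?_)
      (MulAction.injective g).injOn
    simp only [Finset.coe_filter, Set.mem_ofPred_eq] at hx ⊢
    exact ⟨hx.2, by simpa using hx.1⟩
  have h1 := Finset.card_filter_add_card_filter_not (s := A) (fun x => g • x ∈ A)
  have h2 := Finset.card_filter_add_card_filter_not (s := A) (fun x => g⁻¹ • x ∈ A)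
  have h3 := exitCount_eq A g
  have h4 := exitCount_eq A g⁻¹
  omega

theorem exitCount_pow (A : Finset X) (g : G) (n : ℕ) : exitCount A (g ^ n) ≤ n * exitCount A g := by
  induction n with
  | zero => simp [exitCount_one]
  | succ n ih =>
    rw [pow_succ, Nat.succ_mul]
    exact (exitCount_mul A _ _).trans (Nat.add_le_add_right ih _)

theorem exitCount_commutator (A : Finset X) (g h : G) :
    exitCount A ⁅g, h⁆ ≤ 2 * exitCount A g + 2 * exitCount A h := by
  rw [commutatorElement_def]
  have h1 := exitCount_mul A (g * h * g⁻¹) h⁻¹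
  have h2 := exitCount_mul A (g * h) g⁻¹
  have h3 := exitCount_mul A g h
  have h4 := exitCount_inv_le A g
  have h5 := exitCount_inv_le A h
  omega

open Classical in
/-- The points of `A` with infinite orbit under `c`. -/
noncomputable def infOrbit (A : Finset X) (c : G) : Finset X := A.filter fun x => ∀ N : ℕ, 0 < N → c ^ N • x ≠ x

/-- If all powers of `c` up to `T` move few points out of `A`, few points of `A` have an infinite
orbit under `c`. -/
theorem mul_card_infOrbit_le (A : Finset X) (c : G) (T E : ℕ)
    (hE : ∀ m < T, exitCount A (c ^ m) ≤ E) :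
    T * (infOrbit A c).card ≤ A.card ^ 2 + T * E := by
  classical
  set I := infOrbit A c with hI
  have hIA : I ⊆ A := Finset.filter_subset _ _
  let P := (Finset.range T).sigma fun m => I.filter fun x => c ^ m • x ∈ A
  have hP : P.card ≤ A.card ^ 2 := by
    rw [sq, ← Finset.card_product]
    refine Finset.card_le_card_of_injOn (fun q => (q.2, c ^ q.1 • q.2)) ?_ ?_
    · rintro ⟨m, x⟩ hq
      simp only [P, Finset.coe_sigma, Set.mem_sigma_iff, Finset.coe_filter, Set.mem_ofPred_eq] at hq
      simpa using ⟨hIA hq.2.1, hq.2.2⟩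
    · rintro ⟨m, x⟩ hq ⟨m', x'⟩ hq' heq
      simp only [P, Finset.coe_sigma, Set.mem_sigma_iff, Finset.coe_filter, Set.mem_ofPred_eq]
        at hq hq'
      simp only [Prod.mk.injEq] at heq
      obtain ⟨rfl, heq⟩ := heq
      have hinf := (Finset.mem_filter.1 hq.2.1).2
      have key : ∀ a b : ℕ, a < b → c ^ a • x = c ^ b • x → False := by
        intro a b hab h
        refine hinf (b - a) (by omega) ?_
        apply MulAction.injective (c ^ a)
        change c ^ a • c ^ (b - a) • x = c ^ a • x
        rw [← mul_smul, ← pow_add, h, Nat.add_sub_cancel' hab.le]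
      rcases lt_trichotomy m m' with h | h | h
      · exact (key _ _ h heq).elim
      · rw [h]
      · exact (key _ _ h heq.symm).elim
  have hlow : ∀ m ∈ Finset.range T, I.card ≤ (I.filter fun x => c ^ m • x ∈ A).card + E := by
    intro m hm
    have h1 := Finset.card_filter_add_card_filter_not (s := I) (fun x => c ^ m • x ∈ A)
    have h2 : (I.filter fun x => ¬ c ^ m • x ∈ A).card ≤ E :=
      (Finset.card_le_card (Finset.filter_subset_filter _ hIA)).trans
        ((exitCount_eq A (c ^ m)).symm.trans_le (hE m (Finset.mem_range.1 hm)))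
    omega
  have hsum := Finset.sum_le_sum hlow
  rw [Finset.sum_const, Finset.card_range, smul_eq_mul, Finset.sum_add_distrib, Finset.sum_const,
    Finset.card_range, smul_eq_mul, ← Finset.card_sigma] at hsum
  exact hsum.trans (Nat.add_le_add_right hP _)

section Elementary

variable {ι : Type*} {u : ι → ι → ℤ → G} {M : ℕ}

/-- The relations between elementary matrices of level `M`. -/
structure IsElementary (u : ι → ι → ℤ → G) (M : ℕ) : Prop where
  pos : 0 < M
  add : ∀ i j, i ≠ j → ∀ s t, u i j (s + t) = u i j s * u i j t
  comm : ∀ i j k, i ≠ j → j ≠ k → i ≠ k → ∀ s t, ⁅u i j s, u j k t⁆ = u i k (M * s * t)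
  commute : ∀ i j k l, i ≠ j → k ≠ l → j ≠ k → i ≠ l → ∀ s t, Commute (u i j s) (u k l t)

theorem IsElementary.zero (hu : IsElementary u M) {i j : ι} (h : i ≠ j) : u i j 0 = 1 := by
  have := hu.add i j h 0 0
  rw [add_zero] at this
  exact left_eq_mul.1 this

theorem IsElementary.pow (hu : IsElementary u M) {i j : ι} (h : i ≠ j) (s : ℤ) (n : ℕ) :
    u i j s ^ n = u i j (n * s) := by
  induction n with
  | zero => simp [hu.zero h]
  | succ n ih => rw [pow_succ, ih, ← hu.add i j h]; push_cast; ring_nf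

variable {A : Finset X} {B : ℕ}

theorem IsElementary.exitCount_le (hu : IsElementary u M)
    (hB : ∀ i j, i ≠ j → exitCount A (u i j 1) ≤ B) {i j : ι} (h : i ≠ j) (n : ℕ) :
    exitCount A (u i j n) ≤ n * B := by
  have := exitCount_pow A (u i j 1) n
  rw [hu.pow h, mul_one] at this
  exact this.trans (Nat.mul_le_mul_left _ (hB i j h))

theorem IsElementary.exitCount_mul_le (hu : IsElementary u M)
    (hB : ∀ i j, i ≠ j → exitCount A (u i j 1) ≤ B) {i j k : ι} (hij : i ≠ j) (hik : i ≠ k)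
    (hkj : k ≠ j) (L n : ℕ) :
    exitCount A (u i j ((M * L * n : ℕ) : ℤ)) ≤ 2 * (L * B) + 2 * exitCount A (u k j n) := by
  have h1 := exitCount_commutator A (u i k L) (u k j n)
  rw [hu.comm i k j hik hkj hij] at h1
  have h2 := hu.exitCount_le hB hik L
  push_cast
  omega

/-- Elementary matrices with large entries have small word length. -/
theorem IsElementary.exitCount_le_of_lt (hu : IsElementary u M)
    (hB : ∀ i j, i ≠ j → exitCount A (u i j 1) ≤ B) {i j k : ι} (hij : i ≠ j) (hik : i ≠ k)
    (hkj : k ≠ j) (L m : ℕ) (hm : m < L ^ 3) :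
    exitCount A (u i j ((M ^ 2 * m : ℕ) : ℤ)) ≤ 15 * M ^ 2 * L * B := by
  have hL : 0 < L := by
    rcases Nat.eq_zero_or_pos L with rfl | h
    · simp at hm
    · exact h
  obtain ⟨a, b, c, ha, hb, hc, rfl⟩ : ∃ a b c, a < L ∧ b < L ∧ c < L ∧ m = L ^ 2 * a + L * b + c := by
    refine ⟨m / L / L, m / L % L, m % L, ?_, Nat.mod_lt _ hL, Nat.mod_lt _ hL, ?_⟩
    · rw [Nat.div_lt_iff_lt_mul hL, Nat.div_lt_iff_lt_mul hL]
      calc m < L ^ 3 := hm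
        _ = L * L * L := by ring
    · have h1 := Nat.div_add_mod m L
      have h2 := Nat.div_add_mod (m / L) L
      calc m = L * (L * (m / L / L) + m / L % L) + m % L := by rw [h2, h1]
        _ = _ := by ring
  have e : ((M ^ 2 * (L ^ 2 * a + L * b + c) : ℕ) : ℤ)
      = ((M * L * (M * L * a) : ℕ) : ℤ) + ((M * L * (M * b) : ℕ) : ℤ) + ((M ^ 2 * c : ℕ) : ℤ) := by
    push_cast; ring
  rw [e, hu.add i j hij, hu.add i j hij]
  have h1 := exitCount_mul A (u i j ((M * L * (M * L * a) : ℕ) : ℤ) * u i j ((M * L * (M * b) : ℕ) : ℤ))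
    (u i j ((M ^ 2 * c : ℕ) : ℤ))
  have h2 := exitCount_mul A (u i j ((M * L * (M * L * a) : ℕ) : ℤ)) (u i j ((M * L * (M * b) : ℕ) : ℤ))
  have h3 := hu.exitCount_le hB hij (M ^ 2 * c)
  have h4 := hu.exitCount_mul_le hB hij hik hkj L (M * b)
  have h5 := hu.exitCount_le hB hkj (M * b)
  have h6 := hu.exitCount_mul_le hB hij hik hkj L (M * L * a)
  have h7 := hu.exitCount_mul_le hB hkj hik.symm hij L a
  have h8 := hu.exitCount_le hB hij a
  have hM := hu.pos
  have b1 : a * B ≤ L * B := Nat.mul_le_mul_right _ ha.le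
  have b2 : M * b * B ≤ M ^ 2 * L * B := by
    gcongr
    exact Nat.le_self_pow (by norm_num) M
  have b3 : M ^ 2 * c * B ≤ M ^ 2 * L * B := by gcongr
  have b4 : L * B ≤ M ^ 2 * L * B := by
    rw [mul_assoc]
    exact Nat.le_mul_of_pos_left _ (by positivity)
  have b5 : 15 * M ^ 2 * L * B = 15 * (M ^ 2 * L * B) := by ring
  omega

theorem IsElementary.card_infOrbit_le (hu : IsElementary u M) {p C : ℕ} (hC : 0 < C)
    (hp : 96 * (180 * M ^ 2 * C) ^ 3 ≤ p) (hA : A.card = p ^ 2)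
    (hB : ∀ i j, i ≠ j → exitCount A (u i j 1) ≤ C * p) {i j k : ι} (hij : i ≠ j) (hik : i ≠ k)
    (hkj : k ≠ j) : 6 * (infOrbit A (u i j (M ^ 2 : ℕ))).card ≤ p ^ 2 := by
  set K := 180 * M ^ 2 * C with hK
  have hK0 : 0 < K := by have := hu.pos; positivity
  set L := p / K with hL
  have hKp : K ≤ p := by
    refine le_trans ?_ hp
    calc K ≤ K ^ 3 := Nat.le_self_pow (by norm_num) K
      _ ≤ _ := Nat.le_mul_of_pos_left _ (by norm_num)
  have hL0 : 0 < L := Nat.div_pos hKp hK0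
  have hKL : K * L ≤ p := Nat.mul_div_le p K
  have hpL : p ≤ 2 * K * L := by
    have h1 := Nat.div_add_mod p K
    have h2 := Nat.mod_lt p hK0
    have h3 : K * 1 ≤ K * L := Nat.mul_le_mul_left _ hL0
    rw [← hL] at h1
    nlinarith
  have h1 := mul_card_infOrbit_le A (u i j (M ^ 2 : ℕ)) (L ^ 3) (15 * M ^ 2 * L * (C * p)) (by
    intro m hm
    rw [hu.pow hij]
    have := hu.exitCount_le_of_lt hB hij hik hkj L m hm
    rwa [mul_comm (M ^ 2), Nat.cast_mul] at this)
  rw [hA] at h1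
  set I := (infOrbit A (u i j (M ^ 2 : ℕ))).card
  have h2 : 12 * (15 * M ^ 2 * L * (C * p)) ≤ p ^ 2 := by
    calc 12 * (15 * M ^ 2 * L * (C * p)) = K * L * p := by rw [hK]; ring
      _ ≤ p * p := Nat.mul_le_mul_right _ hKL
      _ = p ^ 2 := by ring
  have h3 : 12 * (p ^ 2) ^ 2 ≤ L ^ 3 * p ^ 2 := by
    calc 12 * (p ^ 2) ^ 2 = 12 * p ^ 3 * p := by ring
      _ ≤ 12 * (2 * K * L) ^ 3 * p := by gcongr
      _ = L ^ 3 * (96 * K ^ 3 * p) := by ring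
      _ ≤ L ^ 3 * (p * p) := by gcongr
      _ = _ := by ring
  have h4 : L ^ 3 * (6 * I) ≤ L ^ 3 * p ^ 2 := by nlinarith
  exact Nat.le_of_mul_le_mul_left h4 (by positivity)

/-- Some point of `A` is fixed by common powers of the elementary matrices. -/
theorem IsElementary.exists_fixed (hu : IsElementary u M) {p C : ℕ} (hC : 0 < C)
    (hp : 96 * (180 * M ^ 2 * C) ^ 3 ≤ p) (hA : A.card = p ^ 2)
    (hB : ∀ i j, i ≠ j → exitCount A (u i j 1) ≤ C * p) (hι : ∀ i j : ι, ∃ k, k ≠ i ∧ k ≠ j)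
    (R : Finset (ι × ι)) (hR : R.card ≤ 5) (hR' : ∀ r ∈ R, r.1 ≠ r.2) :
    ∃ x ∈ A, ∃ N : ℕ, 0 < N ∧ ∀ r ∈ R, u r.1 r.2 N • x = x := by
  classical
  have hp0 : 0 < p := lt_of_lt_of_le (by have := hu.pos; positivity) hp
  have hcard : (R.biUnion fun r => infOrbit A (u r.1 r.2 (M ^ 2 : ℕ))).card < A.card := by
    have h1 : (R.biUnion fun r => infOrbit A (u r.1 r.2 (M ^ 2 : ℕ))).card * 6 ≤ R.card * p ^ 2 := by
      refine (Nat.mul_le_mul_right _ Finset.card_biUnion_le).trans ?_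
      rw [Finset.sum_mul, ← smul_eq_mul, ← Finset.sum_const]
      refine Finset.sum_le_sum fun r hr => ?_
      obtain ⟨k, hk1, hk2⟩ := hι r.1 r.2
      rw [mul_comm]
      exact hu.card_infOrbit_le hC hp hA hB (hR' r hr) hk1.symm hk2
    have h2 : R.card * p ^ 2 ≤ 5 * p ^ 2 := Nat.mul_le_mul_right _ hR
    have h3 : 0 < p ^ 2 := by positivity
    omega
  obtain ⟨x, hxA, hx⟩ := Finset.exists_mem_notMem_of_card_lt_card hcard
  have hfix : ∀ r ∈ R, ∃ N : ℕ, 0 < N ∧ u r.1 r.2 (M ^ 2 : ℕ) ^ N • x = x := by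
    intro r hr
    by_contra! h
    exact hx (Finset.mem_biUnion.2 ⟨r, hr, Finset.mem_filter.2 ⟨hxA, h⟩⟩)
  choose! N hN hNx using hfix
  refine ⟨x, hxA, M ^ 2 * ∏ r ∈ R, N r, ?_, fun r hr => ?_⟩
  · have := Finset.prod_pos hN
    have := hu.pos
    positivity
  · rw [← Finset.mul_prod_erase R N hr]
    have e : ((M ^ 2 * (N r * ∏ r ∈ R.erase r, N r) : ℕ) : ℤ)
        = ((∏ r ∈ R.erase r, N r : ℕ) : ℤ) * ((N r : ℤ) * (M ^ 2 : ℕ)) := by push_cast; ring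
    rw [e, ← hu.pow (hR' r hr), ← hu.pow (hR' r hr)]
    have hst : u r.1 r.2 (M ^ 2 : ℕ) ^ N r ∈ MulAction.stabilizer G x := hNx r hr
    exact pow_mem hst _

end Elementary

end PointCount

namespace PadicEmbedding
open Polynomial

/-- The values of a nonconstant integer polynomial have prime divisors coprime to any given `N`. -/
theorem exists_prime_dvd_eval (G : ℤ[X]) (hG : 0 < G.natDegree) (N : ℕ) (hN : 0 < N) :
    ∃ p : ℕ, p.Prime ∧ ¬ p ∣ N ∧ ∃ m : ℤ, (p : ℤ) ∣ G.eval m := by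
  by_cases hc : G.eval 0 = 0
  · obtain ⟨p, hp, hpp⟩ := Nat.exists_infinite_primes (N + 1)
    exact ⟨p, hpp, fun h => by have := Nat.le_of_dvd hN h; omega, 0, by simp [hc]⟩
  set c := G.eval 0 with hcdef
  have heval : ∀ y : ℤ, G.eval (c * N * y) = c * (1 + N * (y * (divX G).eval (c * N * y))) := by
    intro y
    conv_lhs => rw [← divX_mul_X_add G]
    rw [eval_add, eval_mul, eval_X, eval_C, coeff_zero_eq_eval_zero, ← hcdef]
    ring
  obtain ⟨y, hy⟩ : ∃ y : ℤ, (1 + N * (y * (divX G).eval (c * N * y))).natAbs ≠ 1 := by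
    by_contra! h
    have hroot : ∀ y : ℤ, (G ^ 2 - C (c ^ 2)).IsRoot (c * N * y) := by
      intro y
      have h1 : (1 + N * (y * (divX G).eval (c * N * y))) ^ 2 = 1 := by
        rw [← Int.natAbs_sq, h y]; rfl
      rw [IsRoot.def, eval_sub, eval_pow, eval_C, heval, mul_pow, h1, mul_one, sub_self]
    have hinf : {x | (G ^ 2 - C (c ^ 2)).IsRoot x}.Infinite := by
      refine Set.infinite_of_injective_forall_mem (f := fun y : ℤ => c * N * y) ?_ hroot
      exact mul_right_injective₀ (mul_ne_zero hc (by exact_mod_cast hN.ne'))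
    have h0 := sub_eq_zero.1 (eq_zero_of_infinite_isRoot _ hinf)
    have h1 := congrArg natDegree h0
    rw [natDegree_pow, natDegree_C] at h1
    omega
  obtain ⟨p, hp, hpd⟩ := Int.exists_prime_and_dvd hy
  have hpp : p.natAbs.Prime := Int.prime_iff_natAbs_prime.1 hp
  refine ⟨p.natAbs, hpp, fun h => ?_, c * N * y, ?_⟩
  · have h1 : p ∣ (N : ℤ) := Int.natAbs_dvd.1 (by exact_mod_cast h)
    exact hp.not_dvd_one ((dvd_add_left (h1.mul_right _)).1 hpd)
  · rw [Int.natAbs_dvd, heval]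
    exact hpd.mul_left c

theorem exists_eval_ne_zero {ι : Type*} (h : MvPolynomial ι ℤ) (hh : h ≠ 0) :
    ∃ τ : ι → ℤ, MvPolynomial.eval τ h ≠ 0 := by
  by_contra! hτ
  exact hh (MvPolynomial.funext fun τ => by rw [hτ, map_zero])

variable {p : ℕ} [Fact p.Prime]

open Cardinal in
theorem infinite_of_isTranscendenceBasis {T : Set ℚ_[p]}
    (hT : IsTranscendenceBasis ℚ ((↑) : T → ℚ_[p])) : T.Infinite := by
  intro hfin
  have : Finite T := hfin
  have h1 := hT.isAlgebraic
  have h2 := Algebra.IsAlgebraic.cardinalMk_le_max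
    (Algebra.adjoin ℚ (Set.range ((↑) : T → ℚ_[p]))) ℚ_[p]
  have h3 : #(Algebra.adjoin ℚ (Set.range ((↑) : T → ℚ_[p]))) ≤ ℵ₀ := by
    rw [← Cardinal.mk_congr hT.1.aevalEquiv.toEquiv]
    refine MvPolynomial.cardinalMk_le_max.trans ?_
    simp
  have h4 := continuum_le_cardinal_of_nontriviallyNormedField ℚ_[p]
  exact absurd (h4.trans (h2.trans (max_le h3 le_rfl))) (not_le.2 Cardinal.aleph0_lt_continuum)

/-- Algebraically independent `p`-adic integers in given residue classes. -/
theorem exists_algebraicIndependent {ι : Type*} [Finite ι] (τ : ι → ℤ) :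
    ∃ t : ι → ℤ_[p], (∀ i, ‖t i - τ i‖ < 1) ∧
      AlgebraicIndependent ℤ fun i => (t i : ℚ_[p]) := by
  obtain ⟨T, hT⟩ := exists_isTranscendenceBasis ℚ ℚ_[p]
  have := (infinite_of_isTranscendenceBasis hT).to_subtype
  have := Fintype.ofFinite ι
  obtain ⟨e⟩ : Nonempty (ι ↪ T) :=
    ⟨(Fintype.equivFin ι).toEmbedding.trans (Fin.valEmbedding.trans (Infinite.natEmbedding T))⟩
  have he := hT.1.comp e e.injective
  set b : ι → ℚ_[p] := ((↑) : T → ℚ_[p]) ∘ e with hb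
  have hp1 : ‖(p : ℚ_[p])‖ < 1 := Padic.norm_p_lt_one
  obtain ⟨n, hn⟩ : ∃ n : ℕ, ∀ i, ‖(p : ℚ_[p]) ^ n * b i‖ < 1 := by
    have h1 : ∀ i, ∀ᶠ n : ℕ in Filter.atTop, ‖(p : ℚ_[p]) ^ n * b i‖ < 1 := by
      intro i
      have := (tendsto_pow_atTop_nhds_zero_of_norm_lt_one hp1).mul_const (b i)
      rw [zero_mul] at this
      have h2 := this.norm
      rw [norm_zero] at h2
      exact h2.eventually_lt_const one_pos
    exact (Filter.eventually_all.2 h1).exists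
  have h_int : ∀ i, ‖(τ i : ℚ_[p]) + (p : ℚ_[p]) ^ n * b i‖ ≤ 1 := fun i =>
    (IsUltrametricDist.norm_add_le_max _ _).trans (max_le (Padic.norm_int_le_one _) (hn i).le)
  obtain ⟨t, ht⟩ : ∃ t : ι → ℤ_[p], ∀ i, (t i : ℚ_[p]) = (τ i : ℚ_[p]) + (p : ℚ_[p]) ^ n * b i :=
    ⟨fun i => ⟨_, h_int i⟩, fun i => rfl⟩
  refine ⟨t, fun i => ?_, ?_⟩
  · rw [PadicInt.norm_def, PadicInt.coe_sub, PadicInt.coe_intCast, ht, add_sub_cancel_left]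
    exact hn i
  · have hq : ((p : ℚ) ^ n) ≠ 0 := pow_ne_zero _ (by exact_mod_cast (Fact.out : p.Prime).ne_zero)
    let f : MvPolynomial ι ℚ →ₐ[ℚ] MvPolynomial ι ℚ := MvPolynomial.aeval fun i =>
      MvPolynomial.C (τ i : ℚ) + MvPolynomial.C ((p : ℚ) ^ n) * MvPolynomial.X i
    let g : MvPolynomial ι ℚ →ₐ[ℚ] MvPolynomial ι ℚ := MvPolynomial.aeval fun i =>
      MvPolynomial.C ((p : ℚ) ^ n)⁻¹ * (MvPolynomial.X i - MvPolynomial.C (τ i : ℚ))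
    have hgf : g.comp f = AlgHom.id ℚ _ := by
      ext1 i
      simp only [f, g, AlgHom.comp_apply, MvPolynomial.aeval_X, map_add, map_mul,
        MvPolynomial.algHom_C, MvPolynomial.algebraMap_eq, AlgHom.id_apply]
      rw [← mul_assoc, ← map_mul, mul_inv_cancel₀ hq]
      simp
    have hinj : Function.Injective f := Function.LeftInverse.injective (g := g) fun x =>
      DFunLike.congr_fun hgf x
    refine AlgebraicIndependent.restrictScalars (R := ℤ) (K := ℚ) (algebraMap ℤ ℚ).injective_int ?_
    have hcomp : MvPolynomial.aeval (R := ℚ) (fun i => (τ i : ℚ_[p]) + (p : ℚ_[p]) ^ n * b i)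
        = (MvPolynomial.aeval b).comp f := by
      ext1 i
      simp [f]
    simp only [ht]
    rw [AlgebraicIndependent, hcomp]
    exact Function.Injective.comp (g := MvPolynomial.aeval b) he hinj

theorem toZMod_eq_zero_iff (z : ℤ_[p]) : PadicInt.toZMod z = 0 ↔ ‖z‖ < 1 := by
  rw [← RingHom.mem_ker, PadicInt.ker_toZMod, IsLocalRing.mem_maximalIdeal, PadicInt.mem_nonunits]

/-- Clearing denominators in finitely many polynomials. -/
theorem exists_map_eq_C_mul {A K : Type*} [CommRing A] [IsDomain A] [Field K] [Algebra A K]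
    [IsFractionRing A K] (P : Finset K[X]) :
    ∃ h : A, h ≠ 0 ∧ ∀ q ∈ P, ∃ q' : A[X], q'.map (algebraMap A K) = C (algebraMap A K h) * q := by
  classical
  induction P using Finset.induction_on with
  | empty => exact ⟨1, one_ne_zero, by simp⟩
  | insert q P _ ih =>
    obtain ⟨h, hh, hP⟩ := ih
    obtain ⟨b, hb, hq⟩ := IsLocalization.integerNormalization_spec (nonZeroDivisors A) q
    refine ⟨h * b, mul_ne_zero hh (nonZeroDivisors.ne_zero hb), fun r hr => ?_⟩
    rcases Finset.mem_insert.1 hr with rfl | hr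
    · refine ⟨C h * IsLocalization.integerNormalization (nonZeroDivisors A) r, ?_⟩
      rw [Polynomial.map_mul, hq, map_C, map_mul, map_mul, mul_assoc, ← algebraMap_smul K b r,
        smul_eq_C_mul]
    · obtain ⟨r', hr'⟩ := hP r hr
      refine ⟨C b * r', ?_⟩
      rw [Polynomial.map_mul, hr', map_C, map_mul, map_mul]
      ring

/-- A finitely generated field of characteristic zero embeds in `ℚ_p` for some large `p`, such that
given finitely many elements become integral. -/
theorem exists_embedding {k : Type*} [Field k] [CharZero k] (S : Finset k)
    (hS : Subfield.closure (S : Set k) = ⊤) (F : Finset k) (B : ℕ) :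
    ∃ (p : ℕ) (_ : Fact p.Prime), B < p ∧ ∃ φ : k →+* ℚ_[p], ∀ f ∈ F, ‖φ f‖ ≤ 1 := by
  classical
  have : Algebra.IsAlgebraic (Algebra.adjoin ℤ (S : Set k)) k := by
    refine ⟨fun x => ?_⟩
    obtain ⟨y, hy, z, hz, rfl⟩ := Subfield.mem_closure_iff.1 (hS ▸ Subfield.mem_top x :
      x ∈ Subfield.closure (S : Set k))
    have key : ∀ y ∈ Subring.closure (S : Set k),
        IsAlgebraic (Algebra.adjoin ℤ (S : Set k)) y := fun y hy => by
      have hy' : y ∈ Algebra.adjoin ℤ (S : Set k) := by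
        rw [Algebra.adjoin_int]
        exact hy
      exact isAlgebraic_algebraMap (A := k) (⟨y, hy'⟩ : Algebra.adjoin ℤ (S : Set k))
    rw [div_eq_mul_inv]
    exact (key y hy).mul (key z hz).inv
  obtain ⟨T, hTS, hT⟩ := exists_isTranscendenceBasis_subset (R := ℤ) (S : Set k)
  have hTfin : Finite T := S.finite_toSet.subset hTS
  let A := MvPolynomial T ℤ
  let K := FractionRing A
  let _ : Algebra A k := (MvPolynomial.aeval ((↑) : T → k) : A →ₐ[ℤ] k).toAlgebra
  have hAk : Function.Injective (algebraMap A k) := hT.1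
  let _ : Algebra K k := (IsFractionRing.lift hAk : K →+* k).toAlgebra
  have : IsScalarTower A K k := IsScalarTower.of_algebraMap_eq fun a =>
    (IsFractionRing.lift_algebraMap hAk a).symm
  have : Algebra.IsAlgebraic A k := by
    have h1 := hT.isAlgebraic
    exact Algebra.IsAlgebraic.of_ringHom_of_comp_eq hT.1.aevalEquiv (RingHom.id k)
      hT.1.aevalEquiv.surjective Function.injective_id (RingHom.ext fun c =>
        hT.1.algebraMap_aevalEquiv c)
  have : Algebra.IsAlgebraic K k := ⟨fun x => (Algebra.IsAlgebraic.isAlgebraic (R := A) x).extendScalars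
      (IsFractionRing.injective A K)⟩
  have : FiniteDimensional K k := by
    have h1 : IntermediateField.adjoin K (S : Set k) = ⊤ := by
      rw [eq_top_iff]
      intro x _
      have h2 : Subfield.closure (S : Set k) ≤ (IntermediateField.adjoin K (S : Set k)).toSubfield :=
        Subfield.closure_le.2 (IntermediateField.subset_adjoin K _)
      exact h2 (hS ▸ Subfield.mem_top x)
    have h2 := IntermediateField.finiteDimensional_adjoin (K := K) (S := (S : Set k))
      fun x _ => Algebra.IsIntegral.isIntegral x
    rw [h1] at h2
    exact Module.Finite.equiv (IntermediateField.topEquiv (F := K) (E := k)).toLinearEquiv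
  have : CharZero K := (algebraMap K k).charZero
  let pb := Field.powerBasisOfFiniteOfSeparable K k
  set θ := pb.gen with hθ
  set f := minpoly K θ with hf
  have hfmonic : f.Monic := minpoly.monic (Algebra.IsIntegral.isIntegral θ)
  obtain ⟨a, b, hab⟩ : f.Separable := Algebra.IsSeparable.isSeparable K θ
  have hrep : ∀ x : k, ∃ q : K[X], x = aeval θ q := fun x => by
    obtain ⟨q, -, hq⟩ := pb.exists_eq_aeval x
    exact ⟨q, hq⟩
  choose q hq using hrep
  obtain ⟨h, hh, hP⟩ := exists_map_eq_C_mul (A := A) (({f, a, b} : Finset K[X]) ∪ F.image q)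
  obtain ⟨f', hf'⟩ := hP f (by simp)
  obtain ⟨a', ha'⟩ := hP a (by simp)
  obtain ⟨b', hb'⟩ := hP b (by simp)
  have hF : ∀ x ∈ F, ∃ q' : A[X], q'.map (algebraMap A K) = C (algebraMap A K h) * q x :=
    fun x hx => hP _ (Finset.mem_union_right _ (Finset.mem_image_of_mem q hx))
  have hAK : Function.Injective (algebraMap A K) := IsFractionRing.injective A K
  have hbez : a' * f' + b' * derivative f' = C (h ^ 2) := by
    apply map_injective _ hAK
    rw [Polynomial.map_add, Polynomial.map_mul, Polynomial.map_mul, ← derivative_map, ha', hb', hf',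
      derivative_C_mul, map_C, map_pow, map_pow, ← mul_one (C (algebraMap A K h) ^ 2), ← hab]
    ring
  obtain ⟨τ, hτ⟩ := exists_eval_ne_zero h hh
  have hlead : f'.coeff f.natDegree = h := by
    apply hAK
    rw [← coeff_map, hf', coeff_C_mul, hfmonic.coeff_natDegree, mul_one]
  set G : ℤ[X] := f'.map (MvPolynomial.eval τ) with hG
  have hGdeg : 0 < G.natDegree := by
    refine (minpoly.natDegree_pos (Algebra.IsIntegral.isIntegral (R := K) θ)).trans_le
      (le_natDegree_of_ne_zero ?_)
    rw [hG, coeff_map, hlead]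
    exact hτ
  obtain ⟨p, hp, hpN, m, hm⟩ := exists_prime_dvd_eval G hGdeg
    (B.factorial * (MvPolynomial.eval τ h).natAbs)
    (Nat.mul_pos B.factorial_pos (Int.natAbs_pos.2 hτ))
  have hfact : Fact p.Prime := ⟨hp⟩
  refine ⟨p, hfact, ?_, ?_⟩
  · by_contra! hpB
    exact hpN (((Nat.Prime.dvd_factorial hp).2 hpB).mul_right _)
  have hph : ¬ (p : ℤ) ∣ MvPolynomial.eval τ h := fun hd =>
    hpN ((Int.natCast_dvd.1 hd).mul_left _)
  obtain ⟨t, ht, hti⟩ := exists_algebraicIndependent (p := p) τ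
  let ψ : A →+* ℤ_[p] := (MvPolynomial.aeval t : A →ₐ[ℤ] ℤ_[p]).toRingHom
  have hψ : ∀ c : A, PadicInt.toZMod (ψ c) = (MvPolynomial.eval τ c : ZMod p) := by
    intro c
    have : (PadicInt.toZMod (p := p)).comp ψ = (Int.castRingHom (ZMod p)).comp (MvPolynomial.eval τ) := by
      refine MvPolynomial.ringHom_ext (fun c => by simp) fun i => ?_
      have h1 := (toZMod_eq_zero_iff _).2 (ht i)
      rw [map_sub, map_intCast, sub_eq_zero] at h1
      simpa [ψ] using h1
    exact DFunLike.congr_fun this c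
  let Ψ : A →+* ℚ_[p] := (algebraMap ℤ_[p] ℚ_[p]).comp ψ
  have hΨ : Function.Injective Ψ := by
    have h1 : Ψ = (MvPolynomial.aeval (fun i => (t i : ℚ_[p])) : A →ₐ[ℤ] ℚ_[p]).toRingHom :=
      MvPolynomial.ringHom_ext (fun c => by simp [Ψ]) fun i => by simp [Ψ, ψ]
    rw [h1]
    exact hti
  let _ : Algebra K ℚ_[p] := (IsFractionRing.lift hΨ : K →+* ℚ_[p]).toAlgebra
  have hKΨ : ∀ c, algebraMap K ℚ_[p] (algebraMap A K c) = Ψ c := IsFractionRing.lift_algebraMap hΨ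
  have hunit : ∀ z : ℤ_[p], PadicInt.toZMod z ≠ 0 → ‖z‖ = 1 := fun z hz =>
    le_antisymm (PadicInt.norm_le_one z) (not_lt.1 fun h => hz ((toZMod_eq_zero_iff z).2 h))
  have hψh : ‖ψ h‖ = 1 := hunit _ (by
    rw [hψ, Ne, ZMod.intCast_zmod_eq_zero_iff_dvd]
    exact hph)
  have hev : ∀ r : A[X], PadicInt.toZMod ((r.map ψ).eval (m : ℤ_[p]))
      = (((r.map (MvPolynomial.eval τ)).eval m : ℤ) : ZMod p) := by
    intro r
    have h1 : (PadicInt.toZMod (p := p)).comp ψ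
        = (Int.castRingHom (ZMod p)).comp (MvPolynomial.eval τ) := RingHom.ext hψ
    have h2 := hom_eval₂ r ψ (PadicInt.toZMod (p := p)) (m : ℤ_[p])
    have h3 := hom_eval₂ r (MvPolynomial.eval τ) (Int.castRingHom (ZMod p)) m
    rw [eval_map, eval_map, h2, h1, map_intCast]
    exact h3.symm
  have hdvd : ((G.eval m : ℤ) : ZMod p) = 0 := (ZMod.intCast_zmod_eq_zero_iff_dvd _ _).2 hm
  have hτp : ((MvPolynomial.eval τ h : ℤ) : ZMod p) ≠ 0 := fun h0 =>
    hph ((ZMod.intCast_zmod_eq_zero_iff_dvd _ _).1 h0)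
  have hf'0 : ‖(f'.map ψ).eval (m : ℤ_[p])‖ < 1 := by
    rw [← toZMod_eq_zero_iff, hev]
    exact hdvd
  have hf'1 : ‖(derivative (f'.map ψ)).eval (m : ℤ_[p])‖ = 1 := by
    refine hunit _ fun h0 => ?_
    rw [derivative_map, hev] at h0
    have h1 := congrArg (fun r => (((r.map (MvPolynomial.eval τ)).eval m : ℤ) : ZMod p)) hbez
    simp only [Polynomial.map_add, Polynomial.map_mul, eval_add, eval_mul, h0,
      Int.cast_add, Int.cast_mul, mul_zero, add_zero, map_pow, Polynomial.map_pow, map_C, eval_pow,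
      eval_C, Int.cast_pow] at h1
    rw [← hG, hdvd, mul_zero] at h1
    exact pow_ne_zero 2 hτp h1.symm
  obtain ⟨z, hz, -⟩ := hensels_lemma (F := f'.map ψ) (a := (m : ℤ_[p])) (by
    rw [coe_aeval_eq_eval, hf'1, one_pow]
    exact hf'0)
  have hroot : ∀ (r : K[X]) (r' : A[X]), r'.map (algebraMap A K) = C (algebraMap A K h) * r →
      Ψ h * aeval (z : ℚ_[p]) r = ((r'.map ψ).eval z : ℤ_[p]) := by
    intro r r' hr
    have h1 := congrArg (aeval (z : ℚ_[p])) hr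
    rw [map_mul, aeval_C, hKΨ, aeval_def, eval₂_map] at h1
    have h2 := hom_eval₂ r' ψ (algebraMap ℤ_[p] ℚ_[p]) z
    rw [← h1, eval_map]
    refine Eq.trans ?_ h2.symm
    congr 1
    exact RingHom.ext hKΨ
  have hΨh : Ψ h ≠ 0 := (map_ne_zero_iff Ψ hΨ).2 hh
  have hz' : aeval (z : ℚ_[p]) f = 0 := by
    have := hroot f f' hf'
    rw [← coe_aeval_eq_eval, hz, PadicInt.coe_zero] at this
    exact (mul_eq_zero.1 this).resolve_left hΨh
  refine ⟨(pb.lift (z : ℚ_[p]) hz').toRingHom, fun x hx => ?_⟩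
  obtain ⟨q', hq'⟩ := hF x hx
  have h1 : (pb.lift (z : ℚ_[p]) hz').toRingHom x = aeval (z : ℚ_[p]) (q x) := by
    conv_lhs => rw [hq x]
    exact pb.lift_aeval _ _ _
  have h2 := congrArg norm (hroot _ _ hq')
  have h3 : ‖Ψ h‖ = 1 := hψh
  rw [norm_mul, h3, one_mul] at h2
  rw [h1, h2]
  exact PadicInt.norm_le_one _

end PadicEmbedding

namespace Specialization
open MvPolynomial
open scoped Pointwise

variable {ι O K κ : Type*} [CommRing O] [Field K] [Algebra O K] [Field κ]

/-- `f` is regular at the point `a` of the special fibre, and takes the value `c` there. -/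
def HasVal (res : O →+* κ) (x : ι → K) (a : ι → κ) (f : K) (c : κ) : Prop :=
  ∃ P Q : MvPolynomial ι O, eval₂ res a Q ≠ 0 ∧ f * aeval x Q = aeval x P ∧
    c * eval₂ res a Q = eval₂ res a P

variable {res : O →+* κ} {x : ι → K} {a : ι → κ} {f g : K} {c d : κ}

lemma HasVal.unique (hx : AlgebraicIndependent O x) (h : HasVal res x a f c)
    (h' : HasVal res x a f d) : c = d := by
  obtain ⟨P, Q, hQ, h1, h2⟩ := h
  obtain ⟨P', Q', hQ', h1', h2'⟩ := h'
  have : P' * Q = P * Q' := hx (by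
    rw [map_mul, map_mul, ← h1, ← h1']; ring)
  have h3 := congrArg (eval₂ res a) this
  rw [eval₂_mul, eval₂_mul, ← h2, ← h2'] at h3
  have h4 : (d - c) * (eval₂ res a Q * eval₂ res a Q') = 0 := by linear_combination h3
  rcases mul_eq_zero.1 h4 with h | h
  · exact (sub_eq_zero.1 h).symm
  · exact absurd h (mul_ne_zero hQ hQ')

variable (res x a) in
lemma HasVal.poly (P : MvPolynomial ι O) : HasVal res x a (aeval x P) (eval₂ res a P) :=
  ⟨P, 1, by simp, by simp, by simp⟩

variable (res x a) in
lemma HasVal.const (r : O) : HasVal res x a (algebraMap O K r) (res r) := by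
  simpa using HasVal.poly res x a (C r)

variable (res x a) in
lemma HasVal.var (i : ι) : HasVal res x a (x i) (a i) := by
  simpa using HasVal.poly res x a (X i)

lemma HasVal.add (h : HasVal res x a f c) (h' : HasVal res x a g d) :
    HasVal res x a (f + g) (c + d) := by
  obtain ⟨P, Q, hQ, h1, h2⟩ := h
  obtain ⟨P', Q', hQ', h1', h2'⟩ := h'
  refine ⟨P * Q' + P' * Q, Q * Q', ?_, ?_, ?_⟩
  · rw [eval₂_mul]; exact mul_ne_zero hQ hQ'
  · simp only [map_mul, map_add, ← h1, ← h1']; ring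
  · simp only [eval₂_mul, eval₂_add, ← h2, ← h2']; ring

lemma HasVal.mul (h : HasVal res x a f c) (h' : HasVal res x a g d) :
    HasVal res x a (f * g) (c * d) := by
  obtain ⟨P, Q, hQ, h1, h2⟩ := h
  obtain ⟨P', Q', hQ', h1', h2'⟩ := h'
  refine ⟨P * P', Q * Q', ?_, ?_, ?_⟩
  · rw [eval₂_mul]; exact mul_ne_zero hQ hQ'
  · simp only [map_mul, ← h1, ← h1']; ring
  · simp only [eval₂_mul, ← h2, ← h2']; ring

lemma HasVal.sub_const (h : HasVal res x a f c) (r : O) :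
    HasVal res x a (f - algebraMap O K r) (c - res r) := by
  have := h.add (HasVal.const res x a (-r))
  simpa [sub_eq_add_neg] using this

lemma HasVal.ne_zero (hx : AlgebraicIndependent O x) (h : HasVal res x a f c) (hc : c ≠ 0) :
    f ≠ 0 := by
  rintro rfl
  exact hc (h.unique hx (by simpa using HasVal.const res x a 0))

lemma HasVal.inv (hx : AlgebraicIndependent O x) (h : HasVal res x a f c) (hc : c ≠ 0) :
    HasVal res x a f⁻¹ c⁻¹ := by
  have hf := h.ne_zero hx hc
  obtain ⟨P, Q, hQ, h1, h2⟩ := h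
  refine ⟨Q, P, ?_, ?_, ?_⟩
  · rw [← h2]; exact mul_ne_zero hc hQ
  · rw [← h1]; field_simp
  · rw [← h2]; field_simp

lemma HasVal.map {K' : Type*} [Field K'] [Algebra O K'] (σ : K →ₐ[O] K')
    (h : HasVal res x a f c) : HasVal res (σ ∘ x) a (σ f) c := by
  obtain ⟨P, Q, hQ, h1, h2⟩ := h
  have key : ∀ P : MvPolynomial ι O, aeval (σ ∘ x) P = σ (aeval x P) := fun P => by
    rw [← AlgHom.comp_apply, comp_aeval]; rfl
  exact ⟨P, Q, hQ, by rw [key, key, ← h1, map_mul], h2⟩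

lemma HasVal.subst (hx : AlgebraicIndependent O x) {ι' : Type*} {y : ι' → K} {b : ι' → κ}
    (hy : ∀ i, HasVal res x a (y i) (b i)) (h : HasVal res y b f c) : HasVal res x a f c := by
  have key : ∀ P : MvPolynomial ι' O, HasVal res x a (aeval y P) (eval₂ res b P) := by
    intro P
    induction P using MvPolynomial.induction_on with
    | C r => simpa using HasVal.const res x a r
    | add P Q hP hQ => simpa using hP.add hQ
    | mul_X P i hP => simpa using hP.mul (hy i)
  obtain ⟨P, Q, hQ, h1, h2⟩ := h
  have hQ0 := (key Q).ne_zero hx hQ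
  have := (key P).mul ((key Q).inv hx hQ)
  rw [← h1, ← h2] at this
  simpa [hQ0, hQ, mul_assoc] using this

/-- The local ring of the point `a` of the special fibre. -/
def regularAt (res : O →+* κ) (x : ι → K) (a : ι → κ) : Set K := {f | ∃ c, HasVal res x a f c}

lemma eq_of_regularAt_subset (hres : Function.Surjective res) (hx : AlgebraicIndependent O x)
    {a b : ι → κ} (h : regularAt res x a ⊆ regularAt res x b) : a = b := by
  funext i
  by_contra hab
  obtain ⟨r, hr⟩ := hres (b i)
  have h1 := (HasVal.var res x a i).sub_const r
  have hne : a i - res r ≠ 0 := by rw [hr]; exact sub_ne_zero.2 hab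
  obtain ⟨e, he⟩ := h ⟨_, h1.inv hx hne⟩
  have h2 := ((HasVal.var res x b i).sub_const r).mul he
  rw [mul_inv_cancel₀ (h1.ne_zero hx hne), hr, sub_self, zero_mul] at h2
  have h3 := HasVal.const res x b 1
  rw [map_one, map_one] at h3
  exact zero_ne_one (h2.unique hx h3)

variable {k : Type*} [Field k] [Algebra k K] [Algebra O k] [IsScalarTower O k K]

lemma HasVal.of_map {b : ι → κ} (hx : AlgebraicIndependent O x) {σ : K ≃ₐ[k] K}
    (h : ∀ i, HasVal res x a (σ (x i)) (b i)) (hf : HasVal res x b f c) :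
    HasVal res x a (σ f) c :=
  HasVal.subst hx h (hf.map (σ.restrictScalars O).toAlgHom)

lemma smul_regularAt_subset {b : ι → κ} (hx : AlgebraicIndependent O x) {σ : K ≃ₐ[k] K}
    (h : ∀ i, HasVal res x a (σ (x i)) (b i)) : σ • regularAt res x b ⊆ regularAt res x a := by
  rintro _ ⟨f, ⟨c, hc⟩, rfl⟩
  exact ⟨c, hc.of_map hx h⟩

lemma smul_regularAt_eq {b : ι → κ} (hres : Function.Surjective res)
    (hx : AlgebraicIndependent O x) {σ : K ≃ₐ[k] K}
    (h : ∀ i, HasVal res x a (σ (x i)) (b i)) (h' : ∀ i, ∃ c, HasVal res x b (σ⁻¹ (x i)) c) :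
    σ • regularAt res x b = regularAt res x a := by
  refine (smul_regularAt_subset hx h).antisymm ?_
  choose a' ha' using h'
  have h1 : regularAt res x a' ⊆ σ • regularAt res x b := by
    have := smul_regularAt_subset hx ha'
    rwa [← Set.subset_smul_set_iff] at this
  have h2 := eq_of_regularAt_subset hres hx (h1.trans (smul_regularAt_subset hx h))
  rwa [h2] at h1

lemma exists_smul_regularAt_eq [Fintype ι] (hres : Function.Surjective res)
    (hx : AlgebraicIndependent O x) (σ : K ≃ₐ[k] K) {P Q P' Q' : ι → MvPolynomial ι O}
    {N D : MvPolynomial ι O} (hPQ : ∀ i, σ (x i) * aeval x (Q i) = aeval x (P i))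
    (hPQ' : ∀ i, σ⁻¹ (x i) * aeval x (Q' i) = aeval x (P' i))
    (hND : σ (aeval x (∏ i, Q' i)) * aeval x D = aeval x N)
    (hG : eval₂ res a ((∏ i, Q i) * N * D) ≠ 0) :
    ∃ b, σ⁻¹ • regularAt res x a = regularAt res x b := by
  rw [eval₂_mul, eval₂_mul] at hG
  have hD := right_ne_zero_of_mul hG
  have hN := right_ne_zero_of_mul (left_ne_zero_of_mul hG)
  have hQ : ∀ i, eval₂ res a (Q i) ≠ 0 := fun i hi => by
    have := left_ne_zero_of_mul (left_ne_zero_of_mul hG)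
    rw [eval₂_prod] at this
    exact this (Finset.prod_eq_zero (Finset.mem_univ i) hi)
  have h : ∀ i, HasVal res x a (σ (x i)) (eval₂ res a (P i) / eval₂ res a (Q i)) := fun i =>
    ⟨P i, Q i, hQ i, hPQ i, div_mul_cancel₀ _ (hQ i)⟩
  set b : ι → κ := fun i => eval₂ res a (P i) / eval₂ res a (Q i) with hb
  have h1 : HasVal res x a (σ (aeval x (∏ i, Q' i))) (eval₂ res a N / eval₂ res a D) :=
    ⟨N, D, hD, hND, div_mul_cancel₀ _ hD⟩
  have h2 := (HasVal.poly res x b (∏ i, Q' i)).of_map hx h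
  have h3 : eval₂ res b (∏ i, Q' i) ≠ 0 := by
    rw [h2.unique hx h1]; exact div_ne_zero hN hD
  have h4 : ∀ i, eval₂ res b (Q' i) ≠ 0 := fun i hi => by
    rw [eval₂_prod] at h3
    exact h3 (Finset.prod_eq_zero (Finset.mem_univ i) hi)
  refine ⟨b, inv_smul_eq_iff.2 (smul_regularAt_eq hres hx h fun i => ?_).symm⟩
  exact ⟨_, P' i, Q' i, h4 i, hPQ' i, div_mul_cancel₀ _ (h4 i)⟩

end Specialization

namespace Specialization
open MvPolynomial
open scoped Pointwise

lemma card_zeros_le {p : ℕ} [Fact p.Prime] {G : MvPolynomial (Fin 2) (ZMod p)} (hG : G ≠ 0) :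
    (Finset.univ.filter fun a : Fin 2 → ZMod p => eval a G = 0).card ≤ G.totalDegree * p := by
  have h := schwartz_zippel_totalDegree hG Finset.univ
  have hp : (0 : ℚ≥0) < p := by exact_mod_cast (Fact.out : p.Prime).pos
  rw [Fintype.piFinset_univ, Finset.card_univ, ZMod.card, div_le_div_iff₀ (by positivity) hp] at h
  have h2 : ((Finset.univ.filter fun a : Fin 2 → ZMod p => eval a G = 0).card : ℚ≥0) ≤
      G.totalDegree * p := by
    refine le_of_mul_le_mul_right ?_ hp
    calc _ ≤ _ := h
      _ = _ := by ring
  exact_mod_cast h2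

open Classical in
/-- The set of local rings of the points of the affine plane over the finite field `κ`. -/
noncomputable def localRings {ι O K κ : Type*} [CommRing O] [Field K] [Algebra O K] [Field κ]
    [Fintype (ι → κ)] (res : O →+* κ) (x : ι → K) : Finset (Set K) :=
  Finset.univ.image (regularAt res x)

lemma mem_localRings {ι O K κ : Type*} [CommRing O] [Field K] [Algebra O K] [Field κ]
    [Fintype (ι → κ)] {res : O →+* κ} {x : ι → K} {R : Set K} :
    R ∈ localRings res x ↔ ∃ a, regularAt res x a = R := by
  simp [localRings]

lemma card_localRings {O K : Type*} [CommRing O] [Field K] [Algebra O K] {p : ℕ} [Fact p.Prime]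
    {res : O →+* ZMod p} {x : Fin 2 → K} (hres : Function.Surjective res)
    (hx : AlgebraicIndependent O x) : (localRings res x).card = p ^ 2 := by
  rw [localRings, Finset.card_image_of_injective, Finset.card_univ]
  · simp
  · exact fun a b h => eq_of_regularAt_subset hres hx h.le

lemma exists_map_eq {ι k : Type*} [Field k] {O : Subring k} {P : MvPolynomial ι k}
    (h : ∀ c ∈ P.coeffs, c ∈ O) : ∃ P' : MvPolynomial ι O, MvPolynomial.map (algebraMap O k) P' = P := by
  have : P ∈ Set.range (MvPolynomial.map (algebraMap O k)) := by
    rw [mem_range_map_iff_coeffs_subset]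
    intro c hc
    exact ⟨⟨c, h c hc⟩, rfl⟩
  exact this

lemma exitCount_localRings_le {O K : Type*} [CommRing O] [Field K] [Algebra O K]
    {k : Type*} [Field k] [Algebra k K] [Algebra O k] [IsScalarTower O k K] {p : ℕ} [Fact p.Prime]
    {res : O →+* ZMod p} {x : Fin 2 → K} (hres : Function.Surjective res)
    (hx : AlgebraicIndependent O x) (σ : K ≃ₐ[k] K) {P Q P' Q' : Fin 2 → MvPolynomial (Fin 2) O}
    {N D : MvPolynomial (Fin 2) O} (hPQ : ∀ i, σ (x i) * aeval x (Q i) = aeval x (P i))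
    (hPQ' : ∀ i, σ⁻¹ (x i) * aeval x (Q' i) = aeval x (P' i))
    (hND : σ (aeval x (∏ i, Q' i)) * aeval x D = aeval x N)
    {G : MvPolynomial (Fin 2) O} (hGdef : (∏ i, Q i) * N * D = G)
    (hG : MvPolynomial.map res G ≠ 0) :
    PointCount.exitCount (localRings res x) σ⁻¹ ≤ G.totalDegree * p := by
  classical
  rw [PointCount.exitCount_eq]
  calc _ ≤ ((Finset.univ.filter fun a : Fin 2 → ZMod p => eval a (MvPolynomial.map res G) = 0).image
        (regularAt res x)).card := by
        refine Finset.card_le_card fun R hR => ?_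
        rw [Finset.mem_filter, mem_localRings] at hR
        obtain ⟨⟨a, rfl⟩, ha⟩ := hR
        refine Finset.mem_image_of_mem _ (Finset.mem_filter.2 ⟨Finset.mem_univ _, ?_⟩)
        by_contra h
        rw [eval_map, ← hGdef] at h
        obtain ⟨b, hb⟩ := exists_smul_regularAt_eq hres hx σ hPQ hPQ' hND h
        exact ha (mem_localRings.2 ⟨b, hb.symm⟩)
    _ ≤ _ := Finset.card_image_le
    _ ≤ _ := card_zeros_le hG
    _ ≤ _ := Nat.mul_le_mul_right _ (Finset.sup_mono (support_map_subset _ _))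

/-- The exit counts of an automorphism of `k(x,y)` on the local rings of the points modulo `p` are
bounded by a multiple of `p`, as soon as the automorphism is defined modulo `p`. -/
theorem exists_exitCount_le {k K : Type*} [Field k] [Field K] [Algebra k K] {x : Fin 2 → K}
    (hx : AlgebraicIndependent k x)
    (hfrac : ∀ f : K, ∃ P Q : MvPolynomial (Fin 2) k, aeval x Q ≠ 0 ∧ f * aeval x Q = aeval x P)
    (σ : K ≃ₐ[k] K) :
    ∃ (F : Finset k) (C : ℕ), ∀ (O : Subring k) (p : ℕ) [Fact p.Prime] (res : O →+* ZMod p),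
      (∀ f ∈ F, f ∈ O) → PointCount.exitCount (localRings res x) σ⁻¹ ≤ C * p := by
  classical
  choose P Q hQ hPQ using fun i => hfrac (σ (x i))
  choose P' Q' hQ' hPQ' using fun i => hfrac (σ⁻¹ (x i))
  obtain ⟨N, D, hD, hND⟩ := hfrac (σ (aeval x (∏ i, Q' i)))
  have hN : aeval x N ≠ 0 := by
    rw [← hND]
    refine mul_ne_zero ?_ hD
    rw [map_ne_zero_iff _ σ.injective, map_prod, Finset.prod_ne_zero_iff]
    exact fun i _ => hQ' i
  have hG : (∏ i, Q i) * N * D ≠ 0 := by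
    intro h
    have := congrArg (aeval x) h
    rw [map_mul, map_mul, map_zero, map_prod] at this
    exact mul_ne_zero (mul_ne_zero (Finset.prod_ne_zero_iff.2 fun i _ => hQ i) hN) hD this
  obtain ⟨m, hm⟩ := ne_zero_iff.1 hG
  refine ⟨insert (coeff m ((∏ i, Q i) * N * D))⁻¹ (Finset.univ.biUnion (fun i => (P i).coeffs ∪
    (Q i).coeffs ∪ (P' i).coeffs ∪ (Q' i).coeffs) ∪ N.coeffs ∪ D.coeffs),
    ((∏ i, Q i) * N * D).totalDegree, fun O p _ res hF => ?_⟩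
  simp only [Finset.mem_insert, Finset.mem_union, Finset.mem_biUnion, Finset.mem_univ,
    true_and] at hF
  have hg := hF _ (Or.inl rfl)
  have hFN : ∀ c ∈ N.coeffs, c ∈ O := fun c hc => hF c (by tauto)
  have hFD : ∀ c ∈ D.coeffs, c ∈ O := fun c hc => hF c (by tauto)
  have hFi : ∀ i, ∀ c, ((c ∈ (P i).coeffs ∨ c ∈ (Q i).coeffs) ∨ c ∈ (P' i).coeffs) ∨
      c ∈ (Q' i).coeffs → c ∈ O := fun i c hc => hF c (Or.inr (Or.inl (Or.inl ⟨i, hc⟩)))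
  clear hF
  have lift : ∀ R : MvPolynomial (Fin 2) k, (∀ c ∈ R.coeffs, c ∈ O) →
      ∃ R' : MvPolynomial (Fin 2) O, MvPolynomial.map (algebraMap O k) R' = R := fun R h => exists_map_eq h
  obtain ⟨N₀, rfl⟩ := lift N hFN
  obtain ⟨D₀, rfl⟩ := lift D hFD
  choose P₀ hP₀ using fun i => lift (P i) fun c hc => hFi i c (by tauto)
  choose Q₀ hQ₀ using fun i => lift (Q i) fun c hc => hFi i c (by tauto)
  choose P₀' hP₀' using fun i => lift (P' i) fun c hc => hFi i c (by tauto)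
  choose Q₀' hQ₀' using fun i => lift (Q' i) fun c hc => hFi i c (by tauto)
  obtain rfl : _ = P := funext hP₀
  obtain rfl : _ = Q := funext hQ₀
  obtain rfl : _ = P' := funext hP₀'
  obtain rfl : _ = Q' := funext hQ₀'
  have hinj : Function.Injective (algebraMap O k) := Subtype.val_injective
  have hmapG : (∏ i, MvPolynomial.map (algebraMap O k) (Q₀ i)) * MvPolynomial.map (algebraMap O k) N₀ *
      MvPolynomial.map (algebraMap O k) D₀ = MvPolynomial.map (algebraMap O k) ((∏ i, Q₀ i) * N₀ * D₀) := by
    simp only [map_mul, map_prod]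
  rw [hmapG] at hm hg ⊢
  rw [coeff_map] at hm hg
  obtain ⟨G, hGdef⟩ : ∃ G, (∏ i, Q₀ i) * N₀ * D₀ = G := ⟨_, rfl⟩
  rw [hGdef] at hm hg ⊢
  have hdeg : G.totalDegree ≤ (MvPolynomial.map (algebraMap O k) G).totalDegree := by
    refine Finset.sup_mono ?_
    rw [support_map_of_injective _ hinj]
  refine le_trans (exitCount_localRings_le (O := O) (P := P₀) (Q := Q₀) (P' := P₀') (Q' := Q₀')
    (N := N₀) (D := D₀) (G := G) (ZMod.ringHom_surjective res) (hx.restrictScalars hinj) σ ?_ ?_ ?_ hGdef ?_)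
    (Nat.mul_le_mul_right _ hdeg)
  · simpa only [aeval_map_algebraMap] using hPQ
  · simpa only [aeval_map_algebraMap] using hPQ'
  · simpa only [← map_prod, aeval_map_algebraMap] using hND
  · rw [ne_zero_iff]
    refine ⟨m, ?_⟩
    rw [coeff_map]
    intro h0
    have h1 : coeff m G * ⟨_, hg⟩ = 1 := by
      ext
      exact mul_inv_cancel₀ hm
    have h2 := congrArg res h1
    rw [map_mul, h0, zero_mul, map_one] at h2
    exact zero_ne_one h2

end Specialization

namespace GaussNorm
open MvPolynomial

theorem exists_absoluteValue_mvPolynomial {k : Type*} [Field k] (v : AbsoluteValue k ℝ)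
    (hv : IsNonarchimedean v) {r : ℝ} (hr : 0 < r) (n : ℕ) :
    ∃ w : AbsoluteValue (MvPolynomial (Fin n) k) ℝ, IsNonarchimedean w ∧ (∀ q, w (C q) = v q) ∧
      (∀ i, w (X i) = r) ∧ ∀ P m, v (coeff m P) * r ^ (∑ i, m i) ≤ w P := by
  induction n with
  | zero =>
    have h0 : ∀ P : MvPolynomial (Fin 0) k, C (coeff 0 P) = P := fun P =>
      (eq_C_of_isEmpty P).symm
    refine ⟨v.comp (f := constantCoeff) fun P Q h => ?_, ?_, ?_, ?_, ?_⟩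
    · rw [← h0 P, ← h0 Q]
      exact congrArg C h
    · intro P Q
      have := hv (constantCoeff P) (constantCoeff Q)
      rwa [← map_add] at this
    · intro q
      exact congrArg v (constantCoeff_C _ q)
    · intro i; exact i.elim0
    · intro P m
      rw [Subsingleton.elim m 0]
      simp only [Finset.univ_eq_empty, Finset.sum_empty, pow_zero, mul_one]
      exact le_rfl
  | succ n ih =>
    obtain ⟨w, hw, hwC, hwX, hwcoeff⟩ := ih
    refine ⟨⟨⟨fun P => (finSuccEquiv k n P).gaussNorm w r, fun P Q => ?_⟩, fun P => ?_, fun P => ?_,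
      fun P Q => ?_⟩, ?_, ?_, ?_, ?_⟩
    · rw [map_mul, Polynomial.gaussNorm_mul hw hr]
    · exact Polynomial.gaussNorm_nonneg _ _ hr.le
    · change (finSuccEquiv k n P).gaussNorm w r = 0 ↔ P = 0
      rw [Polynomial.gaussNorm_eq_zero_iff w _ (fun _ h => w.eq_zero.1 h) hr,
        EmbeddingLike.map_eq_zero_iff]
    · change (finSuccEquiv k n (P + Q)).gaussNorm w r ≤
        (finSuccEquiv k n P).gaussNorm w r + (finSuccEquiv k n Q).gaussNorm w r
      rw [map_add]
      exact (Polynomial.isNonarchimedean_gaussNorm w hw hr.le _ _).trans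
        (max_le_add_of_nonneg (Polynomial.gaussNorm_nonneg _ _ hr.le)
          (Polynomial.gaussNorm_nonneg _ _ hr.le))
    · intro P Q
      change (finSuccEquiv k n (P + Q)).gaussNorm w r ≤
        max ((finSuccEquiv k n P).gaussNorm w r) ((finSuccEquiv k n Q).gaussNorm w r)
      rw [map_add]
      exact Polynomial.isNonarchimedean_gaussNorm w hw hr.le _ _
    · intro q
      change (finSuccEquiv k n (C q)).gaussNorm w r = v q
      rw [finSuccEquiv_apply, eval₂Hom_C, RingHom.comp_apply, Polynomial.gaussNorm_C, hwC]
    · intro i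
      change (finSuccEquiv k n (X i)).gaussNorm w r = r
      induction i using Fin.cases with
      | zero =>
        rw [finSuccEquiv_X_zero, ← Polynomial.monomial_one_one_eq_X,
          Polynomial.gaussNorm_monomial, map_one, one_mul, pow_one]
      | succ i => rw [finSuccEquiv_X_succ, Polynomial.gaussNorm_C, hwX]
    · intro P m
      change _ ≤ (finSuccEquiv k n P).gaussNorm w r
      have h1 := hwcoeff ((finSuccEquiv k n P).coeff (m 0)) m.tail
      rw [finSuccEquiv_coeff_coeff, Finsupp.cons_tail] at h1
      calc v (coeff m P) * r ^ (∑ i, m i)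
          = v (coeff m P) * r ^ (∑ i, m.tail i) * r ^ m 0 := by
            rw [Fin.sum_univ_succ, add_comm (m 0), pow_add]
            simp only [Finsupp.tail_apply, mul_assoc]
        _ ≤ w ((finSuccEquiv k n P).coeff (m 0)) * r ^ m 0 := by gcongr
        _ ≤ _ := Polynomial.le_gaussNorm _ _ hr.le _

theorem exists_absoluteValue_extension {A K : Type*} [CommRing A] [Field K] (w : AbsoluteValue A ℝ)
    (hw : IsNonarchimedean w) (θ : A →+* K) (hθ : Function.Injective θ)
    (hfrac : ∀ f : K, ∃ P Q : A, θ Q ≠ 0 ∧ f * θ Q = θ P) :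
    ∃ W : AbsoluteValue K ℝ, IsNonarchimedean W ∧ ∀ P, W (θ P) = w P := by
  choose num den hden hnd using hfrac
  have hw0 : ∀ {P : A}, θ P ≠ 0 → w P ≠ 0 := fun h => by
    rw [Ne, w.eq_zero]
    rintro rfl
    exact h (map_zero θ)
  have key : ∀ (f : K) (P Q : A), θ Q ≠ 0 → f * θ Q = θ P →
      w (num f) / w (den f) = w P / w Q := by
    intro f P Q hQ h
    rw [div_eq_div_iff (hw0 (hden f)) (hw0 hQ), ← map_mul, ← map_mul]
    congr 1
    apply hθ
    rw [map_mul, map_mul, ← hnd, ← h]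
    ring
  have hmul : ∀ f g, w (num (f * g)) / w (den (f * g)) =
      w (num f) / w (den f) * (w (num g) / w (den g)) := by
    intro f g
    rw [key (f * g) (num f * num g) (den f * den g), map_mul, map_mul, mul_div_mul_comm]
    · rw [map_mul]; exact mul_ne_zero (hden f) (hden g)
    · rw [map_mul, map_mul, ← hnd, ← hnd]; ring
  have hadd : ∀ f g, w (num (f + g)) / w (den (f + g)) ≤
      max (w (num f) / w (den f)) (w (num g) / w (den g)) := by
    intro f g
    have hf := (w.nonneg (den f)).lt_of_ne (hw0 (hden f)).symm
    have hg := (w.nonneg (den g)).lt_of_ne (hw0 (hden g)).symm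
    rw [key (f + g) (num f * den g + num g * den f) (den f * den g), map_mul,
      div_le_iff₀ (mul_pos hf hg)]
    · refine (hw _ _).trans (max_le ?_ ?_)
      · rw [map_mul]
        calc w (num f) * w (den g) = w (num f) / w (den f) * (w (den f) * w (den g)) := by
              field_simp
          _ ≤ _ := by gcongr; exact le_max_left _ _
      · rw [map_mul]
        calc w (num g) * w (den f) = w (num g) / w (den g) * (w (den f) * w (den g)) := by
              field_simp
          _ ≤ _ := by gcongr; exact le_max_right _ _
    · rw [map_mul]; exact mul_ne_zero (hden f) (hden g)
    · rw [map_mul, map_add, map_mul, map_mul, ← hnd, ← hnd]; ring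
  have hnn : ∀ f, 0 ≤ w (num f) / w (den f) := fun f => div_nonneg (w.nonneg _) (w.nonneg _)
  refine ⟨⟨⟨fun f => w (num f) / w (den f), hmul⟩, hnn, fun f => ?_, fun f g =>
    (hadd f g).trans (max_le_add_of_nonneg (hnn f) (hnn g))⟩, hadd, fun P => ?_⟩
  · change w (num f) / w (den f) = 0 ↔ f = 0
    rw [div_eq_zero_iff, or_iff_left (hw0 (hden f)), w.eq_zero, ← map_eq_zero_iff θ hθ, ← hnd,
      mul_eq_zero, or_iff_left (hden f)]
  · change w (num (θ P)) / w (den (θ P)) = w P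
    have h1 : θ 1 ≠ 0 := by rw [map_one]; exact one_ne_zero
    rw [key (θ P) P 1 h1 (by simp)]
    have h2 : w 1 * w 1 = w 1 := by rw [← map_mul, one_mul]
    rw [mul_right_cancel₀ (hw0 h1) (h2.trans (one_mul _).symm), div_one]

/-- The Gauss norm of radius `r` on the field of rational functions. -/
theorem exists_absoluteValue {k K : Type*} [Field k] [Field K] [Algebra k K] (v : AbsoluteValue k ℝ)
    (hv : IsNonarchimedean v) {r : ℝ} (hr : 0 < r) {n : ℕ} {x : Fin n → K}
    (hx : AlgebraicIndependent k x)
    (hfrac : ∀ f : K, ∃ P Q : MvPolynomial (Fin n) k, aeval x Q ≠ 0 ∧ f * aeval x Q = aeval x P) :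
    ∃ w : AbsoluteValue K ℝ, IsNonarchimedean w ∧ (∀ q, w (algebraMap k K q) = v q) ∧
      (∀ i, w (x i) = r) ∧ ∀ P m, v (coeff m P) * r ^ (∑ i, m i) ≤ w (aeval x P) := by
  obtain ⟨w, hw, hwC, hwX, hwcoeff⟩ := exists_absoluteValue_mvPolynomial v hv hr n
  obtain ⟨W, hW, hWw⟩ := exists_absoluteValue_extension w hw (aeval x : _ →ₐ[k] K).toRingHom hx hfrac
  refine ⟨W, hW, fun q => ?_, fun i => ?_, fun P m => ?_⟩
  · have := hWw (C q)
    simpa [hwC] using this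
  · have := hWw (X i)
    simpa [hwX] using this
  · exact (hwcoeff P m).trans_eq (hWw P).symm

end GaussNorm

namespace GaussNorm
open MvPolynomial Specialization
open scoped Pointwise

lemma apply_sum_le {K ι : Type*} [Field K] {w : AbsoluteValue K ℝ} (hw : IsNonarchimedean w)
    (s : Finset ι) (f : ι → K) {B : ℝ} (hB : 0 ≤ B) (h : ∀ i ∈ s, w (f i) ≤ B) :
    w (∑ i ∈ s, f i) ≤ B := by
  classical
  induction s using Finset.induction_on with
  | empty => simpa using hB
  | insert i s hi ih =>
    rw [Finset.sum_insert hi]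
    exact (hw _ _).trans (max_le (h i (Finset.mem_insert_self i s))
      (ih fun j hj => h j (Finset.mem_insert_of_mem hj)))

lemma apply_sub_le {K : Type*} [Field K] {w : AbsoluteValue K ℝ} (hw : IsNonarchimedean w)
    {f g : K} {B : ℝ} (hf : w f ≤ B) (hg : w g ≤ B) : w (f - g) ≤ B := by
  rw [sub_eq_add_neg]
  exact (hw _ _).trans (max_le hf (by rwa [w.map_neg]))

lemma apply_add_le {K : Type*} [Field K] {w : AbsoluteValue K ℝ} (hw : IsNonarchimedean w)
    {f g : K} {B : ℝ} (hf : w f ≤ B) (hg : w g ≤ B) : w (f + g) ≤ B :=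
  (hw _ _).trans (max_le hf hg)

/-- `v` is an absolute value on `k` extending the `p`-adic one, of ramification index and residue
degree one, with ring of integers `O` and residue map `res`. -/
structure IsUnramified {k : Type*} [Field k] (p : ℕ) (v : AbsoluteValue k ℝ) (O : Subring k)
    (res : O →+* ZMod p) : Prop where
  nonarch : IsNonarchimedean v
  apply_p : v p = (p : ℝ)⁻¹
  mem_iff : ∀ c, c ∈ O ↔ v c ≤ 1
  apply_le : ∀ c : O, res c = 0 → v c ≤ (p : ℝ)⁻¹
  apply_eq : ∀ c : O, res c ≠ 0 → v c = 1
  exists_int : ∀ c : O, ∃ n : ℤ, v (c - n) ≤ (p : ℝ)⁻¹ ^ 2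

/-- `w` is the Gauss norm of radius `p⁻¹` in the coordinates `x`. -/
structure IsGauss {k K : Type*} [Field k] [Field K] [Algebra k K] {n : ℕ} (p : ℕ)
    (v : AbsoluteValue k ℝ) (x : Fin n → K) (w : AbsoluteValue K ℝ) : Prop where
  nonarch : IsNonarchimedean w
  apply_algebraMap : ∀ q, w (algebraMap k K q) = v q
  apply_var : ∀ i, w (x i) = (p : ℝ)⁻¹
  le_apply : ∀ P m, v (coeff m P) * (p : ℝ)⁻¹ ^ (∑ i, m i) ≤ w (aeval x P)
  indep : AlgebraicIndependent k x
  exists_frac : ∀ f : K, ∃ P Q : MvPolynomial (Fin n) k, aeval x Q ≠ 0 ∧ f * aeval x Q = aeval x P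

variable {k K : Type*} [Field k] [Field K] [Algebra k K] {n p : ℕ} {v : AbsoluteValue k ℝ}
  {O : Subring k} {res : O →+* ZMod p} {x : Fin n → K} {w : AbsoluteValue K ℝ}

variable (p) in
lemma inv_prime_pos [Fact p.Prime] : 0 < (p : ℝ)⁻¹ :=
  inv_pos.2 (by exact_mod_cast (Fact.out : p.Prime).pos)

variable (p) in
lemma inv_prime_lt_one [Fact p.Prime] : (p : ℝ)⁻¹ < 1 :=
  inv_lt_one_of_one_lt₀ (by exact_mod_cast (Fact.out : p.Prime).one_lt)

lemma IsGauss.indep' (W : IsGauss p v x w) (O : Subring k) : AlgebraicIndependent O x :=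
  W.indep.restrictScalars Subtype.val_injective

lemma IsGauss.aeval_le (W : IsGauss p v x w) {B : ℝ} (hB : 0 ≤ B) (y : Fin n → K)
    (hy : ∀ i, w (y i) ≤ (p : ℝ)⁻¹) (P : MvPolynomial (Fin n) k)
    (h : ∀ m ∈ P.support, v (coeff m P) * (p : ℝ)⁻¹ ^ (∑ i, m i) ≤ B) : w (aeval y P) ≤ B := by
  rw [aeval_def, eval₂_eq']
  refine apply_sum_le W.nonarch _ _ hB fun m hm => le_trans ?_ (h m hm)
  rw [map_mul, map_prod, W.apply_algebraMap, ← Finset.prod_pow_eq_pow_sum]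
  refine mul_le_mul_of_nonneg_left ?_ (v.nonneg _)
  refine Finset.prod_le_prod (fun i _ => w.nonneg _) fun i _ => ?_
  rw [map_pow]
  exact pow_le_pow_left₀ (w.nonneg _) (hy i) _

lemma eval₂_zero_eq {O : Type*} [CommRing O] (res : O →+* ZMod p) (P : MvPolynomial (Fin n) O) :
    eval₂ res 0 P = res (coeff 0 P) := by
  simp [constantCoeff_eq]

section
variable [Fact p.Prime]

lemma aeval_le_one (V : IsUnramified p v O res) (W : IsGauss p v x w)
    (P : MvPolynomial (Fin n) O) : w (aeval x P) ≤ 1 := by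
  rw [← aeval_map_algebraMap k]
  refine W.aeval_le zero_le_one x (fun i => (W.apply_var i).le) _ fun m _ => ?_
  rw [coeff_map]
  exact mul_le_one₀ ((V.mem_iff _).1 (coeff m P).2) (by positivity)
    (pow_le_one₀ (inv_prime_pos p).le (inv_prime_lt_one p).le)

lemma aeval_le_inv (V : IsUnramified p v O res) (W : IsGauss p v x w)
    (P : MvPolynomial (Fin n) O) (hP : eval₂ res 0 P = 0) :
    w (aeval x P) ≤ (p : ℝ)⁻¹ := by
  rw [← aeval_map_algebraMap k]
  refine W.aeval_le (inv_prime_pos p).le x (fun i => (W.apply_var i).le) _ fun m _ => ?_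
  rw [coeff_map]
  by_cases hm : m = 0
  · subst hm
    rw [eval₂_zero_eq] at hP
    simpa using! V.apply_le _ hP
  · have h1 : 1 ≤ ∑ i, m i := by
      by_contra h
      apply hm
      ext i
      exact Finset.sum_eq_zero_iff.1 (Nat.lt_one_iff.1 (not_le.1 h)) i (Finset.mem_univ i)
    calc v (algebraMap O k (coeff m P)) * (p : ℝ)⁻¹ ^ (∑ i, m i) ≤ 1 * (p : ℝ)⁻¹ ^ 1 :=
          mul_le_mul ((V.mem_iff _).1 (coeff m P).2)
            (pow_le_pow_of_le_one (inv_prime_pos p).le (inv_prime_lt_one p).le h1) (by positivity) zero_le_one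
      _ = _ := by ring

lemma aeval_eq_one (V : IsUnramified p v O res) (W : IsGauss p v x w)
    (P : MvPolynomial (Fin n) O) (hP : eval₂ res 0 P ≠ 0) :
    w (aeval x P) = 1 := by
  refine (aeval_le_one V W P).antisymm ?_
  rw [eval₂_zero_eq] at hP
  have := W.le_apply (MvPolynomial.map (algebraMap O k) P) 0
  rw [aeval_map_algebraMap, coeff_map, show v (algebraMap O k (coeff 0 P)) = 1 from
    V.apply_eq _ hP] at this
  simpa using this

lemma apply_le_one (V : IsUnramified p v O res) (W : IsGauss p v x w)
    {f : K} {c : ZMod p} (h : HasVal res x 0 f c) : w f ≤ 1 := by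
  obtain ⟨P, Q, hQ, h1, -⟩ := h
  have := congrArg w h1
  rw [map_mul, aeval_eq_one V W Q hQ, mul_one] at this
  exact this.trans_le (aeval_le_one V W P)

lemma apply_le_inv (V : IsUnramified p v O res) (W : IsGauss p v x w)
    {f : K} (h : HasVal res x 0 f 0) : w f ≤ (p : ℝ)⁻¹ := by
  obtain ⟨P, Q, hQ, h1, h2⟩ := h
  have := congrArg w h1
  rw [map_mul, aeval_eq_one V W Q hQ, mul_one] at this
  exact this.trans_le (aeval_le_inv V W P (by rw [← h2, zero_mul]))

variable {σ : K ≃ₐ[k] K}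

lemma hasVal_map (W : IsGauss p v x w) (hσ : σ • regularAt res x 0 ⊆ regularAt res x 0)
    {f : K} {c : ZMod p} (h : HasVal res x 0 f c) : HasVal res x 0 (σ f) c := by
  have hx := W.indep' O
  obtain ⟨d, hd⟩ := hσ (Set.smul_mem_smul_set ⟨c, h⟩)
  change HasVal res x 0 (σ f) d at hd
  obtain ⟨o, ho⟩ := ZMod.ringHom_surjective res d
  by_cases hcd : c = d
  · rwa [hcd]
  · exfalso
    have h1 := h.sub_const o
    have hne : c - res o ≠ 0 := by rw [ho]; exact sub_ne_zero.2 hcd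
    obtain ⟨e, he⟩ := hσ (Set.smul_mem_smul_set ⟨_, h1.inv hx hne⟩)
    have h2 := (hd.sub_const o).mul he
    have h3 : σ (algebraMap O K o) = algebraMap O K o := σ.commutes (o : k)
    have h4 : (σ f - algebraMap O K o) * σ • (f - algebraMap O K o)⁻¹ = 1 := by
      rw [AlgEquiv.smul_def]
      nth_rw 1 [← h3]
      rw [← map_sub, ← map_mul, mul_inv_cancel₀ (h1.ne_zero hx hne),
        map_one]
    rw [h4, ho, sub_self, zero_mul] at h2
    have h5 := HasVal.const res x 0 1
    rw [map_one, map_one] at h5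
    exact zero_ne_one (h2.unique hx h5)

lemma apply_aeval_le (V : IsUnramified p v O res) (W : IsGauss p v x w)
    (hσ : σ • regularAt res x 0 ⊆ regularAt res x 0)
    (P : MvPolynomial (Fin n) k) : w (σ (aeval x P)) ≤ w (aeval x P) := by
  have h : σ (aeval x P) = aeval (fun i => σ (x i)) P := by
    change σ.toAlgHom (aeval x P) = _
    rw [← AlgHom.comp_apply, comp_aeval]
    rfl
  rw [h]
  refine W.aeval_le (w.nonneg _) _ (fun i => ?_) _ fun m _ => W.le_apply P m
  exact apply_le_inv V W (hasVal_map W hσ (HasVal.var res x 0 i))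

lemma apply_map_le (V : IsUnramified p v O res) (W : IsGauss p v x w)
    (hσ : σ • regularAt res x 0 ⊆ regularAt res x 0)
    {f : K} (hf : f ∈ regularAt res x 0) : w (σ f) ≤ w f := by
  obtain ⟨c, P, Q, hQ, h1, -⟩ := hf
  have h2 : w f = w (aeval x P) := by
    rw [← h1, map_mul, aeval_eq_one V W Q hQ, mul_one]
  have h3 : w (σ (aeval x Q)) = 1 := by
    have hx := W.indep' O
    have hv := hasVal_map W hσ (HasVal.poly res x 0 Q)
    have h4 := apply_le_one V W hv
    have h5 := apply_le_one V W (hv.inv hx hQ)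
    rw [map_inv₀] at h5
    have h6 : 0 < w (σ (aeval x Q)) := w.pos (hv.ne_zero hx hQ)
    exact h4.antisymm (by
      by_contra h7
      exact absurd h5 (not_le.2 ((one_lt_inv₀ h6).2 (not_le.1 h7))))
  have h4 : w (σ f) = w (σ (aeval x P)) := by
    rw [← h1, map_mul, map_mul, h3, mul_one]
  rw [h2, h4, ← aeval_map_algebraMap k]
  exact apply_aeval_le V W hσ _

lemma exists_mul_mem (V : IsUnramified p v O res) (P : MvPolynomial (Fin n) k) : ∃ N : ℕ,
    (p : K) ^ N * aeval x P ∈ regularAt res x 0 := by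
  have h1 : ∃ N : ℕ, ∀ c ∈ P.coeffs, (p : k) ^ N * c ∈ O := by
    classical
    induction P.coeffs using Finset.induction_on with
    | empty => exact ⟨0, by simp⟩
    | insert c s hc ih =>
      obtain ⟨N, hN⟩ := ih
      obtain ⟨M, hM⟩ : ∃ M : ℕ, (p : k) ^ M * c ∈ O := by
        obtain ⟨M, hM⟩ := exists_pow_lt_of_lt_one (y := (p : ℝ)⁻¹) (x := (v c + 1)⁻¹)
          (inv_pos.2 (by have := v.nonneg c; linarith)) (inv_prime_lt_one p)
        refine ⟨M, (V.mem_iff _).2 ?_⟩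
        rw [map_mul, map_pow, V.apply_p]
        have h0 := v.nonneg c
        calc _ ≤ (v c + 1)⁻¹ * (v c + 1) := by gcongr; linarith
          _ = 1 := inv_mul_cancel₀ (by linarith)
      have hp : (p : k) ∈ O := natCast_mem O p
      refine ⟨N + M, fun d hd => ?_⟩
      rcases Finset.mem_insert.1 hd with rfl | hd
      · rw [pow_add, mul_assoc]
        exact O.mul_mem (O.pow_mem hp N) hM
      · rw [pow_add, mul_comm (_ ^ N), mul_assoc]
        exact O.mul_mem (O.pow_mem hp M) (hN d hd)
  obtain ⟨N, hN⟩ := h1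
  have h2 : C ((p : k) ^ N) * P ∈ Set.range (MvPolynomial.map (algebraMap O k)) := by
    rw [mem_range_map_iff_coeffs_subset]
    intro c hc
    obtain ⟨m, hm, rfl⟩ := mem_coeffs_iff.1 (Finset.mem_coe.1 hc)
    rw [coeff_C_mul]
    by_cases h0 : coeff m P = 0
    · exact ⟨0, by rw [h0, mul_zero, map_zero]⟩
    · exact ⟨⟨_, hN _ (coeff_mem_coeffs m h0)⟩, rfl⟩
  obtain ⟨P', hP'⟩ := h2
  have h3 := HasVal.poly res x 0 P'
  rw [← aeval_map_algebraMap k, hP', map_mul, aeval_C, map_pow, map_natCast] at h3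
  exact ⟨N, _, h3⟩

lemma apply_map (V : IsUnramified p v O res) (W : IsGauss p v x w)
    (hσ : σ • regularAt res x 0 = regularAt res x 0)
    (f : K) : w (σ f) = w f := by
  have hσ' : σ⁻¹ • regularAt res x 0 = regularAt res x 0 := by
    rw [inv_smul_eq_iff, hσ]
  have h1 : ∀ g ∈ regularAt res x 0, w (σ g) = w g := fun g hg => by
    refine (apply_map_le V W hσ.le hg).antisymm ?_
    have h2 : σ g ∈ regularAt res x 0 := by
      rw [← hσ]; exact Set.smul_mem_smul_set hg
    have h3 := apply_map_le V W hσ'.le h2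
    have h4 : σ⁻¹ (σ g) = g := σ.symm_apply_apply g
    rwa [h4] at h3
  have hp0 : w (p : K) ≠ 0 := by
    rw [← map_natCast (algebraMap k K), W.apply_algebraMap, V.apply_p]
    exact (inv_prime_pos p).ne'
  have h2 : ∀ P : MvPolynomial (Fin n) k, w (σ (aeval x P)) = w (aeval x P) := fun P => by
    obtain ⟨N, hN⟩ := exists_mul_mem (x := x) V P
    have h3 := h1 _ hN
    rw [map_mul, map_mul, map_mul, map_pow, map_natCast] at h3
    refine mul_left_cancel₀ ?_ h3
    rw [map_pow]
    exact pow_ne_zero _ hp0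
  obtain ⟨P, Q, hQ, h⟩ := W.exists_frac f
  have h3 := congrArg w (congrArg σ h)
  rw [map_mul, map_mul, h2, h2, ← h, map_mul] at h3
  exact mul_right_cancel₀ (w.ne_zero hQ) h3

end

end GaussNorm

namespace GaussNorm
open MvPolynomial Specialization
open scoped Pointwise

variable {k K : Type*} [Field k] [Field K] [Algebra k K] {n p : ℕ} {v : AbsoluteValue k ℝ}
  {O : Subring k} {res : O →+* ZMod p} {x : Fin n → K} {w : AbsoluteValue K ℝ}

/-- An integral affine function in the coordinates `x`. -/
def affine (x : Fin n → K) (c : ℤ × (Fin n → ℤ)) : K := c.1 + ∑ i, c.2 i * x i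

lemma IsGauss.int_le (W : IsGauss p v x w) (z : ℤ) : w z ≤ 1 :=
  W.nonarch.apply_intCast_le_one

lemma IsGauss.exists_affine_add (W : IsGauss p v x w) {f g : K}
    (hf : ∃ c, w (f - affine x c) ≤ (p : ℝ)⁻¹ ^ 2) (hg : ∃ c, w (g - affine x c) ≤ (p : ℝ)⁻¹ ^ 2) :
    ∃ c, w (f + g - affine x c) ≤ (p : ℝ)⁻¹ ^ 2 := by
  obtain ⟨c, hc⟩ := hf
  obtain ⟨d, hd⟩ := hg
  refine ⟨c + d, ?_⟩
  have : f + g - affine x (c + d) = (f - affine x c) + (g - affine x d) := by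
    simp only [affine, Prod.fst_add, Prod.snd_add, Pi.add_apply, Int.cast_add, add_mul,
      Finset.sum_add_distrib]
    ring
  rw [this]
  exact apply_add_le W.nonarch hc hd

variable [Fact p.Prime]

lemma IsGauss.linear_le (W : IsGauss p v x w) (c : Fin n → ℤ) :
    w (∑ i, (c i : K) * x i) ≤ (p : ℝ)⁻¹ := by
  refine apply_sum_le W.nonarch _ _ (inv_prime_pos p).le fun i _ => ?_
  rw [map_mul, W.apply_var]
  exact mul_le_of_le_one_left (inv_prime_pos p).le (W.int_le _)

lemma IsGauss.affine_le (W : IsGauss p v x w) (c : ℤ × (Fin n → ℤ)) : w (affine x c) ≤ 1 :=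
  apply_add_le W.nonarch (W.int_le _) ((W.linear_le _).trans (inv_prime_lt_one p).le)

lemma IsGauss.exists_affine_mul (W : IsGauss p v x w) {f g : K}
    (hf : ∃ c, w (f - affine x c) ≤ (p : ℝ)⁻¹ ^ 2) (hg : ∃ c, w (g - affine x c) ≤ (p : ℝ)⁻¹ ^ 2) :
    ∃ c, w (f * g - affine x c) ≤ (p : ℝ)⁻¹ ^ 2 := by
  obtain ⟨c, hc⟩ := hf
  obtain ⟨d, hd⟩ := hg
  refine ⟨(c.1 * d.1, fun i => c.1 * d.2 i + d.1 * c.2 i), ?_⟩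
  have h0 : 0 ≤ (p : ℝ)⁻¹ ^ 2 := by positivity
  have hlt : (p : ℝ)⁻¹ ^ 2 ≤ 1 := pow_le_one₀ (inv_prime_pos p).le (inv_prime_lt_one p).le
  have : f * g - affine x (c.1 * d.1, fun i => c.1 * d.2 i + d.1 * c.2 i) =
      (f - affine x c) * (g - affine x d) + (f - affine x c) * affine x d +
        affine x c * (g - affine x d) +
        (∑ i, (c.2 i : K) * x i) * (∑ i, (d.2 i : K) * x i) := by
    have e : ∑ i, ((c.1 * d.2 i + d.1 * c.2 i : ℤ) : K) * x i =
        c.1 * (∑ i, (d.2 i : K) * x i) + d.1 * ∑ i, (c.2 i : K) * x i := by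
      rw [Finset.mul_sum, Finset.mul_sum, ← Finset.sum_add_distrib]
      refine Finset.sum_congr rfl fun i _ => ?_
      push_cast
      ring
    simp only [affine]
    rw [e]
    push_cast
    ring
  rw [this]
  refine apply_add_le W.nonarch (apply_add_le W.nonarch (apply_add_le W.nonarch ?_ ?_) ?_) ?_
  · rw [map_mul]
    exact (mul_le_of_le_one_right (w.nonneg _) (hd.trans hlt)).trans hc
  · rw [map_mul]
    exact (mul_le_of_le_one_right (w.nonneg _) (W.affine_le d)).trans hc
  · rw [map_mul]
    exact (mul_le_of_le_one_left (w.nonneg _) (W.affine_le c)).trans hd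
  · rw [map_mul, sq]
    exact mul_le_mul (W.linear_le _) (W.linear_le _) (w.nonneg _) (inv_prime_pos p).le

lemma exists_affine (V : IsUnramified p v O res) (W : IsGauss p v x w) {f : K}
    (hf : f ∈ regularAt res x 0) : ∃ c, w (f - affine x c) ≤ (p : ℝ)⁻¹ ^ 2 := by
  have h0 : 0 ≤ (p : ℝ)⁻¹ ^ 2 := by positivity
  have h_int : ∀ z : ℤ, ∃ c, w ((z : K) - affine x c) ≤ (p : ℝ)⁻¹ ^ 2 := fun z =>
    ⟨(z, 0), by simp [affine]⟩
  have hpoly : ∀ P : MvPolynomial (Fin n) O, ∃ c, w (aeval x P - affine x c) ≤ (p : ℝ)⁻¹ ^ 2 := by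
    intro P
    induction P using MvPolynomial.induction_on with
    | C o =>
      obtain ⟨z, hz⟩ := V.exists_int o
      refine ⟨(z, 0), ?_⟩
      have : aeval x (C o) - affine x ((z, 0) : ℤ × (Fin n → ℤ)) = algebraMap k K ((o : k) - z) := by
        rw [aeval_C, map_sub, map_intCast]
        simp only [affine, Pi.zero_apply, Int.cast_zero, zero_mul, Finset.sum_const_zero, add_zero]
        rfl
      rw [this, W.apply_algebraMap]
      exact hz
    | add P Q hP hQ =>
      rw [map_add]
      exact W.exists_affine_add hP hQ
    | mul_X P i hP =>
      rw [map_mul, aeval_X]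
      refine W.exists_affine_mul hP ⟨(0, Pi.single i 1), ?_⟩
      have : x i - affine x ((0, Pi.single i 1) : ℤ × (Fin n → ℤ)) = 0 := by
        simp [affine, Pi.single_apply]
      rw [this, map_zero]
      exact h0
  obtain ⟨c, P, Q, hQ, h1, -⟩ := hf
  have hx := W.indep' O
  obtain ⟨z, hz⟩ := ZMod.intCast_surjective (eval₂ res 0 Q)⁻¹
  have h2 : w (1 - z * aeval x Q) ≤ (p : ℝ)⁻¹ := by
    rw [w.map_sub]
    have h3 := ((HasVal.const res x 0 (z : O)).mul (HasVal.poly res x 0 Q)).sub_const 1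
    rw [map_intCast, map_intCast, map_one, map_one, hz, inv_mul_cancel₀ hQ, sub_self] at h3
    exact apply_le_inv V W h3
  have hQ1 := aeval_eq_one V W Q hQ
  have hQ0 : aeval x Q ≠ 0 := by
    intro h
    rw [h, map_zero] at hQ1
    exact zero_ne_one hQ1
  have h3 : w (f - aeval x P * (z * (2 - z * aeval x Q))) ≤ (p : ℝ)⁻¹ ^ 2 := by
    have h4 : (f - aeval x P * (z * (2 - z * aeval x Q))) * aeval x Q =
        aeval x P * (1 - z * aeval x Q) ^ 2 := by
      rw [sub_mul, h1]
      ring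
    have h5 := congrArg w h4
    rw [map_mul, hQ1, mul_one, map_mul, map_pow] at h5
    rw [h5]
    exact (mul_le_of_le_one_left (by positivity) (aeval_le_one V W P)).trans
      (pow_le_pow_left₀ (w.nonneg _) h2 2)
  have h4 : ∃ c, w (aeval x P * (z * (2 - z * aeval x Q)) - affine x c) ≤ (p : ℝ)⁻¹ ^ 2 := by
    refine W.exists_affine_mul (hpoly P) (W.exists_affine_mul (h_int z) ?_)
    have : (2 : K) - z * aeval x Q = ((2 : ℤ) : K) + ((-z : ℤ) : K) * aeval x Q := by
      push_cast
      ring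
    rw [this]
    exact W.exists_affine_add (h_int 2) (W.exists_affine_mul (h_int (-z)) (hpoly Q))
  obtain ⟨c, hc⟩ := h4
  refine ⟨c, ?_⟩
  rw [← sub_add_sub_cancel]
  exact apply_add_le W.nonarch h3 hc

lemma affine_sub_le (V : IsUnramified p v O res) (W : IsGauss p v x w) {c d : ℤ × (Fin n → ℤ)}
    (h : (c.1 : ZMod (p ^ 2)) = d.1) (h' : ∀ i, (c.2 i : ZMod (p ^ 2)) = d.2 i) :
    w (affine x c - affine x d) ≤ (p : ℝ)⁻¹ ^ 2 := by
  have key : ∀ a b : ℤ, (a : ZMod (p ^ 2)) = b → w ((a : K) - b) ≤ (p : ℝ)⁻¹ ^ 2 := by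
    intro a b hab
    obtain ⟨e, he⟩ := (ZMod.intCast_eq_intCast_iff_dvd_sub b a _).1 hab.symm
    have : (a : K) - b = algebraMap k K ((p : k) ^ 2) * e := by
      rw [← Int.cast_sub, he]
      simp
    rw [this, map_mul, W.apply_algebraMap, map_pow, V.apply_p]
    exact mul_le_of_le_one_right (by positivity) (W.int_le e)
  have : affine x c - affine x d = ((c.1 : K) - d.1) + ∑ i, ((c.2 i : K) - d.2 i) * x i := by
    simp only [affine, sub_mul, Finset.sum_sub_distrib]
    ring
  rw [this]
  refine apply_add_le W.nonarch (key _ _ h) (apply_sum_le W.nonarch _ _ (by positivity)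
    fun i _ => ?_)
  rw [map_mul, W.apply_var]
  exact (mul_le_of_le_one_right (w.nonneg _) (inv_prime_lt_one p).le).trans (key _ _ (h' i))

lemma exists_pow_var_sub_le (V : IsUnramified p v O res) (W : IsGauss p v x w) {σ : K ≃ₐ[k] K}
    (hσ : σ • regularAt res x 0 = regularAt res x 0) :
    ∃ N : ℕ, 0 < N ∧ ∀ i, w ((σ ^ N) (x i) - x i) ≤ (p : ℝ)⁻¹ ^ 2 := by
  have hpow : ∀ m : ℕ, σ ^ m • regularAt res x 0 = regularAt res x 0 := fun m => by
    induction m with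
    | zero => rw [pow_zero, one_smul]
    | succ m ih => rw [pow_succ, mul_smul, hσ, ih]
  have hmem : ∀ (m : ℕ) (i : Fin n), (σ ^ m) (x i) ∈ regularAt res x 0 := fun m i => by
    rw [← hpow m]
    exact Set.smul_mem_smul_set ⟨_, HasVal.var res x 0 i⟩
  choose c hc using fun m i => exists_affine V W (hmem m i)
  have : NeZero (p ^ 2) := ⟨pow_ne_zero _ (Fact.out : p.Prime).ne_zero⟩
  obtain ⟨a, b, hab, heq⟩ := Finite.exists_ne_map_eq_of_infinite
    (fun m : ℕ => fun i : Fin n => (((c m i).1 : ZMod (p ^ 2)),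
      fun j : Fin n => ((c m i).2 j : ZMod (p ^ 2))))
  wlog hlt : a < b generalizing a b
  · exact this b a hab.symm heq.symm (lt_of_le_of_ne (not_lt.1 hlt) hab.symm)
  refine ⟨b - a, by omega, fun i => ?_⟩
  have h1 := congrFun heq i
  simp only [Prod.mk.injEq] at h1
  have h2 := affine_sub_le V W h1.1.symm (fun j => (congrFun h1.2 j).symm)
  have h3 : w ((σ ^ b) (x i) - (σ ^ a) (x i)) ≤ (p : ℝ)⁻¹ ^ 2 := by
    have := apply_sub_le W.nonarch (apply_add_le W.nonarch (hc b i) h2) (hc a i)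
    convert this using 2
    ring
  have h4 : (σ ^ b) (x i) - (σ ^ a) (x i) = (σ ^ a) ((σ ^ (b - a)) (x i) - x i) := by
    rw [map_sub, ← AlgEquiv.mul_apply, ← pow_add, Nat.add_sub_cancel' hlt.le]
  rwa [h4, apply_map V W (hpow a)] at h3

/-- Some power of an automorphism preserving the local ring at a point of the special fibre is close
to the identity in the Gauss norm. -/
theorem exists_pow_close (V : IsUnramified p v O res) (W : IsGauss p v x w) {σ : K ≃ₐ[k] K}
    (hσ : σ • regularAt res x 0 = regularAt res x 0) :
    ∃ N : ℕ, 0 < N ∧ ∀ f, w ((σ ^ N) f - f) ≤ (p : ℝ)⁻¹ * w f := by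
  obtain ⟨N, hN, hx⟩ := exists_pow_var_sub_le V W hσ
  refine ⟨N, hN, ?_⟩
  have hσN : σ ^ N • regularAt res x 0 = regularAt res x 0 := by
    clear hx hN
    induction N with
    | zero => rw [pow_zero, one_smul]
    | succ m ih => rw [pow_succ, mul_smul, hσ, ih]
  have hiso := apply_map V W hσN
  generalize σ ^ N = τ at *
  have hmul : ∀ f g, w (τ f - f) ≤ (p : ℝ)⁻¹ * w f → w (τ g - g) ≤ (p : ℝ)⁻¹ * w g →
      w (τ (f * g) - f * g) ≤ (p : ℝ)⁻¹ * w (f * g) := by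
    intro f g hf hg
    have : τ (f * g) - f * g = (τ f - f) * τ g + f * (τ g - g) := by
      rw [map_mul]
      ring
    rw [this]
    refine apply_add_le W.nonarch ?_ ?_
    · rw [map_mul, hiso, map_mul, ← mul_assoc]
      exact mul_le_mul_of_nonneg_right hf (w.nonneg _)
    · rw [map_mul, map_mul]
      calc _ ≤ w f * ((p : ℝ)⁻¹ * w g) := mul_le_mul_of_nonneg_left hg (w.nonneg _)
        _ = _ := by ring
  have hconst : ∀ q : k, w (τ (algebraMap k K q) - algebraMap k K q) ≤
      (p : ℝ)⁻¹ * w (algebraMap k K q) := fun q => by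
    rw [τ.commutes, sub_self, map_zero]
    exact mul_nonneg (inv_prime_pos p).le (w.nonneg _)
  have hpow : ∀ f (m : ℕ), w (τ f - f) ≤ (p : ℝ)⁻¹ * w f →
      w (τ (f ^ m) - f ^ m) ≤ (p : ℝ)⁻¹ * w (f ^ m) := by
    intro f m hf
    induction m with
    | zero => simp
    | succ m ih => rw [pow_succ]; exact hmul _ _ ih hf
  have hprod : ∀ (s : Finset (Fin n)) (m : Fin n → ℕ),
      w (τ (∏ i ∈ s, x i ^ m i) - ∏ i ∈ s, x i ^ m i) ≤ (p : ℝ)⁻¹ * w (∏ i ∈ s, x i ^ m i) := by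
    intro s m
    induction s using Finset.induction_on with
    | empty => simp
    | insert i s hi ih =>
      rw [Finset.prod_insert hi]
      refine hmul _ _ (hpow _ _ ?_) ih
      rw [W.apply_var, ← sq]
      exact hx i
  have hpoly : ∀ P : MvPolynomial (Fin n) k,
      w (τ (aeval x P) - aeval x P) ≤ (p : ℝ)⁻¹ * w (aeval x P) := by
    intro P
    have h1 : aeval x P = ∑ m ∈ P.support, algebraMap k K (coeff m P) * ∏ i, x i ^ m i := by
      rw [aeval_def, eval₂_eq']
    have h2 : τ (aeval x P) - aeval x P = ∑ m ∈ P.support,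
        (τ (algebraMap k K (coeff m P) * ∏ i, x i ^ m i) -
          algebraMap k K (coeff m P) * ∏ i, x i ^ m i) := by
      rw [Finset.sum_sub_distrib, ← map_sum, ← h1]
    rw [h2]
    refine apply_sum_le W.nonarch _ _ (mul_nonneg (inv_prime_pos p).le (w.nonneg _)) fun m _ => ?_
    refine (hmul _ _ (hconst _) (hprod _ _)).trans ?_
    refine mul_le_mul_of_nonneg_left ?_ (inv_prime_pos p).le
    refine le_of_eq_of_le ?_ (W.le_apply P m)
    rw [map_mul, W.apply_algebraMap, map_prod, ← Finset.prod_pow_eq_pow_sum]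
    congr 1
    refine Finset.prod_congr rfl fun i _ => ?_
    rw [map_pow, W.apply_var]
  intro f
  obtain ⟨P, Q, hQ, h⟩ := W.exists_frac f
  have hτQ : τ (aeval x Q) ≠ 0 := (map_ne_zero_iff _ τ.injective).2 hQ
  have h1 := hpoly P
  rw [← h, map_mul] at h1
  have h2 : (τ f - f) * τ (aeval x Q) =
      (τ f * τ (aeval x Q) - f * aeval x Q) - f * (τ (aeval x Q) - aeval x Q) := by ring
  have h3 : w (τ f - f) * w (aeval x Q) ≤ (p : ℝ)⁻¹ * w f * w (aeval x Q) := by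
    rw [← hiso (aeval x Q), ← map_mul, h2, hiso]
    refine apply_sub_le W.nonarch ?_ ?_
    · rw [map_mul, ← mul_assoc] at h1
      exact h1
    · rw [map_mul]
      calc _ ≤ w f * ((p : ℝ)⁻¹ * w (aeval x Q)) :=
            mul_le_mul_of_nonneg_left (hpoly Q) (w.nonneg _)
        _ = _ := by ring
  exact le_of_mul_le_mul_right h3 (w.pos hQ)

end GaussNorm

namespace GaussNorm
open MvPolynomial Specialization
open scoped Pointwise

theorem exists_isUnramified {k : Type*} [Field k] {p : ℕ} [Fact p.Prime] (φ : k →+* ℚ_[p]) :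
    ∃ (v : AbsoluteValue k ℝ) (O : Subring k) (res : O →+* ZMod p), IsUnramified p v O res ∧
      ∀ c, c ∈ O ↔ ‖φ c‖ ≤ 1 := by
  obtain ⟨v, hv⟩ : ∃ v : AbsoluteValue k ℝ, ∀ c, v c = ‖φ c‖ :=
    ⟨(NormedField.toAbsoluteValue ℚ_[p]).comp φ.injective, fun _ => rfl⟩
  let O : Subring k := (PadicInt.subring p).comap φ
  have hO : ∀ c, c ∈ O ↔ ‖φ c‖ ≤ 1 := fun _ => Iff.rfl
  let ψ : O →+* ℤ_[p] :=
    { toFun := fun c => ⟨φ c, c.2⟩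
      map_one' := Subtype.ext (by simp)
      map_mul' := fun a b => Subtype.ext (map_mul φ (a : k) b)
      map_zero' := Subtype.ext (by simp)
      map_add' := fun a b => Subtype.ext (map_add φ (a : k) b) }
  have hψ : ∀ c : O, ‖ψ c‖ = v c := fun c => (hv c).symm
  have hlt : ∀ c : O, PadicInt.toZMod (ψ c) = 0 ↔ v c < 1 := fun c => by
    rw [PadicEmbedding.toZMod_eq_zero_iff, hψ]
  refine ⟨v, O, PadicInt.toZMod.comp ψ, ⟨?_, ?_, fun c => ?_, fun c hc => ?_, fun c hc => ?_,
    fun c => ?_⟩, hO⟩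
  · intro a b
    rw [hv, hv, hv, map_add]
    exact Padic.nonarchimedean _ _
  · rw [hv, map_natCast, Padic.norm_p]
  · rw [hO, hv]
  · have h := (hlt c).1 hc
    rw [← hψ] at h ⊢
    have := (PadicInt.norm_lt_pow_iff_norm_le_pow_sub_one (ψ c) 0).1 (by simpa using h)
    simpa using this
  · refine le_antisymm ?_ (not_lt.1 fun h => hc ((hlt c).2 h))
    rw [hv]
    exact (hO c).1 c.2
  · refine ⟨(ψ c).appr 2, ?_⟩
    have h := (PadicInt.norm_le_pow_iff_mem_span_pow _ 2).2 (PadicInt.appr_spec 2 (ψ c))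
    have h2 : v (c - ((ψ c).appr 2 : ℤ)) = ‖ψ c - ((ψ c).appr 2 : ℕ)‖ := by
      rw [hv]
      have : ψ c - ((ψ c).appr 2 : ℕ) = ψ (c - ((ψ c).appr 2 : ℕ)) := by simp
      rw [this, hψ, hv]
      simp
    rw [h2]
    simpa [inv_pow] using! h

variable {k K : Type*} [Field k] [Field K] [Algebra k K] {p : ℕ} {v : AbsoluteValue k ℝ}
  {O : Subring k} {res : O →+* ZMod p}

lemma aeval_sub_algebraMap {k A ι : Type*} [CommRing k] [CommRing A] [Algebra k A] (x : ι → A)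
    (z : ι → k) (P : MvPolynomial ι k) :
    aeval (fun i => x i - algebraMap k A (z i)) (aeval (fun i => X i + C (z i)) P : MvPolynomial ι k)
      = aeval x P := by
  rw [← AlgHom.comp_apply]
  congr 1
  ext i
  simp

theorem exists_isGauss [Fact p.Prime] (V : IsUnramified p v O res) {n : ℕ} {x : Fin n → K}
    (hx : AlgebraicIndependent k x) (hfrac : ∀ f : K, ∃ P Q : MvPolynomial (Fin n) k,
      aeval x Q ≠ 0 ∧ f * aeval x Q = aeval x P) (a : Fin n → ZMod p) :
    ∃ (ξ : Fin n → K) (w : AbsoluteValue K ℝ), IsGauss p v ξ w ∧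
      regularAt res ξ 0 = regularAt res x a := by
  choose z hz using fun i => ZMod.ringHom_surjective res (a i)
  let ξ : Fin n → K := fun i => x i - algebraMap k K (z i)
  have hxξ : ∀ i, x i = ξ i - algebraMap k K (-(z i : k)) := fun i => by simp [ξ]
  have hshift : ∀ P, ∃ P', aeval ξ P' = aeval x P := fun P => ⟨_, aeval_sub_algebraMap x _ P⟩
  have hξ : AlgebraicIndependent k ξ := by
    have hj := aeval_sub_algebraMap (A := K) ξ (fun i => -(z i : k))
    rw [algebraicIndependent_iff] at hx ⊢
    intro P hP
    have h1 := hx (aeval (fun i => X i + C (-(z i : k))) P) (by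
      rw [← hP, ← hj P]
      congr 2
      ext i; exact hxξ i)
    have h2 := aeval_sub_algebraMap (A := MvPolynomial (Fin n) k)
      (fun i => X i) (fun i => -(z i : k)) P
    rwa [h1, map_zero, aeval_X_left_apply, eq_comm] at h2
  have hξfrac : ∀ f : K, ∃ P Q : MvPolynomial (Fin n) k,
      aeval ξ Q ≠ 0 ∧ f * aeval ξ Q = aeval ξ P := fun f => by
    obtain ⟨P, Q, h1, h2⟩ := hfrac f
    obtain ⟨P', hP⟩ := hshift P
    obtain ⟨Q', hQ⟩ := hshift Q
    exact ⟨P', Q', by rwa [hQ], by rwa [hQ, hP]⟩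
  obtain ⟨w, hw, hwk, hwx, hle⟩ := exists_absoluteValue v V.nonarch (inv_prime_pos p) hξ hξfrac
  refine ⟨ξ, w, ⟨hw, hwk, hwx, hle, hξ, hξfrac⟩, Set.Subset.antisymm ?_ ?_⟩
  · rintro f ⟨c, hc⟩
    refine ⟨c, HasVal.subst (hx.restrictScalars Subtype.val_injective) (fun i => ?_) hc⟩
    have := (HasVal.var res x a i).sub_const (z i)
    rwa [hz, sub_self] at this
  · rintro f ⟨c, hc⟩
    refine ⟨c, HasVal.subst (hξ.restrictScalars Subtype.val_injective) (fun i => ?_) hc⟩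
    have := (HasVal.var res ξ 0 i).sub_const (-z i)
    rw [map_neg res, hz] at this
    rw [hxξ]
    simpa using! this

end GaussNorm

namespace PadicFlow
open UniformSpace

instance {K : Type*} [NormedField K] [IsUltrametricDist K] :
    IsUltrametricDist (Completion K) := by
  refine IsUltrametricDist.isUltrametricDist_of_forall_norm_add_le_max_norm fun a b => ?_
  induction a, b using Completion.induction_on₂ with
  | hp => exact isClosed_le (by fun_prop) (by fun_prop)
  | ih a b =>
    rw [← Completion.coe_add, Completion.norm_coe, Completion.norm_coe, Completion.norm_coe]
    exact IsUltrametricDist.norm_add_le_max a b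

theorem derivation_eq_zero {K F : Type*} [Field K] [NormedField F] (φ : K →+* F)
    (hφ : DenseRange φ) {T : Set K} (hT : Subfield.closure T = ⊤) (D : Derivation ℤ F F)
    (hD : ∃ C, ∀ b, ‖D b‖ ≤ C * ‖b‖) (h : ∀ t ∈ T, D (φ t) = 0) : D = 0 := by
  obtain ⟨C, hC⟩ := hD
  have hcl : ∀ b ∈ Subfield.closure T, D (φ b) = 0 := by
    intro b hb
    induction hb using Subfield.closure_induction with
    | mem b hb => exact h b hb
    | one => rw [map_one, D.map_one_eq_zero]
    | add a b _ _ ha hb => rw [map_add, map_add, ha, hb, add_zero]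
    | neg a _ ha => rw [map_neg, map_neg, ha, neg_zero]
    | inv a _ ha => rw [map_inv₀, Derivation.leibniz_inv, ha, smul_zero]
    | mul a b _ _ ha hb => rw [map_mul, D.leibniz, ha, hb, smul_zero, smul_zero, add_zero]
  have hcont : Continuous D := AddMonoidHomClass.continuous_of_bound D C hC
  ext b
  refine hφ.induction_on b (isClosed_eq hcont continuous_const) fun b => ?_
  exact hcl b (hT ▸ Subfield.mem_top b)

theorem eq_one_of_heisenberg_of_closure {K : Type*} [NormedField K] [IsUltrametricDist K] {p : ℕ}
    {r : ℝ} (hr : ‖(p : K)‖ = r) (hr0 : 0 < r) (hr1 : r < 1) (S : Set K) (x y : K)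
    (hS : Subfield.closure (insert x (insert y S)) = ⊤)
    {a₁ b₁ a₂ b₂ z : K →+* K} (hclose : ∀ g ∈ ({a₁, b₁, a₂, b₂, z} : Set (K →+* K)),
      Close (r ^ 2) g ∧ ∀ s ∈ S, g s = s)
    (h₁ : a₁ * b₁ = z * (b₁ * a₁)) (h₂ : a₂ * b₂ = z * (b₂ * a₂))
    (ha : Commute a₁ a₂) (hba : Commute b₁ a₂) (hza₁ : Commute z a₁) (hzb₁ : Commute z b₁)
    (hza₂ : Commute z a₂) (hzb₂ : Commute z b₂) : z = 1 := by
  have hcont : ∀ g ∈ ({a₁, b₁, a₂, b₂, z} : Set (K →+* K)), Continuous g := fun g hg =>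
    AddMonoidHomClass.continuous_of_bound g 1 fun b => by
      simpa using! (hclose g hg).1.norm_le (pow_le_one₀ hr0.le hr1.le) b
  have hmap : ∀ g ∈ ({a₁, b₁, a₂, b₂, z} : Set (K →+* K)), ∃ G : Completion K →+* Completion K,
      Continuous G ∧ ∀ b : K, G b = (g b : K) := fun g hg =>
    ⟨Completion.mapRingHom g (hcont g hg), Completion.continuous_map, fun b =>
      Completion.mapRingHom_coe (hcont g hg) b⟩
  have hext : ∀ G H : Completion K →+* Completion K, Continuous G → Continuous H →
      (∀ b : K, G b = H b) → G = H := fun G H hG hH h =>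
    RingHom.ext fun b => Completion.induction_on b (isClosed_eq hG hH) h
  simp only [Set.mem_insert_iff, Set.mem_singleton_iff, forall_eq_or_imp, forall_eq] at hmap hclose
  obtain ⟨⟨A₁, cA₁, eA₁⟩, ⟨B₁, cB₁, eB₁⟩, ⟨A₂, cA₂, eA₂⟩, ⟨B₂, cB₂, eB₂⟩, Z, cZ, eZ⟩ := hmap
  have hc : ∀ (g : K →+* K) (G : Completion K →+* Completion K), Continuous G →
      (∀ b : K, G b = (g b : K)) → (Close (r ^ 2) g ∧ ∀ s ∈ S, g s = s) →
      Close (r ^ 2) G ∧ ∀ s ∈ ((↑) : K → Completion K) '' S, G s = s := by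
    intro g G cG eG hg
    refine ⟨fun b => ?_, ?_⟩
    · induction b using Completion.induction_on with
      | hp => exact isClosed_le (by fun_prop) (by fun_prop)
      | ih b =>
        rw [eG, ← Completion.coe_sub, Completion.norm_coe, Completion.norm_coe]
        exact hg.1 b
    · rintro _ ⟨s, hs, rfl⟩
      rw [eG, hg.2 s hs]
  have hcomm : ∀ (g h : K →+* K) (G H : Completion K →+* Completion K), Continuous G → Continuous H →
      (∀ b : K, G b = (g b : K)) → (∀ b : K, H b = (h b : K)) → Commute g h → Commute G H := by
    intro g h G H cG cH eG eH hgh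
    refine hext _ _ (cG.comp cH) (cH.comp cG) fun b => ?_
    have := RingHom.congr_fun hgh b
    simp only [RingHom.mul_def, RingHom.comp_apply] at this ⊢
    rw [eH, eG, eG, eH, this]
  have hheis : ∀ (g h : K →+* K) (G H : Completion K →+* Completion K), Continuous G → Continuous H →
      (∀ b : K, G b = (g b : K)) → (∀ b : K, H b = (h b : K)) → g * h = z * (h * g) →
      G * H = Z * (H * G) := by
    intro g h G H cG cH eG eH hgh
    refine hext _ _ (cG.comp cH) (cZ.comp (cH.comp cG)) fun b => ?_
    have := RingHom.congr_fun hgh b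
    simp only [RingHom.mul_def, RingHom.comp_apply] at this ⊢
    rw [eH, eG, eG, eH, eZ, this]
  have hZ : Z = 1 := by
    refine eq_one_of_heisenberg (r := r) (p := p) ?_ hr0 hr1 (((↑) : K → Completion K) '' S) x y ?_
      (a₁ := A₁) (b₁ := B₁) (a₂ := A₂) (b₂ := B₂) ?_ (hheis _ _ _ _ cA₁ cB₁ eA₁ eB₁ h₁)
      (hheis _ _ _ _ cA₂ cB₂ eA₂ eB₂ h₂) (hcomm _ _ _ _ cA₁ cA₂ eA₁ eA₂ ha)
      (hcomm _ _ _ _ cB₁ cA₂ eB₁ eA₂ hba) (hcomm _ _ _ _ cZ cA₁ eZ eA₁ hza₁)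
      (hcomm _ _ _ _ cZ cB₁ eZ eB₁ hzb₁) (hcomm _ _ _ _ cZ cA₂ eZ eA₂ hza₂)
      (hcomm _ _ _ _ cZ cB₂ eZ eB₂ hzb₂)
    · rw [← hr, ← Completion.norm_coe (p : K)]
      congr 1
      exact (map_natCast Completion.coeRingHom p).symm
    · rintro D hD hDS hDx hDy
      refine derivation_eq_zero Completion.coeRingHom Completion.denseRange_coe hS D hD ?_
      rintro _ (rfl | rfl | hb)
      · exact hDx
      · exact hDy
      · exact hDS _ ⟨_, hb, rfl⟩
    · simp only [Set.mem_insert_iff, Set.mem_singleton_iff, forall_eq_or_imp, forall_eq]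
      exact ⟨hc _ _ cA₁ eA₁ hclose.1, hc _ _ cB₁ eB₁ hclose.2.1, hc _ _ cA₂ eA₂ hclose.2.2.1,
        hc _ _ cB₂ eB₂ hclose.2.2.2.1, hc _ _ cZ eZ hclose.2.2.2.2⟩
  ext b
  have := eZ b
  rw [hZ] at this
  exact (Completion.coe_injective K this).symm

end PadicFlow

theorem PadicFlow.Close.pow {F : Type*} [NormedField F] [IsUltrametricDist F] {c : ℝ} {g : F →+* F}
    (h : PadicFlow.Close c g) (hc : c ≤ 1) (m : ℕ) : PadicFlow.Close c (g ^ m) := by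
  have hc0 : 0 ≤ c := by simpa using (norm_nonneg _).trans (h 1)
  intro b
  induction m with
  | zero => simp; positivity
  | succ m ih =>
    have h1 : (g ^ (m + 1)) b - b = g ((g ^ m) b - b) + (g b - b) := by
      rw [pow_succ', RingHom.mul_def, RingHom.comp_apply, map_sub]
      ring
    rw [h1]
    exact PadicFlow.norm_add_le' ((h.norm_le hc _).trans ih) (h b)

namespace GaussNorm
open MvPolynomial Specialization PadicFlow
open scoped Pointwise

lemma isUltrametricDist {K : Type*} [Field K] {w : AbsoluteValue K ℝ} (hw : IsNonarchimedean w) :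
    let _ := w.toNormedField; IsUltrametricDist K := by
  let _ := w.toNormedField
  exact IsUltrametricDist.isUltrametricDist_of_forall_norm_add_le_max_norm hw

variable {k K : Type*} [Field k] [Field K] [Algebra k K] {p : ℕ}
  {v : AbsoluteValue k ℝ} {O : Subring k} {res : O →+* ZMod p} {n : ℕ} {x : Fin n → K}
  {w : AbsoluteValue K ℝ}

lemma IsGauss.apply_natCast (W : IsGauss p v x w) (V : IsUnramified p v O res) :
    w (p : K) = (p : ℝ)⁻¹ := by
  rw [← map_natCast (algebraMap k K), W.apply_algebraMap, V.apply_p]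

theorem exists_common_pow_close [Fact p.Prime] (V : IsUnramified p v O res) (W : IsGauss p v x w)
    (s : Finset (K ≃ₐ[k] K)) (hs : ∀ σ ∈ s, σ • regularAt res x 0 = regularAt res x 0) :
    ∃ N : ℕ, 0 < N ∧ ∀ σ ∈ s, ∀ (m : ℕ) (f : K), w ((σ ^ (N * m)) f - f) ≤ (p : ℝ)⁻¹ ^ 2 * w f := by
  choose! N hN hclose using fun σ hσ => exists_pow_close V W (hs σ hσ)
  refine ⟨(∏ σ ∈ s, N σ) * p, Nat.mul_pos (Finset.prod_pos hN) (Fact.out : p.Prime).pos, ?_⟩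
  intro σ hσ m
  let _ := w.toNormedField
  have := isUltrametricDist W.nonarch
  have hr : ‖(p : K)‖ = (p : ℝ)⁻¹ := W.apply_natCast V
  have hr0 := inv_prime_pos p
  have hr1 := inv_prime_lt_one p
  let φ : (K ≃ₐ[k] K) →* (K →+* K) :=
    { toFun := fun σ => (σ : K →+* K)
      map_one' := rfl
      map_mul' := fun _ _ => rfl }
  have h1 : Close ((p : ℝ)⁻¹ ^ 1) (φ (σ ^ N σ)) := fun f => by
    rw [pow_one]; exact hclose σ hσ f
  obtain ⟨q, hq⟩ := Finset.dvd_prod_of_mem N hσ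
  have h2 : Close ((p : ℝ)⁻¹ ^ 1) (φ (σ ^ N σ) ^ q) :=
    h1.pow (by rw [pow_one]; exact hr1.le) q
  have h3 := (h2.pow_prime hr hr0 hr1 le_rfl).pow (pow_le_one₀ hr0.le hr1.le) m
  intro f
  have := h3 f
  rw [← map_pow, ← map_pow, ← map_pow, ← pow_mul, ← pow_mul, ← pow_mul,
    show N σ * (q * (p * m)) = (∏ σ ∈ s, N σ) * p * m by rw [hq]; ring] at this
  exact this

lemma IsGauss.closure_eq_top {x : Fin 2 → K} (W : IsGauss p v x w) :
    Subfield.closure (insert (x 0) (insert (x 1) (Set.range (algebraMap k K)))) = ⊤ := by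
  set T : Set K := insert (x 0) (insert (x 1) (Set.range (algebraMap k K)))
  have hP : ∀ P : MvPolynomial (Fin 2) k, aeval x P ∈ Subfield.closure T := by
    intro P
    induction P using MvPolynomial.induction_on with
    | C c => exact Subfield.subset_closure (by simp [T])
    | add P Q hP hQ => rw [map_add]; exact add_mem hP hQ
    | mul_X P i hP =>
      rw [map_mul, aeval_X]
      refine mul_mem hP (Subfield.subset_closure ?_)
      fin_cases i <;> simp [T]
  refine eq_top_iff.2 fun f _ => ?_
  obtain ⟨P, Q, hQ, h⟩ := W.exists_frac f
  rw [eq_div_of_mul_eq hQ h]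
  exact div_mem (hP P) (hP Q)

theorem eq_one_of_heisenberg [Fact p.Prime] (V : IsUnramified p v O res) {x : Fin 2 → K} (W : IsGauss p v x w)
    {a₁ b₁ a₂ b₂ z : K ≃ₐ[k] K} (hclose : ∀ g ∈ ({a₁, b₁, a₂, b₂, z} : Set (K ≃ₐ[k] K)),
      ∀ f, w (g f - f) ≤ (p : ℝ)⁻¹ ^ 2 * w f)
    (h₁ : a₁ * b₁ = z * (b₁ * a₁)) (h₂ : a₂ * b₂ = z * (b₂ * a₂))
    (ha : Commute a₁ a₂) (hba : Commute b₁ a₂) (hza₁ : Commute z a₁) (hzb₁ : Commute z b₁)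
    (hza₂ : Commute z a₂) (hzb₂ : Commute z b₂) : z = 1 := by
  let _ := w.toNormedField
  have := isUltrametricDist W.nonarch
  let φ : (K ≃ₐ[k] K) →* (K →+* K) :=
    { toFun := fun σ => (σ : K →+* K)
      map_one' := rfl
      map_mul' := fun _ _ => rfl }
  have h : φ z = 1 := by
    refine eq_one_of_heisenberg_of_closure (W.apply_natCast V) (inv_prime_pos p)
      (inv_prime_lt_one p) (Set.range (algebraMap k K)) (x 0) (x 1) W.closure_eq_top
      (a₁ := φ a₁) (b₁ := φ b₁) (a₂ := φ a₂) (b₂ := φ b₂) ?_ ?_ ?_ (ha.map φ) (hba.map φ)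
      (hza₁.map φ) (hzb₁.map φ) (hza₂.map φ) (hzb₂.map φ)
    · have key : ∀ g ∈ ({a₁, b₁, a₂, b₂, z} : Set (K ≃ₐ[k] K)),
          Close ((p : ℝ)⁻¹ ^ 2) (φ g) ∧ ∀ s ∈ Set.range (algebraMap k K), φ g s = s := by
        intro g hg
        refine ⟨hclose g hg, ?_⟩
        rintro _ ⟨c, rfl⟩
        exact g.commutes c
      simp only [Set.mem_insert_iff, Set.mem_singleton_iff, forall_eq_or_imp, forall_eq] at key ⊢
      exact key
    · rw [← map_mul, h₁, map_mul, map_mul]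
    · rw [← map_mul, h₂, map_mul, map_mul]
  ext f
  exact RingHom.congr_fun h f

end GaussNorm

namespace PointCount
open MvPolynomial Specialization GaussNorm
open scoped Pointwise commutatorElement

/-- Elementary matrices of rank at least four acting on a finitely generated field of rational
functions in two variables act through torsion elements. -/
theorem IsElementary.exists_eq_one {k K ι : Type*} [Field k] [CharZero k] [Field K] [Algebra k K]
    {S : Finset k} (hS : Subfield.closure (S : Set k) = ⊤) {x : Fin 2 → K}
    (hx : AlgebraicIndependent k x)
    (hfrac : ∀ f : K, ∃ P Q : MvPolynomial (Fin 2) k, aeval x Q ≠ 0 ∧ f * aeval x Q = aeval x P)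
    [Fintype ι] {u : ι → ι → ℤ → (K ≃ₐ[k] K)} {M : ℕ} (hu : IsElementary u M)
    {i j l m : ι} (hij : i ≠ j) (hil : i ≠ l) (him : i ≠ m) (hjl : j ≠ l) (hjm : j ≠ m)
    (hlm : l ≠ m) : ∃ N : ℕ, 0 < N ∧ u i j N = 1 := by
  classical
  choose F C hC using fun r : ι × ι => exists_exitCount_le hx hfrac (u r.1 r.2 1)⁻¹
  obtain ⟨p, _, hpB, φ, hφ⟩ := PadicEmbedding.exists_embedding S hS (Finset.univ.biUnion F)
    (96 * (180 * M ^ 2 * (∑ r, C r + 1)) ^ 3)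
  obtain ⟨v, O, res, V, hO⟩ := exists_isUnramified φ
  have hexit : ∀ a b, a ≠ b → exitCount (localRings res x) (u a b 1) ≤ (∑ r, C r + 1) * p := by
    intro a b _
    have h1 := hC (a, b) O p res fun f hf => (hO f).2
      (hφ f (Finset.mem_biUnion.2 ⟨_, Finset.mem_univ _, hf⟩))
    rw [inv_inv] at h1
    refine h1.trans (Nat.mul_le_mul_right p ?_)
    exact (Finset.single_le_sum (fun _ _ => Nat.zero_le _) (Finset.mem_univ (a, b))).trans
      (Nat.le_succ _)
  have hthird : ∀ a b : ι, ∃ c, c ≠ a ∧ c ≠ b := by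
    intro a b
    by_contra! h
    have h1 : ({i, j, l} : Finset ι) ⊆ {a, b} := fun c _ => by
      by_cases hc : c = a
      · simp [hc]
      · simp [h c hc]
    have h2 := Finset.card_le_card h1
    rw [Finset.card_eq_three.2 ⟨i, j, l, hij, hil, hjl, rfl⟩] at h2
    exact absurd (h2.trans Finset.card_le_two) (by norm_num)
  set R : Finset (ι × ι) := {(i, l), (l, j), (i, m), (m, j), (i, j)} with hR
  obtain ⟨A, hA, N, hN, hfix⟩ := hu.exists_fixed (Nat.succ_pos _) hpB.le
    (card_localRings (ZMod.ringHom_surjective res) (hx.restrictScalars Subtype.val_injective))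
    hexit hthird R Finset.card_le_five (by
      simp [hR, hij, hil, him, hjl.symm, hjm.symm])
  obtain ⟨a, rfl⟩ := mem_localRings.1 hA
  obtain ⟨ξ, w, W, hξ⟩ := exists_isGauss V hx hfrac a
  obtain ⟨N', hN', hclose⟩ := exists_common_pow_close V W
    (R.image fun r => u r.1 r.2 N) (by
      rintro σ hσ
      obtain ⟨r, hr, rfl⟩ := Finset.mem_image.1 hσ
      rw [hξ]
      exact hfix r hr)
  have hclose' : ∀ r ∈ R, ∀ (q : ℕ) (f : K),
      w (u r.1 r.2 ((N' * q * N : ℕ) : ℤ) f - f) ≤ (p : ℝ)⁻¹ ^ 2 * w f := by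
    intro r hr q f
    have hr' : r.1 ≠ r.2 := by
      revert r
      simp [hR, hij, hil, him, hjl.symm, hjm.symm]
    have := hclose _ (Finset.mem_image_of_mem _ hr) q f
    rw [hu.pow hr'] at this
    exact_mod_cast this
  set T : ℕ := N' * N with hT
  have hT' : N' * 1 * N = T := by rw [mul_one]
  refine ⟨M * T * T, ?_, ?_⟩
  · have := hu.pos
    positivity
  have hheis : ∀ c, i ≠ c → c ≠ j →
      u i c T * u c j T = u i j ((M * T * T : ℕ) : ℤ) * (u c j T * u i c T) := by
    intro c hic hcj
    have := hu.comm i c j hic hcj hij T T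
    push_cast
    rw [← this, commutatorElement_def]
    group
  refine GaussNorm.eq_one_of_heisenberg V W (a₁ := u i l T) (b₁ := u l j T) (a₂ := u i m T)
    (b₂ := u m j T) ?_ (hheis l hil hjl.symm) (hheis m him hjm.symm)
    (hu.commute _ _ _ _ hil him hil.symm him _ _) (hu.commute _ _ _ _ hjl.symm him hij.symm hlm _ _)
    (hu.commute _ _ _ _ hij hil hij.symm hil _ _) (hu.commute _ _ _ _ hij hjl.symm hjl hij _ _)
    (hu.commute _ _ _ _ hij him hij.symm him _ _) (hu.commute _ _ _ _ hij hjm.symm hjm hij _ _)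
  have h1 := fun r hr => hclose' r hr 1
  rw [hT'] at h1
  have h2 := hclose' (i, j) (by simp [hR]) (M * T)
  rw [show N' * (M * T) * N = M * T * T by rw [hT]; ring] at h2
  simp only [Set.mem_insert_iff, Set.mem_singleton_iff, forall_eq_or_imp, forall_eq]
  exact ⟨h1 (i, l) (by simp [hR]), h1 (l, j) (by simp [hR]), h1 (i, m) (by simp [hR]),
    h1 (m, j) (by simp [hR]), h2⟩

end PointCount

namespace PointCount
open MvPolynomial
open scoped Pointwise commutatorElement

section
variable {ι G G' : Type*} [Group G] [Group G'] {u : ι → ι → ℤ → G} {M : ℕ}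

theorem IsElementary.zpow (hu : IsElementary u M) {i j : ι} (h : i ≠ j) (t : ℤ) :
    u i j 1 ^ t = u i j t := by
  have h1 : ∀ n : ℕ, u i j 1 ^ n = u i j n := fun n => by rw [hu.pow h, mul_one]
  obtain ⟨n, rfl | rfl⟩ := t.eq_nat_or_neg
  · rw [zpow_natCast, h1]
  · rw [zpow_neg, zpow_natCast, h1, inv_eq_iff_mul_eq_one, ← hu.add i j h, add_neg_cancel,
      hu.zero h]

theorem IsElementary.map (hu : IsElementary u M) (φ : G →* G') :
    IsElementary (fun i j t => φ (u i j t)) M where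
  pos := hu.pos
  add i j h s t := by rw [hu.add i j h, map_mul]
  comm i j k hij hjk hik s t := by rw [← map_commutatorElement, hu.comm i j k hij hjk hik]
  commute i j k l hij hkl hjk hil s t := (hu.commute i j k l hij hkl hjk hil s t).map φ

theorem IsElementary.of_map {v : ι → ι → ℤ → G'} (hv : IsElementary v M) {φ : G →* G'}
    (hφ : Function.Injective φ) (h : ∀ i j, i ≠ j → ∀ t, φ (u i j t) = v i j t) :
    IsElementary u M where
  pos := hv.pos
  add i j hij s t := hφ (by rw [map_mul, h i j hij, h i j hij, h i j hij, hv.add i j hij])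
  comm i j k hij hjk hik s t := hφ (by
    rw [map_commutatorElement, h i j hij, h j k hjk, h i k hik, hv.comm i j k hij hjk hik])
  commute i j k l hij hkl hjk hil s t := by
    have := hv.commute i j k l hij hkl hjk hil s t
    rw [← h i j hij, ← h k l hkl] at this
    exact this.of_map hφ
end

section
variable {F L : Type*} [Field F] [Field L] [Algebra F L]

lemma exists_coeff_subset {S : Set F} {P : MvPolynomial (Fin 2) F}
    (hP : ∀ m ∈ P.support, coeff m P ∈ S) (x : Fin 2 → L) :
    aeval x P ∈ IntermediateField.adjoin (Subfield.closure S) (Set.range x) := by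
  rw [aeval_def, eval₂_eq']
  refine sum_mem fun m hm => mul_mem ?_ (prod_mem fun i _ => pow_mem ?_ _)
  · exact IntermediateField.algebraMap_mem _
      (⟨coeff m P, Subfield.subset_closure (hP m hm)⟩ : Subfield.closure S)
  · exact IntermediateField.subset_adjoin _ _ ⟨i, rfl⟩

/-- Finitely many automorphisms of a field of rational functions are defined over a finitely
generated field. -/
theorem exists_finset_stable {x : Fin 2 → L}
    (hfrac : ∀ f : L, ∃ P Q : MvPolynomial (Fin 2) F, aeval x Q ≠ 0 ∧ f * aeval x Q = aeval x P)
    {ι : Type*} [Fintype ι] (σ : ι → L ≃ₐ[F] L) :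
    ∃ S : Finset F, ∀ i, ∀ f ∈ IntermediateField.adjoin (Subfield.closure (S : Set F)) (Set.range x),
      σ i f ∈ IntermediateField.adjoin (Subfield.closure (S : Set F)) (Set.range x) := by
  classical
  choose P Q hQ hPQ using fun i j => hfrac (σ i (x j))
  let co : MvPolynomial (Fin 2) F → Finset F := fun P => P.support.image fun m => coeff m P
  refine ⟨Finset.univ.biUnion fun i => Finset.univ.biUnion fun j => co (P i j) ∪ co (Q i j), ?_⟩
  set S := Finset.univ.biUnion fun i => Finset.univ.biUnion fun j => co (P i j) ∪ co (Q i j) with hS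
  intro i f hf
  have hsub : ∀ j, co (P i j) ∪ co (Q i j) ⊆ S := fun j c hc => by
    rw [hS]
    simp only [Finset.mem_biUnion, Finset.mem_univ, true_and]
    exact ⟨i, j, hc⟩
  induction hf using IntermediateField.adjoin_induction with
  | mem f hf =>
    obtain ⟨j, rfl⟩ := hf
    rw [eq_div_of_mul_eq (hQ i j) (hPQ i j)]
    refine div_mem (exists_coeff_subset (fun m hm => hsub j ?_) x)
      (exists_coeff_subset (fun m hm => hsub j ?_) x)
    · exact Finset.mem_union_left _ (Finset.mem_image_of_mem _ hm)
    · exact Finset.mem_union_right _ (Finset.mem_image_of_mem _ hm)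
  | algebraMap c =>
    have : σ i (algebraMap (Subfield.closure (S : Set F)) L c) = algebraMap _ L c :=
      (σ i).commutes (c : F)
    rw [this]
    exact IntermediateField.algebraMap_mem _ c
  | add f g _ _ hf hg => rw [map_add]; exact add_mem hf hg
  | inv f _ hf => rw [map_inv₀]; exact inv_mem hf
  | mul f g _ _ hf hg => rw [map_mul]; exact mul_mem hf hg

/-- Restriction of the automorphisms preserving a subfield. -/
def restrictHom {k : Subfield F} (K : IntermediateField k L) :
    MulAction.stabilizer (L ≃ₐ[F] L) (K : Set L) →* (K ≃ₐ[k] K) :=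
  have key : ∀ σ : MulAction.stabilizer (L ≃ₐ[F] L) (K : Set L), ∀ f ∈ K, σ.1 f ∈ K :=
    fun σ f hf => by
      have h : σ.1 • (K : Set L) = K := σ.2
      have h1 : σ.1 f ∈ σ.1 • (K : Set L) := ⟨f, hf, rfl⟩
      rwa [h] at h1
  { toFun := fun σ =>
      { toFun := fun f => ⟨σ.1 f, key σ f f.2⟩
        invFun := fun f => ⟨σ.1⁻¹ f, key σ⁻¹ f f.2⟩
        left_inv := fun f => Subtype.ext (σ.1.symm_apply_apply f)
        right_inv := fun f => Subtype.ext (σ.1.apply_symm_apply f)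
        map_mul' := fun f g => Subtype.ext (map_mul σ.1 (f : L) g)
        map_add' := fun f g => Subtype.ext (map_add σ.1 (f : L) g)
        commutes' := fun c => Subtype.ext (σ.1.commutes (c : F)) }
    map_one' := rfl
    map_mul' := fun _ _ => rfl }

theorem IsElementary.exists_eq_one_of_field [CharZero F] {x : Fin 2 → L}
    (hx : AlgebraicIndependent F x)
    (hfrac : ∀ f : L, ∃ P Q : MvPolynomial (Fin 2) F, aeval x Q ≠ 0 ∧ f * aeval x Q = aeval x P)
    {ι : Type*} [Fintype ι] {u : ι → ι → ℤ → (L ≃ₐ[F] L)} {M : ℕ} (hu : IsElementary u M)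
    {i j l m : ι} (hij : i ≠ j) (hil : i ≠ l) (him : i ≠ m) (hjl : j ≠ l) (hjm : j ≠ m)
    (hlm : l ≠ m) : ∃ N : ℕ, 0 < N ∧ u i j N = 1 := by
  obtain ⟨S, hS⟩ := exists_finset_stable hfrac
    (fun r : (ι × ι) × Bool => if r.2 then u r.1.1 r.1.2 1 else (u r.1.1 r.1.2 1)⁻¹)
  set k : Subfield F := Subfield.closure (S : Set F) with hk
  set K : IntermediateField k L := IntermediateField.adjoin k (Set.range x) with hK
  have hmem : ∀ a b, u a b 1 ∈ MulAction.stabilizer (L ≃ₐ[F] L) (K : Set L) := by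
    intro a b
    rw [MulAction.mem_stabilizer_set]
    intro f
    constructor
    · intro hf
      have := hS ((a, b), false) _ hf
      simpa using! this
    · intro hf
      have := hS ((a, b), true) _ hf
      simpa using! this
  have hv : IsElementary (fun a b (t : ℤ) =>
      (⟨u a b 1, hmem a b⟩ : MulAction.stabilizer (L ≃ₐ[F] L) (K : Set L)) ^ t) M :=
    hu.of_map (φ := Subgroup.subtype _) Subtype.val_injective fun a b hab t => by
      rw [map_zpow]
      exact hu.zpow hab t
  let x' : Fin 2 → K := fun i => ⟨x i, IntermediateField.subset_adjoin _ _ ⟨i, rfl⟩⟩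
  have hval : ∀ P : MvPolynomial (Fin 2) k, ((aeval x' P : K) : L) = aeval x P := fun P => by
    have := congrArg (fun φ => φ P) (comp_aeval (R := k) x' K.val)
    exact this
  have hxk : AlgebraicIndependent k x := hx.restrictScalars (algebraMap k F).injective
  have hx' : AlgebraicIndependent k x' := by
    rw [algebraicIndependent_iff] at hxk ⊢
    intro P hP
    exact hxk P (by rw [← hval, hP]; rfl)
  have hfrac' : ∀ f : K, ∃ P Q : MvPolynomial (Fin 2) k,
      aeval x' Q ≠ 0 ∧ f * aeval x' Q = aeval x' P := by
    rintro ⟨f, hf⟩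
    obtain ⟨P, Q, h⟩ := IntermediateField.mem_adjoin_range_iff k x f |>.1 hf
    by_cases hQ : aeval x' Q = 0
    · refine ⟨0, 1, by simp, ?_⟩
      have : f = 0 := by rw [h, ← hval Q, hQ]; simp
      ext
      simp [this]
    · refine ⟨P, Q, hQ, ?_⟩
      have hQ' : aeval x Q ≠ 0 := fun h0 => hQ (Subtype.ext (by rw [hval, h0]; rfl))
      ext
      change f * ((aeval x' Q : K) : L) = ((aeval x' P : K) : L)
      rw [hval, hval, h, div_mul_cancel₀ _ hQ']
  obtain ⟨S', hS'⟩ : ∃ S' : Finset k, Subfield.closure (S' : Set k) = ⊤ := by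
    classical
    let g : S → k := fun s => ⟨s, Subfield.subset_closure s.2⟩
    refine ⟨S.attach.image g, eq_top_iff.2 ?_⟩
    set T := Subfield.closure ((S.attach.image g : Finset k) : Set k) with hT
    have h : k ≤ T.map k.subtype := Subfield.closure_le.2 fun s hs =>
      ⟨g ⟨s, hs⟩, Subfield.subset_closure (Finset.mem_coe.2
        (Finset.mem_image_of_mem g (Finset.mem_attach S ⟨s, hs⟩))), rfl⟩
    intro c _
    obtain ⟨d, hd, hdc⟩ := h c.2
    rwa [← Subtype.ext hdc]
  obtain ⟨N, hN, h⟩ := (hv.map (restrictHom K)).exists_eq_one hS' hx' hfrac' hij hil him hjl hjm hlm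
  refine ⟨N, hN, ?_⟩
  rw [← hu.zpow hij]
  generalize hτ : u i j 1 ^ (N : ℤ) = τ
  have hfix : ∀ a, τ (x a) = x a := fun a => by
    have h1 := congrArg (fun σ => ((σ (x' a) : K) : L)) h
    rw [← hτ]
    exact h1
  have hfix' : ∀ P : MvPolynomial (Fin 2) F, τ (aeval x P) = aeval x P := fun P => by
    have := congrArg (fun φ => φ P) (comp_aeval (R := F) x τ.toAlgHom)
    refine this.trans ?_
    congr 2
    exact funext hfix
  ext f
  obtain ⟨P, Q, hQ, hPQ⟩ := hfrac f
  apply mul_right_cancel₀ hQ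
  change τ f * aeval x Q = f * aeval x Q
  rw [hPQ]
  conv_lhs => rw [← hfix' Q]
  rw [← map_mul, hPQ, hfix']
end

end PointCount

namespace SLn
open Matrix PointCount
open scoped commutatorElement

variable {ι : Type*} [Fintype ι] [DecidableEq ι]

theorem isElementary_elem {M : ℕ} (hM : 0 < M) :
    IsElementary (fun (i j : ι) (t : ℤ) => if h : i ≠ j then elem h (M * t) else 1) M where
  pos := hM
  add i j h s t := by
    simp only [dif_pos h, mul_add]
    exact SpecialLinearGroup.transvection_add h _ _
  comm i j k hij hjk hik s t := by
    simp only [dif_pos hij, dif_pos hjk, dif_pos hik]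
    rw [commutator_elem hij hjk hik]
    congr 1
    ring
  commute i j k l hij hkl hjk hil s t := by
    simp only [dif_pos hij, dif_pos hkl]
    exact commute_elem hij hkl hjk hil _ _

theorem exists_elem_mem (Γ : Subgroup (SpecialLinearGroup ι ℤ)) (hΓ : Γ.FiniteIndex) :
    ∃ M : ℕ, 0 < M ∧ ∀ (i j : ι) (h : i ≠ j) (t : ℤ), elem h (M * t) ∈ Γ := by
  refine ⟨Γ.index.factorial, Nat.factorial_pos _, fun i j h t => ?_⟩
  obtain ⟨n, hn, hn', hmem⟩ := Γ.exists_pow_mem_of_index_ne_zero hΓ.index_ne_zero (elem h 1)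
  obtain ⟨q, hq⟩ := Nat.dvd_factorial hn hn'
  rw [← zpow_natCast, elem_zpow, mul_one] at hmem
  have := Γ.zpow_mem hmem (q * t)
  rw [elem_zpow] at this
  rw [hq]
  convert this using 2
  push_cast
  ring

theorem exists_isElementary (Γ : Subgroup (SpecialLinearGroup ι ℤ)) (hΓ : Γ.FiniteIndex) :
    ∃ (M : ℕ) (u : ι → ι → ℤ → Γ), IsElementary u M ∧
      ∀ (i j : ι) (h : i ≠ j) (t : ℤ), (u i j t : SpecialLinearGroup ι ℤ) = elem h (M * t) := by
  obtain ⟨M, hM, hmem⟩ := exists_elem_mem Γ hΓ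
  let u : ι → ι → ℤ → Γ := fun i j t => if h : i ≠ j then ⟨elem h (M * t), hmem i j h t⟩ else 1
  have hu : ∀ (i j : ι) (h : i ≠ j) (t : ℤ), (u i j t : SpecialLinearGroup ι ℤ) = elem h (M * t) :=
    fun i j h t => by simp only [u, dif_pos h]
  refine ⟨M, u, (isElementary_elem hM).of_map (φ := Γ.subtype) Subtype.val_injective
    fun i j h t => ?_, hu⟩
  rw [dif_pos h]
  exact hu i j h t

/-- A homomorphism from a finite-index subgroup of `SL(n, ℤ)`, `n ≥ 4`, to the automorphism group
of a field of rational functions in two variables has finite image. -/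
theorem finite_range_of_algEquiv {F L : Type*} [Field F] [CharZero F] [Field L] [Algebra F L]
    {x : Fin 2 → L} (hx : AlgebraicIndependent F x)
    (hfrac : ∀ f : L, ∃ P Q : MvPolynomial (Fin 2) F,
      MvPolynomial.aeval x Q ≠ 0 ∧ f * MvPolynomial.aeval x Q = MvPolynomial.aeval x P)
    (hcard : 4 ≤ Fintype.card ι) (Γ : Subgroup (SpecialLinearGroup ι ℤ)) (hΓ : Γ.FiniteIndex)
    (ρ : Γ →* (L ≃ₐ[F] L)) : (Set.range ρ).Finite := by
  refine finite_range_of_elem_mem_ker (by omega) (fun Γ hΓ ρ i j hij => ?_) Γ hΓ ρ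
  obtain ⟨M, u, hu, hcoe⟩ := exists_isElementary Γ hΓ
  have hthird : ∀ s : Finset ι, s.card ≤ 3 → ∃ l, l ∉ s := fun s hs => by
    by_contra! h
    have : s = Finset.univ := Finset.eq_univ_iff_forall.2 h
    rw [this, Finset.card_univ] at hs
    omega
  obtain ⟨l, hl⟩ := hthird {i, j} (Finset.card_le_two.trans (by norm_num))
  obtain ⟨m, hm⟩ := hthird {i, j, l} Finset.card_le_three
  simp only [Finset.mem_insert, Finset.mem_singleton, not_or] at hl hm
  obtain ⟨N, hN, h⟩ := (hu.map ρ).exists_eq_one_of_field hx hfrac hij (Ne.symm hl.1) (Ne.symm hm.1)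
    (Ne.symm hl.2) (Ne.symm hm.2.1) (Ne.symm hm.2.2)
  have h1 : (u i j N : SpecialLinearGroup ι ℤ) = elem hij ((M * N : ℕ) : ℤ) := by
    rw [hcoe i j hij]
    push_cast
    rfl
  refine ⟨M * N, Nat.mul_pos hu.pos hN, h1 ▸ (u i j N).2, ?_⟩
  rw [← h]
  congr 1
  exact Subtype.ext h1.symm

end SLn

/-- For `n ≥ 4`, every group homomorphism from a finite-index subgroup of `SL(n,ℤ)` into
the plane Cremona group `Bir(ℙ²_ℂ) = Aut_ℂ(ℂ(x,y))` has finite image. -/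
theorem sl_n_finite_image (n : ℕ) (hn : 4 ≤ n)
    (Γ : Subgroup (Matrix.SpecialLinearGroup (Fin n) ℤ)) (hΓ : Γ.FiniteIndex)
    (ρ : ↥Γ →* Cremona2) : (Set.range ρ).Finite := by
  let x : Fin 2 → K2 := fun i => algebraMap (MvPolynomial (Fin 2) ℂ) K2 (MvPolynomial.X i)
  have hval : ∀ P : MvPolynomial (Fin 2) ℂ,
      MvPolynomial.aeval x P = algebraMap (MvPolynomial (Fin 2) ℂ) K2 P := fun P => by
    have h : MvPolynomial.aeval x = IsScalarTower.toAlgHom ℂ (MvPolynomial (Fin 2) ℂ) K2 := by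
      ext i
      simp [x]
    rw [h]
    rfl
  have hinj := IsFractionRing.injective (MvPolynomial (Fin 2) ℂ) K2
  refine SLn.finite_range_of_algEquiv (x := x) ?_ (fun f => ?_) (by simpa using hn) Γ hΓ ρ
  · rw [algebraicIndependent_iff]
    intro P hP
    rw [hval] at hP
    exact (map_eq_zero_iff _ hinj).1 hP
  · obtain ⟨⟨P, Q⟩, h⟩ := IsLocalization.surj (nonZeroDivisors (MvPolynomial (Fin 2) ℂ)) f
    refine ⟨P, Q, ?_, ?_⟩
    · rw [hval]
      exact fun h0 => nonZeroDivisors.ne_zero Q.2 ((map_eq_zero_iff _ hinj).1 h0)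
    · rw [hval, hval]
      exact h
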